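/- Let rank L = d+1. The equality (−1)^d · χ(X) = deg ℛ_L between the signed Euler characteristic of the arrangement complement and the degree of the reciprocal linear space holds if and only if rank(A_I^⊤) = rank(L_I) for every flat I of M(L) except I = {0,…,n}. -/

import Mathlib

open scoped BigOperators
noncomputable section

namespace ScatteringPaper

open CategoryTheory AlgebraicTopology

/- ## Topological Euler characteristic via rational singular homology -/

/-- The singular chain complex of a topological space, with rational coefficients. -/
def singularChainComplex (X : Type) [TopologicalSpace X] : ChainComplex (ModuleCat ℚ) ℕ :=
  (alternatingFaceMapComplex (ModuleCat ℚ)).obj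
    (((SimplicialObject.whiskering _ _).obj (ModuleCat.free ℚ)).obj (TopCat.toSSet.obj (TopCat.of X)))

/-- The `q`-th (rational) Betti number of a topological space. -/
def betti (X : Type) [TopologicalSpace X] (q : ℕ) : ℕ :=
  Module.finrank ℚ ((singularChainComplex X).homology q)

/-- The topological Euler characteristic, as the alternating sum of Betti numbers. -/
def eulerChar (X : Type) [TopologicalSpace X] : ℤ :=
  ∑ᶠ q : ℕ, (-1 : ℤ) ^ q * (betti X q : ℤ)

variable {d : ℕ} {ι : Type} [Fintype ι] [DecidableEq ι]

/- ## Hyperplane arrangements: `(ℓ_i(x))_i = (1, x_1, …, x_d) · L` -/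

/-- Value of the affine-linear form encoded by column `i` of `L`. -/
def ell (K : Type) [Field K] (L : Matrix (Fin (d+1)) ι K) (x : Fin d → K) (i : ι) : K :=
  L 0 i + ∑ j : Fin d, x j * L j.succ i

/-- The complement `X = ℂ^d ∖ 𝒜` of the arrangement `𝒜 = V(∏ ℓ_i)`. -/
def complementX (L : Matrix (Fin (d+1)) ι ℂ) : Set (Fin d → ℂ) := {x | ∀ i, ell ℂ L x i ≠ 0}

/-- `x ∈ X` is a solution of the scattering equations
`∂ℒ_u/∂x_k = ∑_i u_i a_{ki}/ℓ_i(x) = 0`, `k = 1, …, d`. -/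
def IsSol (L : Matrix (Fin (d+1)) ι ℂ) (u : ι → ℂ) (x : Fin d → ℂ) : Prop :=
  x ∈ complementX L ∧ ∀ k : Fin d, ∑ i : ι, u i * L k.succ i / ell ℂ L x i = 0

/-- An arrangement is essential if some subset of its hyperplanes meets in a single point. -/
def IsEssential (L : Matrix (Fin (d+1)) ι ℂ) : Prop :=
  ∃ (S : Set ι) (x₀ : Fin d → ℂ), {x : Fin d → ℂ | ∀ i ∈ S, ell ℂ L x i = 0} = {x₀}

/-- `P u` holds for all `u` outside a proper algebraic subset (i.e. for generic `u`). -/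
def Generically {σ : Type} [Fintype σ] [DecidableEq σ] (P : (σ → ℂ) → Prop) : Prop :=
  ∃ g : MvPolynomial σ ℂ, g ≠ 0 ∧ ∀ u : σ → ℂ, MvPolynomial.eval u g ≠ 0 → P u

/- ## Matroid data of the columns of `L` -/

/-- Rank of the set `I` of columns of `L` (the matroid rank in `M(L)`). -/
def rkL (K : Type) [Field K] (L : Matrix (Fin (d+1)) ι K) (I : Set ι) : ℕ :=
  Module.finrank K (Submodule.span K ((fun i => fun r => L r i) '' I))

/-- Rank of the set `I` of columns of `A^⊤` (`L` with its first row deleted). -/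
def rkA (K : Type) [Field K] (L : Matrix (Fin (d+1)) ι K) (I : Set ι) : ℕ :=
  Module.finrank K (Submodule.span K ((fun i => fun k : Fin d => L k.succ i) '' I))

/-- `I` is a flat of the matroid `M(L)`. -/
def IsFlat (K : Type) [Field K] (L : Matrix (Fin (d+1)) ι K) (I : Set ι) : Prop :=
  ∀ i ∉ I, rkL K L I < rkL K L (insert i I)

/-- `C` is a circuit of `M(L)`: a minimal linearly dependent set of columns. -/
def IsCircuit (K : Type) [Field K] (L : Matrix (Fin (d+1)) ι K) (C : Finset ι) : Prop :=
  (¬ LinearIndependent K (fun i : {a // a ∈ C} => fun r => L r i.1)) ∧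
  ∀ D : Finset ι, D ⊂ C → LinearIndependent K (fun i : {a // a ∈ D} => fun r => L r i.1)

/-- `M(L)` is connected: there is no separation into two nonempty parts with additive rank. -/
def MatroidConnected (K : Type) [Field K] (L : Matrix (Fin (d+1)) ι K) : Prop :=
  ∀ S : Set ι, S.Nonempty → Sᶜ.Nonempty → rkL K L S + rkL K L Sᶜ ≠ rkL K L Set.univ

/- ## The reciprocal linear space -/

/-- Zariski closure of a subset of affine space `K^ι`. -/
def zarClosure (K : Type) [Field K] (S : Set (ι → K)) : Set (ι → K) :=
  {v | ∀ f : MvPolynomial ι K, (∀ w ∈ S, MvPolynomial.eval w f = 0) → MvPolynomial.eval v f = 0}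

/-- The affine cone over the image of `φ : x ↦ (ℓ_0(x)⁻¹ : ⋯ : ℓ_n(x)⁻¹)`. -/
def coneImage (L : Matrix (Fin (d+1)) ι ℂ) : Set (ι → ℂ) :=
  {v | ∃ (c : ℂ) (x : Fin d → ℂ), x ∈ complementX L ∧ v = fun i => c / ell ℂ L x i}

/-- The vanishing ideal of a subset of affine space. -/
def vanishingIdeal (K : Type) [Field K] (S : Set (ι → K)) : Ideal (MvPolynomial ι K) where
  carrier := {f | ∀ v ∈ S, MvPolynomial.eval v f = 0}
  add_mem' := by
    intro a b ha hb v hv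
    simp [map_add, ha v hv, hb v hv]
  zero_mem' := by intro v hv; simp
  smul_mem' := by
    intro c f hf v hv
    simp [smul_eq_mul, map_mul, hf v hv]

/-- Projective space `ℙ^n = ℙ(ℂ^ι)`. -/
abbrev Pn (ι : Type) [Fintype ι] := Projectivization ℂ (ι → ℂ)

/-- The reciprocal linear space `ℛ_L ⊂ ℙ^n`, the Zariski closure of `im φ`. -/
def RL (L : Matrix (Fin (d+1)) ι ℂ) : Set (Pn ι) :=
  {p | p.rep ∈ zarClosure ℂ (coneImage L)}

/-- The linear space `𝕃_u = {y : A^⊤ diag(u) y = 0} ⊂ ℙ^n`. -/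
def LuSet (L : Matrix (Fin (d+1)) ι ℂ) (u : ι → ℂ) : Set (Pn ι) :=
  {p | ∀ k : Fin d, ∑ i : ι, L k.succ i * u i * p.rep i = 0}

/-- The torus orbit `U_I = {y ∈ ℙ^n : y_i ≠ 0 ⇔ i ∈ I}`. -/
def Ustratum (I : Set ι) : Set (Pn ι) := {p : Pn ι | ∀ i : ι, p.rep i ≠ 0 ↔ i ∈ I}

/-- `p = φ(x)` for the map `φ : x ↦ (ℓ_0(x)⁻¹ : ⋯ : ℓ_n(x)⁻¹)`. -/
def PhiRel (L : Matrix (Fin (d+1)) ι ℂ) (x : Fin d → ℂ) (p : Pn ι) : Prop :=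
  ∃ hv : (fun i => (ell ℂ L x i)⁻¹) ≠ 0, p = Projectivization.mk ℂ (fun i => (ell ℂ L x i)⁻¹) hv

/-- The image of `φ` in `ℙ^n`. -/
def imPhi (L : Matrix (Fin (d+1)) ι ℂ) : Set (Pn ι) :=
  {p | ∃ x ∈ complementX L, PhiRel L x p}

/-- Complement of the subarrangement `𝒜_I`. -/
def subComplement (L : Matrix (Fin (d+1)) ι ℂ) (I : Set ι) : Set (Fin d → ℂ) :=
  {x | ∀ i ∈ I, ell ℂ L x i ≠ 0}

/-- The affine cone over the image of the reciprocal map of the subarrangement indexed by `I`,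
embedded in the coordinate subspace `{y_i = 0, i ∉ I}`. -/
def coneImageSub (L : Matrix (Fin (d+1)) ι ℂ) (I : Set ι) : Set (ι → ℂ) :=
  {v | ∃ (c : ℂ) (x : Fin d → ℂ), x ∈ subComplement L I ∧
      v = I.indicator (fun i => c / ell ℂ L x i)}

/-- The reciprocal linear space `ℛ_{L_I}` of the submatrix `L_I`, embedded in `ℙ^n`. -/
def RLsub (L : Matrix (Fin (d+1)) ι ℂ) (I : Set ι) : Set (Pn ι) :=
  {p | p.rep ∈ zarClosure ℂ (coneImageSub L I)}

/-- The open stratum `ℛ_{L_I}^∘ = ℛ_{L_I} ∩ U_I`. -/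
def RLsubOpen (L : Matrix (Fin (d+1)) ι ℂ) (I : Set ι) : Set (Pn ι) :=
  RLsub L I ∩ Ustratum I

/- ## The very affine variety `X_I = (ℂ^d ∖ 𝒜_I)/K_I` -/

/-- Quotient of `ℂ^d ∖ 𝒜_I` by translation by the left kernel `K_I` of `A_I^⊤`:
two points are identified iff `A_I^⊤` takes the same values on them. -/
def XIsetoid (L : Matrix (Fin (d+1)) ι ℂ) (I : Set ι) : Setoid ↥(subComplement L I) where
  r x y := ∀ i ∈ I, ∑ k : Fin d, (x : Fin d → ℂ) k * L k.succ i
      = ∑ k : Fin d, (y : Fin d → ℂ) k * L k.succ i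
  iseqv := ⟨fun _ _ _ => rfl, fun h i hi => (h i hi).symm, fun h1 h2 i hi => (h1 i hi).trans (h2 i hi)⟩

/-- The very affine variety `X_I = (ℂ^d ∖ 𝒜_I)/K_I`. -/
def XI (L : Matrix (Fin (d+1)) ι ℂ) (I : Set ι) : Type := Quotient (XIsetoid L I)

instance (L : Matrix (Fin (d+1)) ι ℂ) (I : Set ι) : TopologicalSpace (XI L I) :=
  instTopologicalSpaceQuotient

/-- The complement of the arrangement, over a general field `K`. -/
def complementK (K : Type) [Field K] (L : Matrix (Fin (d+1)) ι K) : Set (Fin d → K) :=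
  {x | ∀ i, ell K L x i ≠ 0}

/-- The affine cone over the image of the reciprocal map, over a general field `K`. -/
def coneImageK (K : Type) [Field K] (L : Matrix (Fin (d+1)) ι K) : Set (ι → K) :=
  {v | ∃ (c : K) (x : Fin d → K), x ∈ complementK K L ∧ v = fun i => c / ell K L x i}

/- ## Hilbert functions, degree, Hilbert regularity -/

/-- The Hilbert function of the graded algebra `K[y]/I`:
`q ↦ dim_K (K[y]/I)_q`. -/
def hilb (K : Type) [Field K] (I : Ideal (MvPolynomial ι K)) (q : ℕ) : ℕ :=
  Module.finrank K ((MvPolynomial.homogeneousSubmodule ι K q).map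
    (Ideal.Quotient.mkₐ K I).toLinearMap)

/-- `k` is the degree of the `d`-dimensional projective variety with homogeneous
coordinate ring `K[y]/I`: the Hilbert polynomial has degree `d` and leading
coefficient `k/d!`. -/
def IsProjDegree (K : Type) [Field K] (I : Ideal (MvPolynomial ι K)) (d k : ℕ) : Prop :=
  ∃ P : Polynomial ℚ, (∃ N : ℕ, ∀ q : ℕ, N ≤ q → Polynomial.eval (q : ℚ) P = hilb K I q) ∧
    P.degree = (d : WithBot ℕ) ∧ P.leadingCoeff = (k : ℚ) / (Nat.factorial d : ℚ)

/-- The Hilbert function, extended by `0` to negative integers. -/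
def HFZ (K : Type) [Field K] (I : Ideal (MvPolynomial ι K)) (q : ℤ) : ℕ :=
  if 0 ≤ q then hilb K I q.toNat else 0

/-- The Hilbert regularity: the smallest degree from which the Hilbert function
agrees with a (necessarily unique) polynomial. -/
def HReg (K : Type) [Field K] (I : Ideal (MvPolynomial ι K)) : ℤ :=
  sInf {i : ℤ | ∃ P : Polynomial ℚ, ∀ q : ℤ, i ≤ q → Polynomial.eval (q : ℚ) P = HFZ K I q}

namespace Sd

/-- chains of vertex tuples -/
abbrev A (K : Type) (m : ℕ) := (Fin m → K) →₀ ℚ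

variable {K K' : Type}

def sg {m : ℕ} (v : Fin m → K) : A K m := Finsupp.single v 1

def bd (m : ℕ) : A K (m+1) →ₗ[ℚ] A K m :=
  Finsupp.linearCombination ℚ (fun v => ∑ i : Fin (m+1), ((-1:ℚ)^(i:ℕ)) • sg (v ∘ i.succAbove))

def cone (b : K) (m : ℕ) : A K m →ₗ[ℚ] A K (m+1) :=
  Finsupp.linearCombination ℚ (fun v => sg (Fin.cons b v))

@[simp] lemma bd_sg {m : ℕ} (v : Fin (m+1) → K) :
    bd m (sg v) = ∑ i : Fin (m+1), ((-1:ℚ)^(i:ℕ)) • sg (v ∘ i.succAbove) := by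
  simp [bd, sg]

@[simp] lemma cone_sg (b : K) {m : ℕ} (v : Fin m → K) :
    cone b m (sg v) = sg (Fin.cons b v) := by
  simp [cone, sg]

lemma A_ext {M : Type*} [AddCommMonoid M] [Module ℚ M] {m : ℕ} {f g : A K m →ₗ[ℚ] M}
    (h : ∀ v, f (sg v) = g (sg v)) : f = g := by
  apply Finsupp.lhom_ext'
  intro v
  ext
  exact h v

lemma cons_zero_succAbove (b : K) {m : ℕ} (v : Fin m → K) :
    (Fin.cons b v : Fin (m+1) → K) ∘ (0 : Fin (m+1)).succAbove = v := by
  ext i; simp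

lemma cons_succ_succAbove (b : K) {m : ℕ} (v : Fin (m+1) → K) (i : Fin (m+1)) :
    (Fin.cons b v : Fin (m+2) → K) ∘ (i.succ).succAbove = Fin.cons b (v ∘ i.succAbove) := by
  ext j
  refine Fin.cases ?_ (fun j => ?_) j
  · simp
  · simp

lemma bd_cone_zero (b : K) (x : A K 0) : bd 0 (cone b 0 x) = x := by
  have : (bd 0) ∘ₗ (cone b 0) = LinearMap.id := by
    apply A_ext
    intro v
    simp

  exact LinearMap.congr_fun this x

lemma bd_cone_succ (b : K) (m : ℕ) (x : A K (m+1)) :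
    bd (m+1) (cone b (m+1) x) = x - cone b m (bd m x) := by
  have : (bd (m+1)) ∘ₗ (cone b (m+1)) = LinearMap.id - (cone b m) ∘ₗ (bd m) := by
    apply A_ext
    intro v
    simp only [LinearMap.comp_apply, cone_sg, bd_sg, LinearMap.sub_apply, LinearMap.id_apply]
    rw [Fin.sum_univ_succ, map_sum, sub_eq_add_neg, ← Finset.sum_neg_distrib]
    congr 1
    · rw [cons_zero_succAbove]; simp
    · apply Finset.sum_congr rfl
      intro i _
      rw [cons_succ_succAbove]
      simp [pow_succ]
  exact LinearMap.congr_fun this x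

lemma bd_bd (m : ℕ) (x : A K (m+2)) : bd m (bd (m+1) x) = 0 := by
  have : (bd (K := K) m) ∘ₗ (bd (m+1)) = 0 := by
    clear x
    induction m with
    | zero =>
      apply A_ext
      intro v
      have : sg v = cone (v 0) 1 (sg (Fin.tail v)) := by simp
      rw [this, LinearMap.comp_apply, bd_cone_succ, map_sub, bd_cone_zero]
      simp
    | succ m ih =>
      apply A_ext
      intro v
      have : sg v = cone (v 0) _ (sg (Fin.tail v)) := by simp
      rw [this, LinearMap.comp_apply, bd_cone_succ, map_sub, bd_cone_succ,
        show bd m (bd (m+1) (sg (Fin.tail v))) = 0 from LinearMap.congr_fun ih _]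
      simp
  exact LinearMap.congr_fun this x

/-- A barycenter structure. -/
abbrev Bary (K : Type) := ∀ m : ℕ, (Fin (m+1) → K) → K

def sd (β : Bary K) : (m : ℕ) → A K m →ₗ[ℚ] A K m
  | 0 => LinearMap.id
  | m+1 => Finsupp.linearCombination ℚ (fun v => cone (β m v) m (sd β m (bd m (sg v))))

def hT (β : Bary K) : (m : ℕ) → A K m →ₗ[ℚ] A K (m+1)
  | 0 => 0
  | m+1 => Finsupp.linearCombination ℚ
      (fun v => cone (β m v) (m+1) (sg v - hT β m (bd m (sg v))))

lemma sd_sg (β : Bary K) {m : ℕ} (v : Fin (m+1) → K) :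
    sd β (m+1) (sg v) = cone (β m v) m (sd β m (bd m (sg v))) := by
  conv_lhs => rw [sd, sg]
  simp

lemma hT_sg (β : Bary K) {m : ℕ} (v : Fin (m+1) → K) :
    hT β (m+1) (sg v) = cone (β m v) (m+1) (sg v - hT β m (bd m (sg v))) := by
  conv_lhs => rw [hT, sg]
  simp

lemma bd_sd (β : Bary K) (m : ℕ) (x : A K (m+1)) :
    bd m (sd β (m+1) x) = sd β m (bd m x) := by
  have : (bd m) ∘ₗ (sd β (m+1)) = sd β m ∘ₗ bd m := by
    clear x
    induction m with
    | zero =>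
      apply A_ext
      intro v
      rw [LinearMap.comp_apply, sd_sg, bd_cone_zero]
      rfl
    | succ m ih =>
      apply A_ext
      intro v
      rw [LinearMap.comp_apply, sd_sg, bd_cone_succ]
      have h := LinearMap.congr_fun ih (bd (m+1) (sg v))
      simp only [LinearMap.comp_apply] at h
      rw [h, bd_bd]
      simp
  exact LinearMap.congr_fun this x

lemma bd_hT_zero (β : Bary K) (x : A K 0) : bd 0 (hT β 0 x) = 0 := by
  simp [hT]

lemma bd_hT (β : Bary K) (m : ℕ) (x : A K (m+1)) :
    bd (m+1) (hT β (m+1) x) = x - sd β (m+1) x - hT β m (bd m x) := by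
  have : (bd (m+1)) ∘ₗ (hT β (m+1)) =
      LinearMap.id - sd β (m+1) - hT β m ∘ₗ bd m := by
    clear x
    induction m with
    | zero =>
      apply A_ext
      intro v
      rw [LinearMap.comp_apply, hT_sg, bd_cone_succ]
      simp only [LinearMap.sub_apply, LinearMap.comp_apply, LinearMap.id_apply, hT,
        LinearMap.zero_apply, sub_zero, sd_sg]
      rfl
    | succ m ih =>
      apply A_ext
      intro v
      rw [LinearMap.comp_apply, hT_sg, bd_cone_succ]
      have h := LinearMap.congr_fun ih (bd (m+1) (sg v))
      simp only [LinearMap.comp_apply, LinearMap.sub_apply, LinearMap.id_apply] at h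
      simp only [LinearMap.sub_apply, LinearMap.comp_apply, LinearMap.id_apply]
      rw [map_sub, h, bd_bd, map_zero, sub_zero, sd_sg]
      simp only [sub_sub_cancel]
      abel
  exact LinearMap.congr_fun this x

/-- pushforward of tuples -/
def mp (f : K → K') (m : ℕ) : A K m →ₗ[ℚ] A K' m := Finsupp.lmapDomain ℚ ℚ (fun v => f ∘ v)

@[simp] lemma mp_sg (f : K → K') {m : ℕ} (v : Fin m → K) : mp f m (sg v) = sg (f ∘ v) := by
  simp [mp, sg]

lemma mp_bd (f : K → K') (m : ℕ) (x : A K (m+1)) : mp f m (bd m x) = bd m (mp f (m+1) x) := by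
  have : mp f m ∘ₗ bd m = bd m ∘ₗ mp f (m+1) := by
    apply A_ext
    intro v
    simp [Function.comp_assoc]
  exact LinearMap.congr_fun this x

lemma mp_cone (f : K → K') (b : K) (m : ℕ) (x : A K m) :
    mp f (m+1) (cone b m x) = cone (f b) m (mp f m x) := by
  have : mp f (m+1) ∘ₗ cone b m = cone (f b) m ∘ₗ mp f m := by
    apply A_ext
    intro v
    simp only [LinearMap.comp_apply, cone_sg, mp_sg]
    congr 1
    ext i
    refine Fin.cases ?_ (fun j => ?_) i <;> simp
  exact LinearMap.congr_fun this x

lemma mp_sd (β : Bary K) (β' : Bary K') (f : K → K') (hf : ∀ m v, f (β m v) = β' m (f ∘ v))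
    (m : ℕ) (x : A K m) : mp f m (sd β m x) = sd β' m (mp f m x) := by
  have : mp f m ∘ₗ sd β m = sd β' m ∘ₗ mp f m := by
    clear x
    induction m with
    | zero => rfl
    | succ m ih =>
      apply A_ext
      intro v
      have h := LinearMap.congr_fun ih (bd m (sg v))
      simp only [LinearMap.comp_apply] at h
      rw [LinearMap.comp_apply, LinearMap.comp_apply, mp_sg, sd_sg, sd_sg, mp_cone, h, hf, mp_bd,
        mp_sg]
  exact LinearMap.congr_fun this x

lemma mp_hT (β : Bary K) (β' : Bary K') (f : K → K') (hf : ∀ m v, f (β m v) = β' m (f ∘ v))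
    (m : ℕ) (x : A K m) : mp f (m+1) (hT β m x) = hT β' m (mp f m x) := by
  have : mp f (m+1) ∘ₗ hT β m = hT β' m ∘ₗ mp f m := by
    clear x
    induction m with
    | zero => simp [hT]
    | succ m ih =>
      apply A_ext
      intro v
      have h := LinearMap.congr_fun ih (bd m (sg v))
      simp only [LinearMap.comp_apply] at h
      rw [LinearMap.comp_apply, LinearMap.comp_apply, mp_sg, hT_sg, hT_sg, mp_cone, map_sub, h, hf,
        mp_bd, mp_sg]
  exact LinearMap.congr_fun this x

end Sd

namespace Sd

abbrev Dl (n : ℕ) := stdSimplex ℝ (Fin (n+1))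

/-- affine simplex with given vertices -/
def aff {m n : ℕ} (v : Fin (m+1) → Dl n) : C(Dl m, Dl n) where
  toFun t := ⟨∑ i, (t : Fin (m+1) → ℝ) i • (v i : Fin (n+1) → ℝ),
    (convex_stdSimplex ℝ (Fin (n+1))).sum_mem (fun i _ => t.2.1 i) t.2.2 (fun i _ => (v i).2)⟩
  continuous_toFun := by
    apply Continuous.subtype_mk
    refine continuous_finsetSum _ (fun i _ => ?_)
    exact ((continuous_apply i).comp continuous_subtype_val).smul continuous_const

lemma aff_coe {m n : ℕ} (v : Fin (m+1) → Dl n) (t : Dl m) :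
    ((aff v t : Dl n) : Fin (n+1) → ℝ) =
      ∑ i, (t : Fin (m+1) → ℝ) i • (v i : Fin (n+1) → ℝ) := rfl

/-- vertices -/
def vx (n : ℕ) : Fin (n+1) → Dl n := fun i => ⟨Pi.single i 1, single_mem_stdSimplex ℝ i⟩

lemma aff_vx (n : ℕ) : aff (vx n) = ContinuousMap.id _ := by
  ext t j
  rw [aff_coe, Finset.sum_apply, Finset.sum_eq_single j]
  · change (t : Fin (n+1) → ℝ) j * (Pi.single j (1:ℝ) : Fin (n+1) → ℝ) j = (t : Fin (n+1) → ℝ) j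
    simp
  · intro b _ hb
    change (t : Fin (n+1) → ℝ) b * (Pi.single b (1:ℝ) : Fin (n+1) → ℝ) j = 0
    rw [Pi.single_eq_of_ne (Ne.symm hb), mul_zero]
  · simp

lemma aff_apply_vx {m n : ℕ} (v : Fin (m+1) → Dl n) (i : Fin (m+1)) : aff v (vx m i) = v i := by
  ext j
  rw [aff_coe, Finset.sum_apply, Finset.sum_eq_single i]
  · change (Pi.single i (1:ℝ) : Fin (m+1) → ℝ) i * (v i : Fin (n+1) → ℝ) j = (v i : Fin (n+1) → ℝ) j
    simp
  · intro b _ hb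
    change (Pi.single i (1:ℝ) : Fin (m+1) → ℝ) b * (v b : Fin (n+1) → ℝ) j = 0
    rw [Pi.single_eq_of_ne hb, zero_mul]
  · simp

lemma aff_comp {l m n : ℕ} (w : Fin (m+1) → Dl n) (v : Fin (l+1) → Dl m) :
    (aff w).comp (aff v) = aff (aff w ∘ v) := by
  ext t j
  simp only [aff_coe, ContinuousMap.comp_apply, Finset.sum_apply, Pi.smul_apply, smul_eq_mul,
    Function.comp]
  simp only [Finset.sum_mul, Finset.mul_sum]
  rw [Finset.sum_comm]
  refine Finset.sum_congr rfl (fun i _ => Finset.sum_congr rfl (fun k _ => by ring))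

def bc (m : ℕ) : Dl m := ⟨fun _ => (1 : ℝ) / (m+1), by
  constructor
  · intro i; positivity
  · simp; field_simp⟩

def bry (n : ℕ) : Bary (Dl n) := fun m v => aff v (bc m)

lemma aff_bry {m n : ℕ} (w : Fin (m+1) → Dl n) (k : ℕ) (v : Fin (k+1) → Dl m) :
    aff w (bry m k v) = bry n k (aff w ∘ v) := by
  unfold bry
  rw [← aff_comp]; rfl

variable {V : Type} [TopologicalSpace V]

abbrev Ch (V : Type) [TopologicalSpace V] (n : ℕ) := C(Dl n, V) →₀ ℚ

def sgc {n : ℕ} (σ : C(Dl n, V)) : Ch V n := Finsupp.single σ 1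

lemma Ch_ext {M : Type*} [AddCommMonoid M] [Module ℚ M] {m : ℕ} {f g : Ch V m →ₗ[ℚ] M}
    (h : ∀ v, f (sgc v) = g (sgc v)) : f = g := by
  apply Finsupp.lhom_ext'
  intro v
  ext
  exact h v

def push {n : ℕ} (σ : C(Dl n, V)) (m : ℕ) : A (Dl n) (m+1) →ₗ[ℚ] Ch V m :=
  Finsupp.lmapDomain ℚ ℚ (fun v => σ.comp (aff v))

@[simp] lemma push_sg {n : ℕ} (σ : C(Dl n, V)) {m : ℕ} (v : Fin (m+1) → Dl n) :
    push σ m (sg v) = sgc (σ.comp (aff v)) := by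
  simp [push, sg, sgc]

def dC (n : ℕ) : Ch V (n+1) →ₗ[ℚ] Ch V n :=
  Finsupp.linearCombination ℚ (fun σ => push σ n (bd (n+1) (sg (vx (n+1)))))

def sdC (n : ℕ) : Ch V n →ₗ[ℚ] Ch V n :=
  Finsupp.linearCombination ℚ (fun σ => push σ n (sd (bry n) (n+1) (sg (vx n))))

def hTC (n : ℕ) : Ch V n →ₗ[ℚ] Ch V (n+1) :=
  Finsupp.linearCombination ℚ (fun σ => push σ (n+1) (hT (bry n) (n+1) (sg (vx n))))

lemma dC_sgc {n : ℕ} (σ : C(Dl (n+1), V)) :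
    dC n (sgc σ) = push σ n (bd (n+1) (sg (vx (n+1)))) := by simp [dC, sgc]

lemma sdC_sgc {n : ℕ} (σ : C(Dl n, V)) :
    sdC n (sgc σ) = push σ n (sd (bry n) (n+1) (sg (vx n))) := by simp [sdC, sgc]

lemma hTC_sgc {n : ℕ} (σ : C(Dl n, V)) :
    hTC n (sgc σ) = push σ (n+1) (hT (bry n) (n+1) (sg (vx n))) := by simp [hTC, sgc]

lemma push_comp {m n : ℕ} (σ : C(Dl n, V)) (v : Fin (m+1) → Dl n) (k : ℕ) (a : A (Dl m) (k+1)) :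
    push (σ.comp (aff v)) k a = push σ k (mp (aff v) (k+1) a) := by
  have : push (σ.comp (aff v)) k = push σ k ∘ₗ mp (aff v) (k+1) := by
    apply A_ext
    intro w
    simp [ContinuousMap.comp_assoc, aff_comp]
  exact LinearMap.congr_fun this a

lemma aff_comp_vx {m n : ℕ} (v : Fin (m+1) → Dl n) : aff v ∘ vx m = v := by
  ext1 i; exact aff_apply_vx v i

lemma dC_push {n : ℕ} (σ : C(Dl n, V)) (m : ℕ) (a : A (Dl n) (m+2)) :
    dC m (push σ (m+1) a) = push σ m (bd (m+1) a) := by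
  have : dC m ∘ₗ push σ (m+1) = push σ m ∘ₗ bd (m+1) := by
    apply A_ext
    intro v
    rw [LinearMap.comp_apply, push_sg, dC_sgc, push_comp, mp_bd, mp_sg, aff_comp_vx,
      LinearMap.comp_apply]
  exact LinearMap.congr_fun this a

lemma sdC_push {n : ℕ} (σ : C(Dl n, V)) (m : ℕ) (a : A (Dl n) (m+1)) :
    sdC m (push σ m a) = push σ m (sd (bry n) (m+1) a) := by
  have : sdC m ∘ₗ push σ m = push σ m ∘ₗ sd (bry n) (m+1) := by
    apply A_ext
    intro v
    rw [LinearMap.comp_apply, push_sg, sdC_sgc, push_comp, mp_sd _ (bry n) _ (aff_bry v), mp_sg,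
      aff_comp_vx, LinearMap.comp_apply]
  exact LinearMap.congr_fun this a

lemma hTC_push {n : ℕ} (σ : C(Dl n, V)) (m : ℕ) (a : A (Dl n) (m+1)) :
    hTC m (push σ m a) = push σ (m+1) (hT (bry n) (m+1) a) := by
  have : hTC m ∘ₗ push σ m = push σ (m+1) ∘ₗ hT (bry n) (m+1) := by
    apply A_ext
    intro v
    rw [LinearMap.comp_apply, push_sg, hTC_sgc, push_comp, mp_hT _ (bry n) _ (aff_bry v), mp_sg,
      aff_comp_vx, LinearMap.comp_apply]
  exact LinearMap.congr_fun this a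

lemma push_vx {n : ℕ} (σ : C(Dl n, V)) : push σ n (sg (vx n)) = sgc σ := by
  rw [push_sg, aff_vx, ContinuousMap.comp_id]

lemma dC_dC (n : ℕ) (x : Ch V (n+2)) : dC n (dC (n+1) x) = 0 := by
  have : dC n ∘ₗ dC (V := V) (n+1) = 0 := by
    apply Ch_ext
    intro σ
    rw [LinearMap.comp_apply, dC_sgc, dC_push, bd_bd]
    simp
  exact LinearMap.congr_fun this x

lemma dC_sdC (n : ℕ) (x : Ch V (n+1)) : dC n (sdC (n+1) x) = sdC n (dC n x) := by
  have : dC n ∘ₗ sdC (V := V) (n+1) = sdC n ∘ₗ dC n := by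
    apply Ch_ext
    intro σ
    rw [LinearMap.comp_apply, LinearMap.comp_apply, dC_sgc, sdC_sgc, dC_push, bd_sd, sdC_push]
  exact LinearMap.congr_fun this x

lemma dC_hTC_zero (x : Ch V 0) : dC 0 (hTC 0 x) = x - sdC 0 x := by
  have : dC 0 ∘ₗ hTC (V := V) 0 = LinearMap.id - sdC 0 := by
    apply Ch_ext
    intro σ
    rw [LinearMap.comp_apply, LinearMap.sub_apply, hTC_sgc, sdC_sgc, dC_push, bd_hT]
    simp [hT, push_vx]
    rw [aff_vx, ContinuousMap.comp_id]
  exact LinearMap.congr_fun this x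

lemma dC_hTC (n : ℕ) (x : Ch V (n+1)) :
    dC (n+1) (hTC (n+1) x) = x - sdC (n+1) x - hTC n (dC n x) := by
  have : dC (n+1) ∘ₗ hTC (V := V) (n+1) = LinearMap.id - sdC (n+1) - hTC n ∘ₗ dC n := by
    apply Ch_ext
    intro σ
    simp only [LinearMap.comp_apply, LinearMap.sub_apply, LinearMap.id_apply]
    rw [hTC_sgc, sdC_sgc, dC_push, bd_hT, dC_sgc, hTC_push, map_sub, map_sub, push_vx]
  exact LinearMap.congr_fun this x

/-- chains in a subset -/
def Sub (Y : Set V) (n : ℕ) : Submodule ℚ (Ch V n) :=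
  Finsupp.supported ℚ ℚ {σ | ∀ t, σ t ∈ Y}

lemma sgc_mem {Y : Set V} {n : ℕ} {σ : C(Dl n, V)} (h : ∀ t, σ t ∈ Y) : sgc σ ∈ Sub Y n :=
  Finsupp.single_mem_supported ℚ 1 h

lemma Sub_le {Y : Set V} {n : ℕ} {P : Submodule ℚ (Ch V n)}
    (h : ∀ σ : C(Dl n, V), (∀ t, σ t ∈ Y) → sgc σ ∈ P) : Sub Y n ≤ P := by
  unfold Sub
  rw [Finsupp.supported_eq_span_single, Submodule.span_le]
  rintro _ ⟨σ, hσ, rfl⟩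
  exact h σ hσ

lemma push_mem {Y : Set V} {n : ℕ} {σ : C(Dl n, V)} (h : ∀ t, σ t ∈ Y) (m : ℕ)
    (a : A (Dl n) (m+1)) : push σ m a ∈ Sub Y m := by
  induction a using Finsupp.induction_linear with
  | zero => simp
  | add f g hf hg => rw [map_add]; exact add_mem hf hg
  | single v c =>
    have : Finsupp.single v c = c • sg v := by simp [sg]
    rw [this, map_smul, push_sg]
    exact Submodule.smul_mem _ _ (sgc_mem (fun t => h _))

lemma dC_mem {Y : Set V} {n : ℕ} {x : Ch V (n+1)} (h : x ∈ Sub Y (n+1)) : dC n x ∈ Sub Y n := by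
  have : Sub Y (n+1) ≤ (Sub Y n).comap (dC n) := by
    apply Sub_le
    intro σ hσ
    rw [Submodule.mem_comap, dC_sgc]
    exact push_mem hσ _ _
  exact this h

lemma sdC_mem {Y : Set V} {n : ℕ} {x : Ch V n} (h : x ∈ Sub Y n) : sdC n x ∈ Sub Y n := by
  have : Sub Y n ≤ (Sub Y n).comap (sdC n) := by
    apply Sub_le
    intro σ hσ
    rw [Submodule.mem_comap, sdC_sgc]
    exact push_mem hσ _ _
  exact this h

lemma hTC_mem {Y : Set V} {n : ℕ} {x : Ch V n} (h : x ∈ Sub Y n) : hTC n x ∈ Sub Y (n+1) := by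
  have : Sub Y n ≤ (Sub Y (n+1)).comap (hTC n) := by
    apply Sub_le
    intro σ hσ
    rw [Submodule.mem_comap, hTC_sgc]
    exact push_mem hσ _ _
  exact this h

/-! small simplices -/

/-- tuples of size `m` in `s` of diameter at most `r` -/
def Sm (n m : ℕ) (s : Set (Fin (n+1) → ℝ)) (r : ℝ) : Submodule ℚ (A (Dl n) m) :=
  Finsupp.supported ℚ ℚ {v | (∀ j, (v j : Fin (n+1) → ℝ) ∈ s) ∧ ∀ i j, dist (v i) (v j) ≤ r}

lemma sg_memSm {n m : ℕ} {s : Set (Fin (n+1) → ℝ)} {r : ℝ} {v : Fin m → Dl n}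
    (h : ∀ j, (v j : Fin (n+1) → ℝ) ∈ s) (h' : ∀ i j, dist (v i) (v j) ≤ r) :
    sg v ∈ Sm n m s r := Finsupp.single_mem_supported ℚ 1 ⟨h, h'⟩

lemma Sm_le {n m : ℕ} {s : Set (Fin (n+1) → ℝ)} {r : ℝ} {P : Submodule ℚ (A (Dl n) m)}
    (h : ∀ v : Fin m → Dl n, (∀ j, (v j : Fin (n+1) → ℝ) ∈ s) → (∀ i j, dist (v i) (v j) ≤ r) →
      sg v ∈ P) : Sm n m s r ≤ P := by
  unfold Sm
  rw [Finsupp.supported_eq_span_single, Submodule.span_le]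
  rintro _ ⟨σ, hσ, rfl⟩
  exact h σ hσ.1 hσ.2

lemma aff_mem_convex {m n : ℕ} {s : Set (Fin (n+1) → ℝ)} (hs : Convex ℝ s) (v : Fin (m+1) → Dl n)
    (h : ∀ j, (v j : Fin (n+1) → ℝ) ∈ s) (t : Dl m) : (aff v t : Fin (n+1) → ℝ) ∈ s := by
  rw [aff_coe]
  exact hs.sum_mem (fun i _ => t.2.1 i) t.2.2 (fun i _ => h i)

lemma dist_bry {m n N : ℕ} (hm : m ≤ N) (v : Fin (m+1) → Dl n) {r : ℝ} (hr : 0 ≤ r)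
    (h : ∀ i j, dist (v i) (v j) ≤ r) (i : Fin (m+1)) :
    dist (v i : Fin (n+1) → ℝ) (bry n m v : Dl n) ≤ (N / (N+1) : ℝ) * r := by
  have e1 : (v i : Fin (n+1) → ℝ) - ((bry n m v : Dl n) : Fin (n+1) → ℝ)
      = ((1:ℝ) / (m+1)) • ∑ j ∈ Finset.univ.erase i, ((v i : Fin (n+1) → ℝ) - v j) := by
    rw [Finset.sum_erase _ (by simp), Finset.sum_sub_distrib, bry, aff_coe]
    simp only [bc, Finset.sum_const, Finset.card_univ, Fintype.card_fin, smul_sub]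
    congr 1
    · rw [← Nat.cast_smul_eq_nsmul ℝ, smul_smul]
      have : (1:ℝ)/(m+1) * ((m+1 : ℕ) : ℝ) = 1 := by push_cast; field_simp
      rw [this, one_smul]
    · rw [Finset.smul_sum]; rfl
  rw [dist_eq_norm, e1, norm_smul]
  have e2 : ‖∑ j ∈ Finset.univ.erase i, ((v i : Fin (n+1) → ℝ) - v j)‖ ≤ m * r := by
    refine (norm_sum_le_of_le _ (fun j _ => ?_)).trans (b := ∑ j ∈ Finset.univ.erase i, r) ?_
    · rw [← dist_eq_norm]; exact h i j
    · simp
  have e3 : (1:ℝ)/(m+1) * (m * r) ≤ (N / (N+1) : ℝ) * r := by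
    have : (m:ℝ)/(m+1) ≤ N/(N+1) := by
      rw [div_le_div_iff₀ (by positivity) (by positivity)]
      have : (m:ℝ) ≤ N := by exact_mod_cast hm
      nlinarith
    calc (1:ℝ)/(m+1) * (m * r) = (m:ℝ)/(m+1) * r := by ring
      _ ≤ _ := by gcongr
  refine le_trans ?_ e3
  rw [Real.norm_of_nonneg (by positivity)]
  gcongr

lemma sd_mem_Sm {n N : ℕ} (m : ℕ) (hm : m ≤ N+1) (s : Set (Fin (n+1) → ℝ)) (hs : Convex ℝ s)
    {r : ℝ} (hr : 0 ≤ r) (x : A (Dl n) m) (hx : x ∈ Sm n m s r) :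
    sd (bry n) m x ∈ Sm n m s ((N / (N+1) : ℝ) * r) := by
  induction m generalizing s with
  | zero =>
    have : Sm n 0 s r ≤ (Sm n 0 s ((N / (N+1) : ℝ) * r)).comap (sd (bry n) 0) := by
      apply Sm_le
      intro v _ _
      exact sg_memSm (fun j => j.elim0) (fun j => j.elim0)
    exact this hx
  | succ m ih =>
    have : Sm n (m+1) s r ≤ (Sm n (m+1) s ((N / (N+1) : ℝ) * r)).comap (sd (bry n) (m+1)) := by
      apply Sm_le
      intro v hv hv'
      rw [Submodule.mem_comap, sd_sg]
      set b := bry n m v with hb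
      set s' := s ∩ Metric.closedBall (b : Fin (n+1) → ℝ) ((N / (N+1) : ℝ) * r) with hs'
      have h1 : sd (bry n) m (bd m (sg v)) ∈ Sm n m s' ((N / (N+1) : ℝ) * r) := by
        refine ih (by omega) s' (hs.inter (convex_closedBall _ _)) _ ?_
        rw [bd_sg]
        refine Submodule.sum_mem _ (fun i _ => Submodule.smul_mem _ _ (sg_memSm ?_ ?_))
        · intro j
          exact ⟨hv _, dist_bry (by omega) v hr hv' _⟩
        · intro i j
          exact hv' _ _
      have h2 : Sm n m s' ((N / (N+1) : ℝ) * r) ≤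
          (Sm n (m+1) s ((N / (N+1) : ℝ) * r)).comap (cone b m) := by
        apply Sm_le
        intro w hw hw'
        rw [Submodule.mem_comap, cone_sg]
        have hbw : ∀ j, dist (w j) b ≤ (N / (N+1) : ℝ) * r := fun j => (hw j).2
        have hpos : 0 ≤ (N / (N+1) : ℝ) * r := by positivity
        apply sg_memSm
        · intro j
          refine Fin.cases ?_ (fun j => ?_) j
          · exact aff_mem_convex hs v hv _
          · exact (hw j).1
        · intro i j
          refine Fin.cases ?_ (fun i => ?_) i <;> refine Fin.cases ?_ (fun j => ?_) j
          · simpa using hpos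
          · simpa [dist_comm] using hbw j
          · simpa using hbw i
          · simpa using hw' i j
      exact h2 h1
    exact this hx

lemma sd_iter_mem {n m : ℕ} (x : A (Dl n) (m+1)) (k : ℕ) :
    ((sd (bry n) (m+1))^[k]) x ∈ Sm n (m+1) Set.univ ((m / (m+1) : ℝ)^k * 2) := by
  induction k with
  | zero =>
    refine Finsupp.mem_supported _ _ |>.2 (fun v _ => ⟨fun _ => trivial, fun i j => ?_⟩)
    have h1 : ∀ u : Dl n, dist (u : Fin (n+1) → ℝ) 0 ≤ 1 := fun u =>
      stdSimplex_subset_closedBall u.2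
    calc dist (v i) (v j) = dist (v i : Fin (n+1) → ℝ) (v j) := rfl
      _ ≤ dist (v i : Fin (n+1) → ℝ) 0 + dist 0 (v j : Fin (n+1) → ℝ) := dist_triangle _ _ _
      _ ≤ 1 + 1 := add_le_add (h1 _) (by rw [dist_comm]; exact h1 _)
      _ = _ := by norm_num
  | succ k ih =>
    rw [Function.iterate_succ_apply']
    have := sd_mem_Sm (N := m) (m+1) le_rfl Set.univ convex_univ (by positivity) _ ih
    rwa [← mul_assoc, ← pow_succ'] at this

lemma sdC_iter_push {n : ℕ} (σ : C(Dl n, V)) (m : ℕ) (a : A (Dl n) (m+1)) (k : ℕ) :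
    (sdC m)^[k] (push σ m a) = push σ m ((sd (bry n) (m+1))^[k] a) := by
  induction k with
  | zero => rfl
  | succ k ih => rw [Function.iterate_succ_apply', Function.iterate_succ_apply', ih, sdC_push]

lemma small_simplex {Y O₁ O₂ : Set V} (h₁ : IsOpen O₁) (h₂ : IsOpen O₂) (hY : Y ⊆ O₁ ∪ O₂)
    {n : ℕ} (σ : C(Dl n, V)) (hσ : ∀ t, σ t ∈ Y) :
    ∃ k₀, ∀ k, k₀ ≤ k → (sdC n)^[k] (sgc σ) ∈ Sub (Y ∩ O₁) n ⊔ Sub (Y ∩ O₂) n := by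
  have hc : (Set.univ : Set (Dl n)) ⊆ ⋃ b : Bool, σ ⁻¹' (if b then O₁ else O₂) := by
    intro t _
    rcases hY (hσ t) with h | h
    · exact Set.mem_iUnion.2 ⟨true, h⟩
    · exact Set.mem_iUnion.2 ⟨false, h⟩
  obtain ⟨δ, hδ, hδ'⟩ := lebesgue_number_lemma_of_metric (isCompact_univ)
    (c := fun b : Bool => σ ⁻¹' (if b then O₁ else O₂))
    (fun b => by cases b <;> simp [h₁.preimage σ.continuous, h₂.preimage σ.continuous]) hc
  have hlim : Filter.Tendsto (fun k : ℕ => (n / (n+1) : ℝ)^k * 2) Filter.atTop (nhds (0 * 2)) := by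
    apply Filter.Tendsto.mul_const
    apply tendsto_pow_atTop_nhds_zero_of_lt_one (by positivity)
    rw [div_lt_one (by positivity)]; linarith
  rw [zero_mul] at hlim
  obtain ⟨k₀, hk₀⟩ := Filter.eventually_atTop.1 (hlim.eventually (gt_mem_nhds hδ))
  refine ⟨k₀, fun k hk => ?_⟩
  rw [← push_vx, sdC_iter_push]
  have h1 := sd_iter_mem (sg (vx n)) k
  have h2 : Sm n (n+1) Set.univ ((n / (n+1) : ℝ)^k * 2) ≤
      (Sub (Y ∩ O₁) n ⊔ Sub (Y ∩ O₂) n).comap (push σ n) := by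
    apply Sm_le
    intro v _ hv
    rw [Submodule.mem_comap, push_sg]
    obtain ⟨b, hb⟩ := hδ' (v 0) trivial
    have h3 : ∀ t, aff v t ∈ Metric.ball (v 0) δ := by
      intro t
      have := aff_mem_convex (convex_ball (v 0 : Fin (n+1) → ℝ) δ) v
        (fun j => lt_of_le_of_lt (hv j 0) (hk₀ k hk)) t
      exact this
    cases b with
    | true => exact Submodule.mem_sup_left (sgc_mem (fun t => ⟨hσ _, hb (h3 t)⟩))
    | false => exact Submodule.mem_sup_right (sgc_mem (fun t => ⟨hσ _, hb (h3 t)⟩))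
  exact h2 h1

lemma small_chain {Y O₁ O₂ : Set V} (h₁ : IsOpen O₁) (h₂ : IsOpen O₂) (hY : Y ⊆ O₁ ∪ O₂)
    {n : ℕ} (x : Ch V n) (hx : x ∈ Sub Y n) :
    ∃ k₀, ∀ k, k₀ ≤ k → (sdC n)^[k] x ∈ Sub (Y ∩ O₁) n ⊔ Sub (Y ∩ O₂) n := by
  have hit : ∀ k, ∀ x : Ch V n, (sdC n)^[k] x = ((sdC n)^k : Module.End ℚ (Ch V n)) x := by
    intro k x; rw [Module.End.pow_apply]
  simp only [hit]
  unfold Sub at hx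
  rw [Finsupp.supported_eq_span_single] at hx
  induction hx using Submodule.span_induction with
  | mem x h =>
    obtain ⟨σ, hσ, rfl⟩ := h
    simp only [← hit]
    exact small_simplex h₁ h₂ hY σ hσ
  | zero => exact ⟨0, fun k _ => by rw [map_zero]; exact zero_mem _⟩
  | add x y _ _ hx hy =>
    obtain ⟨a, ha⟩ := hx
    obtain ⟨b, hb⟩ := hy
    refine ⟨max a b, fun k hk => ?_⟩
    rw [map_add]
    exact add_mem (ha k ((le_max_left _ _).trans hk)) (hb k ((le_max_right _ _).trans hk))
  | smul c x _ hx =>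
    obtain ⟨a, ha⟩ := hx
    refine ⟨a, fun k hk => ?_⟩
    rw [map_smul]
    exact Submodule.smul_mem _ _ (ha k hk)

/-- Key consequence: relative cycles are relative boundaries. -/
lemma small_acyclic {Y O₁ O₂ : Set V} (h₁ : IsOpen O₁) (h₂ : IsOpen O₂) (hY : Y ⊆ O₁ ∪ O₂)
    {n : ℕ} (x : Ch V n) (hx : x ∈ Sub Y n)
    (hd : ∀ m, ∀ h : n = m + 1, dC m (h ▸ x) ∈ Sub (Y ∩ O₁) m ⊔ Sub (Y ∩ O₂) m) :
    ∃ y ∈ Sub Y (n+1), x - dC n y ∈ Sub (Y ∩ O₁) n ⊔ Sub (Y ∩ O₂) n := by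
  have hsd : ∀ m, ∀ z ∈ Sub (Y ∩ O₁) m ⊔ Sub (Y ∩ O₂) m,
      sdC m z ∈ Sub (Y ∩ O₁) m ⊔ Sub (Y ∩ O₂) m := by
    intro m z hz
    obtain ⟨a, ha, b, hb, rfl⟩ := Submodule.mem_sup.1 hz
    rw [map_add]
    exact add_mem (Submodule.mem_sup_left (sdC_mem ha)) (Submodule.mem_sup_right (sdC_mem hb))
  have hhT : ∀ m, ∀ z ∈ Sub (Y ∩ O₁) m ⊔ Sub (Y ∩ O₂) m,
      hTC m z ∈ Sub (Y ∩ O₁) (m+1) ⊔ Sub (Y ∩ O₂) (m+1) := by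
    intro m z hz
    obtain ⟨a, ha, b, hb, rfl⟩ := Submodule.mem_sup.1 hz
    rw [map_add]
    exact add_mem (Submodule.mem_sup_left (hTC_mem ha)) (Submodule.mem_sup_right (hTC_mem hb))
  -- one step
  have step : ∀ z ∈ Sub Y n, (∀ m, ∀ h : n = m + 1,
        dC m (h ▸ z) ∈ Sub (Y ∩ O₁) m ⊔ Sub (Y ∩ O₂) m) →
      z - sdC n z - dC n (hTC n z) ∈ Sub (Y ∩ O₁) n ⊔ Sub (Y ∩ O₂) n := by
    intro z hz hdz
    cases n with
    | zero => rw [dC_hTC_zero]; simp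
    | succ n =>
      rw [dC_hTC]
      have := hhT n _ (hdz n rfl)
      simpa using this
  have main : ∀ k, ∃ y ∈ Sub Y (n+1), x - (sdC n)^[k] x - dC n y ∈
      Sub (Y ∩ O₁) n ⊔ Sub (Y ∩ O₂) n ∧ (sdC n)^[k] x ∈ Sub Y n ∧ (∀ m, ∀ h : n = m + 1,
        dC m (h ▸ ((sdC n)^[k] x)) ∈ Sub (Y ∩ O₁) m ⊔ Sub (Y ∩ O₂) m) := by
    intro k
    induction k with
    | zero => exact ⟨0, zero_mem _, by simp, hx, hd⟩
    | succ k ih =>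
      obtain ⟨y, hy, h1, h2, h3⟩ := ih
      refine ⟨y + hTC n ((sdC n)^[k] x), add_mem hy (hTC_mem h2), ?_, ?_, ?_⟩
      · rw [Function.iterate_succ_apply']
        have := add_mem h1 (step _ h2 h3)
        rw [map_add]
        convert this using 1
        abel
      · rw [Function.iterate_succ_apply']
        exact sdC_mem h2
      · intro m hm
        subst hm
        rw [Function.iterate_succ_apply']
        have := hsd _ _ (h3 m rfl)
        rw [dC_sdC]
        exact this
  obtain ⟨k, hk⟩ := small_chain h₁ h₂ hY x hx
  obtain ⟨y, hy, h1, -⟩ := main k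
  refine ⟨y, hy, ?_⟩
  have := add_mem h1 (hk k le_rfl)
  convert this using 1
  abel

end Sd

namespace Sd

lemma fin_mid {A B C : Type} [AddCommGroup A] [AddCommGroup B] [AddCommGroup C] [Module ℚ A]
    [Module ℚ B] [Module ℚ C] (f : A →ₗ[ℚ] B) (g : B →ₗ[ℚ] C)
    (h : LinearMap.range f = LinearMap.ker g) [Module.Finite ℚ A] [Module.Finite ℚ C] :
    Module.Finite ℚ B := by
  have h1 : Module.Finite ℚ (LinearMap.ker g) := by rw [← h]; infer_instance
  have h2 : Module.Finite ℚ (B ⧸ LinearMap.ker g) :=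
    Module.Finite.equiv g.quotKerEquivRange.symm
  exact Module.Finite.of_submodule_quotient (LinearMap.ker g)

lemma dim_mid {A B C : Type} [AddCommGroup A] [AddCommGroup B] [AddCommGroup C] [Module ℚ A]
    [Module ℚ B] [Module ℚ C] (f : A →ₗ[ℚ] B) (g : B →ₗ[ℚ] C)
    (h : LinearMap.range f = LinearMap.ker g) [Module.Finite ℚ B] :
    (Module.finrank ℚ B : ℤ) = Module.finrank ℚ (LinearMap.range f)
      + Module.finrank ℚ (LinearMap.range g) := by
  rw [h, ← LinearMap.finrank_range_add_finrank_ker g]; push_cast; ring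

/-- finite type complexes with Euler characteristic c -/
def FT (K : ChainComplex (ModuleCat.{0} ℚ) ℕ) (c : ℤ) : Prop :=
  (∀ n, Module.Finite ℚ (K.homology n)) ∧ ∃ N, ∀ M, N ≤ M →
    Module.finrank ℚ (K.homology M) = 0 ∧
    ∑ n ∈ Finset.range M, (-1 : ℤ)^n * (Module.finrank ℚ (K.homology n) : ℤ) = c

lemma FT.euler {K : ChainComplex (ModuleCat.{0} ℚ) ℕ} {c : ℤ} (h : FT K c) :
    ∑ᶠ q : ℕ, (-1 : ℤ) ^ q * (Module.finrank ℚ (K.homology q) : ℤ) = c := by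
  obtain ⟨_, N, hN⟩ := h
  rw [finsum_eq_sum_of_support_subset (s := Finset.range N), (hN N le_rfl).2]
  intro q hq
  simp only [Finset.coe_range, Set.mem_Iio]
  by_contra hq'
  apply hq
  simp [(hN q (not_lt.1 hq')).1]

lemma FT.of_iso {K K' : ChainComplex (ModuleCat.{0} ℚ) ℕ} {c : ℤ}
    (e : ∀ n, Nonempty (K.homology n ≅ K'.homology n)) (h : FT K c) : FT K' c := by
  have e1 : ∀ n, Nonempty (K.homology n ≃ₗ[ℚ] K'.homology n) := fun n => (e n).map (·.toLinearEquiv)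
  have e2 : ∀ n, Module.finrank ℚ (K'.homology n) = Module.finrank ℚ (K.homology n) :=
    fun n => (e1 n).some.finrank_eq.symm
  refine ⟨fun n => ?_, ?_⟩
  · have := h.1 n
    exact Module.Finite.equiv (e1 n).some
  · simp only [e2]; exact h.2

section les
variable {S : ShortComplex (ChainComplex (ModuleCat.{0} ℚ) ℕ)}

lemma les (hS : S.ShortExact) :
    ∃ (f : ∀ n, S.X₁.homology n →ₗ[ℚ] S.X₂.homology n)
      (g : ∀ n, S.X₂.homology n →ₗ[ℚ] S.X₃.homology n)
      (δ : ∀ n, S.X₃.homology (n+1) →ₗ[ℚ] S.X₁.homology n),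
      (∀ n, LinearMap.range (f n) = LinearMap.ker (g n)) ∧
      (∀ n, LinearMap.range (g (n+1)) = LinearMap.ker (δ n)) ∧
      (∀ n, LinearMap.range (δ n) = LinearMap.ker (f n)) ∧
      LinearMap.range (g 0) = ⊤ := by
  refine ⟨fun n => (HomologicalComplex.homologyMap S.f n).hom,
    fun n => (HomologicalComplex.homologyMap S.g n).hom,
    fun n => (hS.δ (n+1) n rfl).hom, fun n => ?_, fun n => ?_, fun n => ?_, ?_⟩
  · exact (hS.homology_exact₂ n).moduleCat_range_eq_ker
  · exact (hS.homology_exact₃ (n+1) n rfl).moduleCat_range_eq_ker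
  · exact (hS.homology_exact₁ (n+1) n rfl).moduleCat_range_eq_ker
  · have := hS.epi_g
    have : Epi (HomologicalComplex.homologyMap S.g 0) :=
      HomologicalComplex.epi_homologyMap_of_epi_of_not_rel S.g 0 (by simp)
    exact LinearMap.range_eq_top.2 ((ModuleCat.epi_iff_surjective _).1 this)

lemma FT_sum (hS : S.ShortExact) (h1 : ∀ n, Module.Finite ℚ (S.X₁.homology n))
    (h2 : ∀ n, Module.Finite ℚ (S.X₂.homology n)) (h3 : ∀ n, Module.Finite ℚ (S.X₃.homology n))
    (N : ℕ) (hN : Module.finrank ℚ (S.X₁.homology N) = 0 ∨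
      Module.finrank ℚ (S.X₃.homology (N+1)) = 0) :
    ∑ n ∈ Finset.range (N+1), (-1 : ℤ)^n * (Module.finrank ℚ (S.X₁.homology n) : ℤ)
    - ∑ n ∈ Finset.range (N+1), (-1 : ℤ)^n * (Module.finrank ℚ (S.X₂.homology n) : ℤ)
    + ∑ n ∈ Finset.range (N+1), (-1 : ℤ)^n * (Module.finrank ℚ (S.X₃.homology n) : ℤ) = 0 := by
  obtain ⟨f, g, δ, hfg, hgd, hdf, h0⟩ := les hS
  have key : ∀ N, ∑ n ∈ Finset.range (N+1), (-1 : ℤ)^n * (Module.finrank ℚ (S.X₁.homology n) : ℤ)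
    - ∑ n ∈ Finset.range (N+1), (-1 : ℤ)^n * (Module.finrank ℚ (S.X₂.homology n) : ℤ)
    + ∑ n ∈ Finset.range (N+1), (-1 : ℤ)^n * (Module.finrank ℚ (S.X₃.homology n) : ℤ)
     = (-1)^N * Module.finrank ℚ (LinearMap.range (δ N)) := by
    intro N
    induction N with
    | zero =>
      have e : Module.finrank ℚ (LinearMap.range (g 0)) = Module.finrank ℚ (S.X₃.homology 0) := by
        rw [h0, finrank_top]
      simp only [zero_add, Finset.range_one, Finset.sum_singleton, pow_zero, one_mul,
        dim_mid _ _ (hfg 0), dim_mid _ _ (hdf 0), ← e]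
      ring
    | succ N ih =>
      rw [Finset.sum_range_succ _ (N+1), Finset.sum_range_succ _ (N+1),
        Finset.sum_range_succ _ (N+1), dim_mid _ _ (hfg (N+1)), dim_mid _ _ (hdf (N+1)),
        dim_mid _ _ (hgd N)]
      rw [pow_succ]
      linear_combination ih
  rw [key N]
  have : Module.finrank ℚ (LinearMap.range (δ N)) = 0 := by
    rcases hN with hN | hN
    · exact Nat.le_zero.1 (hN ▸ Submodule.finrank_le _)
    · exact Nat.le_zero.1 (hN ▸ LinearMap.finrank_range_le _)
  simp [this]

lemma finrank_mid_zero {A B C : Type} [AddCommGroup A] [AddCommGroup B] [AddCommGroup C] [Module ℚ A]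
    [Module ℚ B] [Module ℚ C] (f : A →ₗ[ℚ] B) (g : B →ₗ[ℚ] C)
    (h : LinearMap.range f = LinearMap.ker g) [Module.Finite ℚ A] [Module.Finite ℚ C]
    (hA : Module.finrank ℚ A = 0) (hC : Module.finrank ℚ C = 0) : Module.finrank ℚ B = 0 := by
  have := fin_mid f g h
  have h1 := dim_mid f g h
  have h2 := Submodule.finrank_le (LinearMap.range g)
  have h3 := LinearMap.finrank_range_le f
  omega

lemma FT.two (hS : S.ShortExact) {a c : ℤ} (h1 : FT S.X₁ a) (h3 : FT S.X₃ c) : FT S.X₂ (a + c) := by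
  obtain ⟨F1, N1, h1⟩ := h1
  obtain ⟨F3, N3, h3⟩ := h3
  obtain ⟨f, g, δ, hfg, hgd, hdf, h0⟩ := les hS
  have F2 : ∀ n, Module.Finite ℚ (S.X₂.homology n) := fun n => fin_mid _ _ (hfg n)
  refine ⟨F2, N1 + N3 + 1, fun M hM => ⟨?_, ?_⟩⟩
  · exact finrank_mid_zero _ _ (hfg M) (h1 M (by omega)).1 (h3 M (by omega)).1
  · obtain ⟨M, rfl⟩ : ∃ M', M = M' + 1 := ⟨M - 1, by omega⟩
    have := FT_sum hS F1 F2 F3 M (Or.inl (h1 M (by omega)).1)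
    rw [(h1 (M+1) (by omega)).2, (h3 (M+1) (by omega)).2] at this
    linarith

lemma FT.one (hS : S.ShortExact) {b c : ℤ} (h2 : FT S.X₂ b) (h3 : FT S.X₃ c) : FT S.X₁ (b - c) := by
  obtain ⟨F2, N2, h2⟩ := h2
  obtain ⟨F3, N3, h3⟩ := h3
  obtain ⟨f, g, δ, hfg, hgd, hdf, h0⟩ := les hS
  have F1 : ∀ n, Module.Finite ℚ (S.X₁.homology n) := fun n => fin_mid _ _ (hdf n)
  refine ⟨F1, N2 + N3 + 1, fun M hM => ⟨?_, ?_⟩⟩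
  · exact finrank_mid_zero _ _ (hdf M) (h3 (M+1) (by omega)).1 (h2 M (by omega)).1
  · obtain ⟨M, rfl⟩ : ∃ M', M = M' + 1 := ⟨M - 1, by omega⟩
    have := FT_sum hS F1 F2 F3 M (Or.inr (h3 (M+1) (by omega)).1)
    rw [(h2 (M+1) (by omega)).2, (h3 (M+1) (by omega)).2] at this
    linarith

lemma FT.three (hS : S.ShortExact) {a b : ℤ} (h1 : FT S.X₁ a) (h2 : FT S.X₂ b) : FT S.X₃ (b - a) := by
  obtain ⟨F2, N2, h2⟩ := h2
  obtain ⟨F1, N1, h1⟩ := h1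
  obtain ⟨f, g, δ, hfg, hgd, hdf, h0⟩ := les hS
  have F3 : ∀ n, Module.Finite ℚ (S.X₃.homology n) := by
    intro n
    cases n with
    | zero => exact Module.Finite.of_surjective (g 0) (LinearMap.range_eq_top.1 h0)
    | succ n => exact fin_mid _ _ (hgd n)
  have H3 : ∀ M, N1 + N2 ≤ M → Module.finrank ℚ (S.X₃.homology (M+1)) = 0 := fun M hM =>
    finrank_mid_zero _ _ (hgd M) (h2 (M+1) (by omega)).1 (h1 M (by omega)).1
  refine ⟨F3, N1 + N2 + 1, fun M hM => ?_⟩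
  obtain ⟨M, rfl⟩ : ∃ M', M = M' + 1 := ⟨M - 1, by omega⟩
  refine ⟨H3 M (by omega), ?_⟩
  have := FT_sum hS F1 F2 F3 M (Or.inr (H3 M (by omega)))
  rw [(h2 (M+1) (by omega)).2, (h1 (M+1) (by omega)).2] at this
  linarith
end les

end Sd

namespace Sd

section CC
variable (M : ℕ → Type) [∀ n, AddCommGroup (M n)] [∀ n, Module ℚ (M n)]
  (dd : ∀ n, M (n+1) →ₗ[ℚ] M n) (h : ∀ n x, dd n (dd (n+1) x) = 0)

def CC : ChainComplex (ModuleCat.{0} ℚ) ℕ :=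
  ChainComplex.of (fun n => ModuleCat.of ℚ (M n)) (fun n => ModuleCat.ofHom (dd n))
    (fun n => by ext x; exact h n x)

lemma CC_d (n : ℕ) : (CC M dd h).d (n+1) n = ModuleCat.ofHom (dd n) := by
  exact ChainComplex.of_d (fun n => ModuleCat.of ℚ (M n)) (fun n => ModuleCat.ofHom (dd n)) n

variable {M dd h}
lemma CC_acyclic (h0 : ∀ x : M 0, ∃ y, dd 0 y = x)
    (hs : ∀ n, ∀ x : M (n+1), dd n x = 0 → ∃ y, dd (n+1) y = x) : FT (CC M dd h) 0 := by
  have key : ∀ n, Limits.IsZero ((CC M dd h).homology n) := by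
    intro n
    rw [← HomologicalComplex.exactAt_iff_isZero_homology]
    cases n with
    | zero =>
      rw [HomologicalComplex.exactAt_iff' _ 1 0 0 (by simp) (by simp),
        ShortComplex.moduleCat_exact_iff]
      intro x _
      obtain ⟨y, hy⟩ := h0 x
      refine ⟨y, ?_⟩
      change (CC M dd h).d 1 0 y = x
      rw [CC_d]; exact hy
    | succ n =>
      rw [HomologicalComplex.exactAt_iff' _ (n+2) (n+1) n (by simp) (by simp),
        ShortComplex.moduleCat_exact_iff]
      intro x hx
      change (CC M dd h).d (n+1) n x = 0 at hx
      rw [CC_d] at hx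
      obtain ⟨y, hy⟩ := hs n x hx
      refine ⟨y, ?_⟩
      change (CC M dd h).d (n+2) (n+1) y = x
      rw [CC_d]; exact hy
  have key2 : ∀ n, Subsingleton ((CC M dd h).homology n) := fun n =>
    ModuleCat.subsingleton_of_isZero (key n)
  have key3 : ∀ n, Module.finrank ℚ ((CC M dd h).homology n) = 0 := fun n =>
    Module.finrank_zero_of_subsingleton
  refine ⟨fun n => inferInstance, 0, fun N _ => ⟨key3 N, ?_⟩⟩
  simp [key3]
end CC

section ses
variable {M₁ M₂ M₃ : ℕ → Type} [∀ n, AddCommGroup (M₁ n)] [∀ n, Module ℚ (M₁ n)]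
  [∀ n, AddCommGroup (M₂ n)] [∀ n, Module ℚ (M₂ n)] [∀ n, AddCommGroup (M₃ n)] [∀ n, Module ℚ (M₃ n)]
  {d₁ : ∀ n, M₁ (n+1) →ₗ[ℚ] M₁ n} {h₁ : ∀ n x, d₁ n (d₁ (n+1) x) = 0}
  {d₂ : ∀ n, M₂ (n+1) →ₗ[ℚ] M₂ n} {h₂ : ∀ n x, d₂ n (d₂ (n+1) x) = 0}
  {d₃ : ∀ n, M₃ (n+1) →ₗ[ℚ] M₃ n} {h₃ : ∀ n x, d₃ n (d₃ (n+1) x) = 0}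

def CChom (f : ∀ n, M₁ n →ₗ[ℚ] M₂ n) (hf : ∀ n x, f n (d₁ n x) = d₂ n (f (n+1) x)) :
    CC M₁ d₁ h₁ ⟶ CC M₂ d₂ h₂ :=
  ChainComplex.ofHom (X := CC M₁ d₁ h₁) (Y := CC M₂ d₂ h₂) (fun n => ModuleCat.ofHom (f n))
    (fun n => by rw [CC_d, CC_d]; ext x; exact (hf n x).symm)

lemma CC_ses (f : ∀ n, M₁ n →ₗ[ℚ] M₂ n) (hf : ∀ n x, f n (d₁ n x) = d₂ n (f (n+1) x))
    (g : ∀ n, M₂ n →ₗ[ℚ] M₃ n) (hg : ∀ n x, g n (d₂ n x) = d₃ n (g (n+1) x))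
    (hi : ∀ n, Function.Injective (f n)) (hs : ∀ n, Function.Surjective (g n))
    (he : ∀ n x, g n x = 0 ↔ ∃ y, f n y = x) :
    ∃ S : ShortComplex (ChainComplex (ModuleCat.{0} ℚ) ℕ), S.ShortExact ∧
      S.X₁ = CC M₁ d₁ h₁ ∧ S.X₂ = CC M₂ d₂ h₂ ∧ S.X₃ = CC M₃ d₃ h₃ := by
  refine ⟨⟨CChom (h₁ := h₁) (h₂ := h₂) f hf, CChom (h₁ := h₂) (h₂ := h₃) g hg, ?_⟩, ?_, rfl, rfl, rfl⟩
  · ext n x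
    have : (g n) ((f n) x) = 0 := (he n _).2 ⟨x, rfl⟩
    exact this
  · apply HomologicalComplex.shortExact_of_degreewise_shortExact
    intro n
    refine { exact := ?_, mono_f := ?_, epi_g := ?_ }
    · rw [ShortComplex.moduleCat_exact_iff]
      intro x hx
      exact (he n x).1 hx
    · exact (ModuleCat.mono_iff_injective _).2 (hi n)
    · exact (ModuleCat.epi_iff_surjective _).2 (hs n)

lemma ses_two (f : ∀ n, M₁ n →ₗ[ℚ] M₂ n) (hf : ∀ n x, f n (d₁ n x) = d₂ n (f (n+1) x))
    (g : ∀ n, M₂ n →ₗ[ℚ] M₃ n) (hg : ∀ n x, g n (d₂ n x) = d₃ n (g (n+1) x))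
    (hi : ∀ n, Function.Injective (f n)) (hs : ∀ n, Function.Surjective (g n))
    (he : ∀ n x, g n x = 0 ↔ ∃ y, f n y = x)
    {a c : ℤ} (ha : FT (CC M₁ d₁ h₁) a) (hc : FT (CC M₃ d₃ h₃) c) :
    FT (CC M₂ d₂ h₂) (a + c) := by
  obtain ⟨S, hS, e1, e2, e3⟩ := CC_ses (h₁ := h₁) (h₂ := h₂) (h₃ := h₃) f hf g hg hi hs he
  rw [← e1] at ha; rw [← e3] at hc; rw [← e2]; exact FT.two hS ha hc
lemma ses_one (f : ∀ n, M₁ n →ₗ[ℚ] M₂ n) (hf : ∀ n x, f n (d₁ n x) = d₂ n (f (n+1) x))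
    (g : ∀ n, M₂ n →ₗ[ℚ] M₃ n) (hg : ∀ n x, g n (d₂ n x) = d₃ n (g (n+1) x))
    (hi : ∀ n, Function.Injective (f n)) (hs : ∀ n, Function.Surjective (g n))
    (he : ∀ n x, g n x = 0 ↔ ∃ y, f n y = x)
    {b c : ℤ} (ha : FT (CC M₂ d₂ h₂) b) (hc : FT (CC M₃ d₃ h₃) c) :
    FT (CC M₁ d₁ h₁) (b - c) := by
  obtain ⟨S, hS, e1, e2, e3⟩ := CC_ses (h₁ := h₁) (h₂ := h₂) (h₃ := h₃) f hf g hg hi hs he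
  rw [← e2] at ha; rw [← e3] at hc; rw [← e1]; exact FT.one hS ha hc
lemma ses_three (f : ∀ n, M₁ n →ₗ[ℚ] M₂ n) (hf : ∀ n x, f n (d₁ n x) = d₂ n (f (n+1) x))
    (g : ∀ n, M₂ n →ₗ[ℚ] M₃ n) (hg : ∀ n x, g n (d₂ n x) = d₃ n (g (n+1) x))
    (hi : ∀ n, Function.Injective (f n)) (hs : ∀ n, Function.Surjective (g n))
    (he : ∀ n x, g n x = 0 ↔ ∃ y, f n y = x)
    {a b : ℤ} (ha : FT (CC M₁ d₁ h₁) a) (hc : FT (CC M₂ d₂ h₂) b) :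
    FT (CC M₃ d₃ h₃) (b - a) := by
  obtain ⟨S, hS, e1, e2, e3⟩ := CC_ses (h₁ := h₁) (h₂ := h₂) (h₃ := h₃) f hf g hg hi hs he
  rw [← e1] at ha; rw [← e2] at hc; rw [← e3]; exact FT.three hS ha hc
end ses

section mv
variable {V : Type} [TopologicalSpace V]

/-- a subcomplex of singular chains -/
structure SubC (V : Type) [TopologicalSpace V] where
  P : ∀ n, Submodule ℚ (Ch V n)
  hP : ∀ n, ∀ x ∈ P (n+1), dC n x ∈ P n

def SubC.dd (D : SubC V) (n : ℕ) : D.P (n+1) →ₗ[ℚ] D.P n := (dC n).restrict (D.hP n)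

lemma SubC.dd_coe (D : SubC V) (n : ℕ) (x : D.P (n+1)) : (D.dd n x : Ch V n) = dC n x := rfl

lemma SubC.hd (D : SubC V) (n : ℕ) (x : D.P (n+2)) : D.dd n (D.dd (n+1) x) = 0 := by
  ext1
  rw [SubC.dd_coe, SubC.dd_coe, dC_dC]; rfl

def SubC.C (D : SubC V) : ChainComplex (ModuleCat.{0} ℚ) ℕ := CC (fun n => D.P n) D.dd D.hd

def SY (Y : Set V) : SubC V := ⟨Sub Y, fun _ _ h => dC_mem h⟩

def SubC.inf (D E : SubC V) : SubC V := ⟨fun n => D.P n ⊓ E.P n, fun n x h => ⟨D.hP n x h.1, E.hP n x h.2⟩⟩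
def SubC.sup (D E : SubC V) : SubC V := ⟨fun n => D.P n ⊔ E.P n, fun n x h => by
  obtain ⟨a, ha, b, hb, rfl⟩ := Submodule.mem_sup.1 h
  rw [map_add]
  exact Submodule.add_mem_sup (D.hP n a ha) (E.hP n b hb)⟩

def prodd (D E : SubC V) (n : ℕ) : (D.P (n+1) × E.P (n+1)) →ₗ[ℚ] (D.P n × E.P n) :=
  (D.dd n).prodMap (E.dd n)

lemma prodd_hd (D E : SubC V) (n : ℕ) (x : (D.P (n+2) × E.P (n+2))) :
    prodd D E n (prodd D E (n+1) x) = 0 := by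
  ext1
  · exact D.hd n x.1
  · exact E.hd n x.2

def prodC (D E : SubC V) : ChainComplex (ModuleCat.{0} ℚ) ℕ :=
  CC (fun n => D.P n × E.P n) (prodd D E) (prodd_hd D E)

lemma prod_FT {D E : SubC V} {a b : ℤ} (ha : FT D.C a) (hb : FT E.C b) :
    FT (prodC D E) (a + b) := by
  refine ses_two (M₁ := fun n => D.P n) (M₃ := fun n => E.P n)
    (fun n => LinearMap.inl ℚ _ _) ?_ (fun n => LinearMap.snd ℚ _ _) ?_ ?_ ?_ ?_ ha hb
  · intro n x; simp [prodd]
  · intro n x; simp [prodd]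
  · intro n; exact LinearMap.inl_injective
  · intro n; exact LinearMap.snd_surjective
  · rintro n ⟨x, y⟩
    simp [eq_comm]

lemma prod_FT' {D E : SubC V} {a b : ℤ} (ha : FT (prodC D E) a) (hb : FT E.C b) :
    FT D.C (a - b) := by
  refine ses_one (M₁ := fun n => D.P n) (M₃ := fun n => E.P n)
    (fun n => LinearMap.inl ℚ _ _) ?_ (fun n => LinearMap.snd ℚ _ _) ?_ ?_ ?_ ?_ ha hb
  · intro n x; simp [prodd]
  · intro n x; simp [prodd]
  · intro n; exact LinearMap.inl_injective
  · intro n; exact LinearMap.snd_surjective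
  · rintro n ⟨x, y⟩
    simp [eq_comm]

def mvf (D E : SubC V) (n : ℕ) : (D.inf E).P n →ₗ[ℚ] (D.P n × E.P n) :=
  (Submodule.inclusion inf_le_left).prod (Submodule.inclusion inf_le_right)

def mvg (D E : SubC V) (n : ℕ) : (D.P n × E.P n) →ₗ[ℚ] (D.sup E).P n :=
  (Submodule.inclusion le_sup_left).coprod (-(Submodule.inclusion le_sup_right))

lemma mvg_coe (D E : SubC V) (n : ℕ) (x) : (mvg D E n x : Ch V n) = x.1 - x.2 := by
  rw [sub_eq_add_neg]; rfl

lemma mvx (D E : SubC V) :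
  (∀ n x, mvf D E n ((D.inf E).dd n x) = prodd D E n (mvf D E (n+1) x)) ∧
  (∀ n x, mvg D E n (prodd D E n x) = (D.sup E).dd n (mvg D E (n+1) x)) ∧
  (∀ n, Function.Injective (mvf D E n)) ∧ (∀ n, Function.Surjective (mvg D E n)) ∧
  (∀ n x, mvg D E n x = 0 ↔ ∃ y, mvf D E n y = x) := by
  refine ⟨fun n x => rfl, fun n x => ?_, fun n x y h => ?_, fun n x => ?_, fun n x => ?_⟩
  · ext1
    rw [SubC.dd_coe, mvg_coe, mvg_coe, map_sub]; rfl
  · ext1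
    exact congrArg (fun z => (z.1 : Ch V n)) h
  · obtain ⟨x, hx⟩ := x
    obtain ⟨a, ha, b, hb, rfl⟩ := Submodule.mem_sup.1 hx
    refine ⟨(⟨a, ha⟩, ⟨-b, Submodule.neg_mem _ hb⟩), ?_⟩
    ext1
    rw [mvg_coe]; simp
  · rw [← Subtype.coe_inj, mvg_coe]
    constructor
    · intro h
      have h : (x.1 : Ch V n) = x.2 := sub_eq_zero.1 h
      refine ⟨⟨x.1, x.1.2, h ▸ x.2.2⟩, ?_⟩
      ext1
      · rfl
      · ext1; exact h
    · rintro ⟨y, rfl⟩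
      exact sub_self _

lemma sup_FT {D E : SubC V} {a b c : ℤ} (ha : FT D.C a) (hb : FT E.C b) (hc : FT (D.inf E).C c) :
    FT (D.sup E).C (a + b - c) := by
  obtain ⟨h1, h2, h3, h4, h5⟩ := mvx D E
  exact ses_three (M₁ := fun n => (D.inf E).P n) (M₂ := fun n => (D.P n × E.P n))
    _ h1 _ h2 h3 h4 h5 hc (prod_FT ha hb)

lemma left_FT {D E : SubC V} {s b c : ℤ} (hs : FT (D.sup E).C s) (hb : FT E.C b)
    (hc : FT (D.inf E).C c) : FT D.C (s - b + c) := by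
  obtain ⟨h1, h2, h3, h4, h5⟩ := mvx D E
  have := ses_two (M₁ := fun n => (D.inf E).P n) (M₃ := fun n => (D.sup E).P n)
    (h₂ := prodd_hd D E) _ h1 _ h2 h3 h4 h5 hc hs
  have := prod_FT' this hb
  convert this using 1; ring

/-- quotient complex -/
def qdd (D E : SubC V) (n : ℕ) :
    (E.P (n+1) ⧸ (D.P (n+1)).submoduleOf (E.P (n+1))) →ₗ[ℚ] (E.P n ⧸ (D.P n).submoduleOf (E.P n)) :=
  Submodule.mapQ _ _ (E.dd n) (fun x hx => D.hP n x hx)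

lemma qdd_hd (D E : SubC V) (n : ℕ) (x) : qdd D E n (qdd D E (n+1) x) = 0 := by
  obtain ⟨x, rfl⟩ := Submodule.mkQ_surjective _ x
  have : qdd D E n (qdd D E (n+1) (Submodule.mkQ _ x)) = Submodule.mkQ _ (E.dd n (E.dd (n+1) x)) := rfl
  rw [this, SubC.hd, map_zero]

lemma q_ses (D E : SubC V) (hDE : ∀ n, D.P n ≤ E.P n) :
  (∀ n x, Submodule.inclusion (hDE n) (D.dd n x) = E.dd n (Submodule.inclusion (hDE (n+1)) x)) ∧
  (∀ n x, Submodule.mkQ ((D.P n).submoduleOf (E.P n)) (E.dd n x) = qdd D E n (Submodule.mkQ _ x)) ∧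
  (∀ n, Function.Injective (Submodule.inclusion (hDE n))) ∧
  (∀ n, Function.Surjective (Submodule.mkQ ((D.P n).submoduleOf (E.P n)))) ∧
  (∀ n x, Submodule.mkQ ((D.P n).submoduleOf (E.P n)) x = 0 ↔ ∃ y, Submodule.inclusion (hDE n) y = x) := by
  refine ⟨fun n x => rfl, fun n x => rfl, fun n => Submodule.inclusion_injective _,
    fun n => Submodule.mkQ_surjective _, fun n x => ?_⟩
  rw [Submodule.mkQ_apply, Submodule.Quotient.mk_eq_zero]
  constructor
  · intro h; exact ⟨⟨x, h⟩, rfl⟩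
  · rintro ⟨y, rfl⟩; exact y.2

lemma q_acyclic {Y O₁ O₂ : Set V} (h₁ : IsOpen O₁) (h₂ : IsOpen O₂) (hY : Y ⊆ O₁ ∪ O₂) :
    FT (CC (fun n => (SY Y).P n ⧸ (((SY (Y ∩ O₁)).sup (SY (Y ∩ O₂))).P n).submoduleOf ((SY Y).P n))
      (qdd ((SY (Y ∩ O₁)).sup (SY (Y ∩ O₂))) (SY Y)) (qdd_hd _ _)) 0 := by
  apply CC_acyclic
  · intro x
    obtain ⟨x, rfl⟩ := Submodule.mkQ_surjective _ x
    obtain ⟨y, hy, hxy⟩ := small_acyclic h₁ h₂ hY x.1 x.2 (fun m h => by omega)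
    refine ⟨Submodule.mkQ _ ⟨y, hy⟩, ?_⟩
    symm
    exact (Submodule.Quotient.eq _).2 hxy
  · intro n x hx
    obtain ⟨x, rfl⟩ := Submodule.mkQ_surjective _ x
    replace hx := (Submodule.Quotient.mk_eq_zero _ (x := (SY Y).dd n x)).1 hx
    obtain ⟨y, hy, hxy⟩ := small_acyclic h₁ h₂ hY x.1 x.2 (fun m h => by
      obtain rfl : n = m := by omega
      exact hx)
    refine ⟨Submodule.mkQ _ ⟨y, hy⟩, ?_⟩
    symm
    exact (Submodule.Quotient.eq _).2 hxy

lemma sup_le_SY {Y O₁ O₂ : Set V} (n : ℕ) :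
    ((SY (Y ∩ O₁)).sup (SY (Y ∩ O₂))).P n ≤ (SY Y).P n := by
  refine sup_le ?_ ?_ <;> refine Sub_le ?_ <;> intro σ h <;> exact sgc_mem fun t => (h t).1

lemma FT_sup_iff {Y O₁ O₂ : Set V} (h₁ : IsOpen O₁) (h₂ : IsOpen O₂) (hY : Y ⊆ O₁ ∪ O₂) {c : ℤ} :
    FT ((SY (Y ∩ O₁)).sup (SY (Y ∩ O₂))).C c ↔ FT (SY Y).C c := by
  obtain ⟨e1, e2, e3, e4, e5⟩ := q_ses ((SY (Y ∩ O₁)).sup (SY (Y ∩ O₂))) (SY Y) (sup_le_SY)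
  have q := q_acyclic h₁ h₂ hY
  constructor
  · intro h
    have := ses_two (M₁ := fun n => ((SY (Y ∩ O₁)).sup (SY (Y ∩ O₂))).P n)
      (M₂ := fun n => (SY Y).P n) (h₂ := (SY Y).hd) _ e1 _ e2 e3 e4 e5 h q
    rwa [add_zero] at this
  · intro h
    have := ses_one (M₁ := fun n => ((SY (Y ∩ O₁)).sup (SY (Y ∩ O₂))).P n)
      (M₂ := fun n => (SY Y).P n) (h₁ := ((SY (Y ∩ O₁)).sup (SY (Y ∩ O₂))).hd) _ e1 _ e2 e3 e4 e5 h q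
    rwa [sub_zero] at this

lemma SY_inf (Y Z : Set V) : (SY Y).inf (SY Z) = SY (Y ∩ Z) := by
  have : ∀ n, Sub Y n ⊓ Sub Z n = Sub (Y ∩ Z) n := by
    intro n
    simp only [Sub]
    rw [← Finsupp.supported_inter]
    congr 1
    ext σ
    simp [forall_and]
  simp only [SubC.inf, SY, this]

theorem MV {Y O₁ O₂ : Set V} (h₁ : IsOpen O₁) (h₂ : IsOpen O₂) (hY : Y ⊆ O₁ ∪ O₂) {a b c : ℤ}
    (ha : FT (SY (Y ∩ O₁)).C a) (hb : FT (SY (Y ∩ O₂)).C b) (hc : FT (SY (Y ∩ O₁ ∩ O₂)).C c) :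
    FT (SY Y).C (a + b - c) := by
  rw [← FT_sup_iff h₁ h₂ hY]
  refine sup_FT ha hb ?_
  rw [SY_inf]
  convert hc using 3
  ext; simp; tauto

theorem MV' {Y O₁ O₂ : Set V} (h₁ : IsOpen O₁) (h₂ : IsOpen O₂) (hY : Y ⊆ O₁ ∪ O₂) {y b c : ℤ}
    (hy : FT (SY Y).C y) (hb : FT (SY (Y ∩ O₂)).C b) (hc : FT (SY (Y ∩ O₁ ∩ O₂)).C c) :
    FT (SY (Y ∩ O₁)).C (y - b + c) := by
  rw [← FT_sup_iff h₁ h₂ hY] at hy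
  refine left_FT hy hb ?_
  rw [SY_inf]
  convert hc using 3
  ext; simp; tauto
end mv
end Sd

namespace Sd

def CF : TopCat.{0} ⥤ ChainComplex (ModuleCat.{0} ℚ) ℕ :=
  TopCat.toSSet ⋙ (SimplicialObject.whiskering _ _).obj (ModuleCat.free ℚ) ⋙
    alternatingFaceMapComplex (ModuleCat ℚ)

lemma CF_obj (X : Type) [TopologicalSpace X] : CF.obj (TopCat.of X) = singularChainComplex X := rfl

lemma CF_homotopy {X Y : TopCat.{0}} {f g : X ⟶ Y} (H : TopCat.Homotopy f g) (n : ℕ) :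
    HomologicalComplex.homologyMap (CF.map f) n = HomologicalComplex.homologyMap (CF.map g) n :=
  SimplicialObject.Homotopy.map_homology_eq
    (H.toSSet.toSimplicialObjectHomotopy.whiskerRight (ModuleCat.free ℚ)) n

def homIso {X Y : Type} [TopologicalSpace X] [TopologicalSpace Y]
    (e : ContinuousMap.HomotopyEquiv X Y) (n : ℕ) :
    (CF.obj (TopCat.of X)).homology n ≅ (CF.obj (TopCat.of Y)).homology n where
  hom := HomologicalComplex.homologyMap (CF.map (TopCat.ofHom e.toFun)) n
  inv := HomologicalComplex.homologyMap (CF.map (TopCat.ofHom e.invFun)) n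
  hom_inv_id := by
    rw [← HomologicalComplex.homologyMap_comp, ← CF.map_comp,
      CF_homotopy (g := 𝟙 _) e.left_inv.some n, CF.map_id, HomologicalComplex.homologyMap_id]
  inv_hom_id := by
    rw [← HomologicalComplex.homologyMap_comp, ← CF.map_comp,
      CF_homotopy (g := 𝟙 _) e.right_inv.some n, CF.map_id, HomologicalComplex.homologyMap_id]

def FX (X : Type) [TopologicalSpace X] (c : ℤ) : Prop := FT (singularChainComplex X) c

lemma FX.congr {X Y : Type} [TopologicalSpace X] [TopologicalSpace Y]
    (e : ContinuousMap.HomotopyEquiv X Y) {c : ℤ} (h : FX X c) : FX Y c :=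
  FT.of_iso (fun n => ⟨homIso e n⟩) h

lemma FX.euler {X : Type} [TopologicalSpace X] {c : ℤ} (h : FX X c) : eulerChar X = c := by
  simpa [eulerChar, betti] using FT.euler h

def ptS : ((SimplicialObject.whiskering _ _).obj (ModuleCat.free.{0} ℚ)).obj
      (TopCat.toSSet.obj (TopCat.of PUnit.{1})) ≅
      (SimplicialObject.const (ModuleCat.{0} ℚ)).obj ((ModuleCat.free ℚ).obj PUnit) :=
  ((SimplicialObject.whiskering _ _).obj (ModuleCat.free ℚ)).mapIso
    (TopCat.toSSetIsoConst (TopCat.of PUnit.{1})) ≪≫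
    NatIso.ofComponents (fun _ => Iso.refl _) (fun f => by simp; rfl)

def ptI : singularChainComplex PUnit.{1} ≅
    ChainComplex.alternatingConst.obj ((ModuleCat.free.{0} ℚ).obj PUnit.{1}) :=
  (alternatingFaceMapComplex (ModuleCat ℚ)).mapIso ptS ≪≫
    alternatingFaceMapComplexConst.app ((ModuleCat.free ℚ).obj PUnit)

lemma FX_point : FX PUnit 1 := by
  let e1 : singularChainComplex PUnit ≅ ChainComplex.alternatingConst.obj ((ModuleCat.free ℚ).obj PUnit) :=
    ptI
  let e2 := (HomotopyEquiv.ofIso e1).trans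
    (ChainComplex.alternatingConstHomotopyEquiv ((ModuleCat.free ℚ).obj PUnit))
  let F := ((ModuleCat.free ℚ).obj PUnit)
  have hF : Module.finrank ℚ F = 1 := by
    change Module.finrank ℚ (PUnit →₀ ℚ) = 1
    simp
  have hF' : Module.Finite ℚ F := by
    change Module.Finite ℚ (PUnit →₀ ℚ)
    infer_instance
  have key : FT ((ChainComplex.single₀ (ModuleCat.{0} ℚ)).obj F) 1 := by
    have e0 := (HomologicalComplex.singleObjHomologySelfIso (ComplexShape.down ℕ) 0 F).toLinearEquiv
    have ez : ∀ n, Subsingleton (((ChainComplex.single₀ (ModuleCat.{0} ℚ)).obj F).homology (n+1)) :=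
      fun n => ModuleCat.subsingleton_of_isZero
        (HomologicalComplex.isZero_single_obj_homology (ComplexShape.down ℕ) 0 F (n+1) (by simp))
    refine ⟨fun n => ?_, 1, fun M hM => ?_⟩
    · cases n with
      | zero => exact Module.Finite.equiv e0.symm
      | succ n => have := ez n; infer_instance
    · obtain ⟨M, rfl⟩ : ∃ M', M = M' + 1 := ⟨M - 1, by omega⟩
      have ez' : ∀ n, Module.finrank ℚ (((ChainComplex.single₀ (ModuleCat.{0} ℚ)).obj F).homology (n+1)) = 0 :=
        fun n => by have := ez n; exact Module.finrank_zero_of_subsingleton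
      refine ⟨ez' M, ?_⟩
      rw [Finset.sum_range_succ']
      have : Module.finrank ℚ (((ChainComplex.single₀ (ModuleCat.{0} ℚ)).obj F).homology 0) = 1 := by
        rw [← hF]; exact e0.finrank_eq
      simp [ez', this]
  exact FT.of_iso (fun n => ⟨(e2.toHomologyIso n).symm⟩) key

lemma msum {A B : ModuleCat.{0} ℚ} {k : ℕ} (f : Fin k → (A ⟶ B)) :
    (∑ i : Fin k, (-1 : ℤ)^(i:ℕ) • f i) = ModuleCat.ofHom (∑ i : Fin k, (-1 : ℤ)^(i:ℕ) • (f i).hom) := by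
  apply ModuleCat.hom_ext
  rw [ModuleCat.hom_sum]
  rfl

section bridge
variable {V : Type} [TopologicalSpace V] (Y : Set V)

def brE (n : ℕ) : C(Dl n, Y) ≃ {σ : C(Dl n, V) | ∀ t, σ t ∈ Y} where
  toFun σ := ⟨⟨fun t => (σ t : V), by fun_prop⟩, fun t => (σ t).2⟩
  invFun σ := ⟨fun t => ⟨σ.1 t, σ.2 t⟩, by fun_prop⟩
  left_inv _ := rfl
  right_inv _ := rfl

def brL (n : ℕ) : (C(Dl n, Y) →₀ ℚ) ≃ₗ[ℚ] Sub Y n :=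
  (Finsupp.domLCongr (brE Y n)).trans (Finsupp.supportedEquivFinsupp _).symm

lemma brL_coe (n : ℕ) (σ : C(Dl n, Y)) :
    (brL Y n (sgc σ) : Ch V n) = sgc ((ContinuousMap.mk Subtype.val continuous_subtype_val).comp σ) := by
  classical
  change (((Finsupp.supportedEquivFinsupp {τ : C(Dl n, V) | ∀ t, τ t ∈ Y}).symm
    (Finsupp.domLCongr (R := ℚ) (brE Y n) (Finsupp.single σ (1:ℚ))) : Finsupp.supported ℚ ℚ _) : C(Dl n, V) →₀ ℚ) = _
  rw [Finsupp.domLCongr_single, Finsupp.supportedEquivFinsupp_symm_apply_coe]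
  rw [Finsupp.extendDomain_eq_embDomain_subtype, Finsupp.embDomain_single]
  rfl

lemma map_succAbove {n : ℕ} (i : Fin (n+2)) (t : Dl n) :
    stdSimplex.map i.succAbove t = aff (vx (n+1) ∘ i.succAbove) t := by
  ext j
  rw [aff_coe, stdSimplex.map_coe]
  simp only [FunOnFinite.linearMap_apply_apply, Finset.sum_apply, Pi.smul_apply]
  rw [Finset.sum_filter]
  refine Finset.sum_congr rfl fun k _ => ?_
  change _ = (t : Fin (n+1) → ℝ) k • (Pi.single (i.succAbove k) (1:ℝ) : Fin (n+2) → ℝ) j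
  rw [Pi.single_apply]
  by_cases h : i.succAbove k = j
  · simp [h]
  · simp [h, Ne.symm h]


abbrev Tn (n : ℕ) : Type := (TopCat.toSSet.obj (TopCat.of Y)).obj (Opposite.op (SimplexCategory.mk n))

def tnE (n : ℕ) : Tn Y n ≃ C(Dl n, Y) := TopCat.toSSetObjEquiv (TopCat.of Y) (Opposite.op (SimplexCategory.mk n))

def brP (n : ℕ) : (Tn Y n →₀ ℚ) ≃ₗ[ℚ] Sub Y n :=
  (Finsupp.domLCongr (tnE Y n)).trans (brL Y n)

lemma brP_single (n : ℕ) (x : Tn Y n) :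
    (brP Y n (Finsupp.single x 1) : Ch V n) =
      sgc ((ContinuousMap.mk Subtype.val continuous_subtype_val).comp (tnE Y n x)) := by
  rw [← brL_coe, brP, LinearEquiv.trans_apply, Finsupp.domLCongr_single]
  rfl

def tnd (n : ℕ) (i : Fin (n+2)) : Tn Y (n+1) → Tn Y n := (TopCat.toSSet.obj (TopCat.of Y)).δ i

lemma tnE_d (n : ℕ) (i : Fin (n+2)) (x : Tn Y (n+1)) :
    tnE Y n (tnd Y n i x) = (tnE Y (n+1) x).comp (aff (vx (n+1) ∘ i.succAbove)) := by
  ext z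
  refine congrArg _ ((TopCat.toSSetObjEquiv_δ_apply (X := TopCat.of Y) x i z).trans ?_)
  rw [map_succAbove]
  rfl

def tnD (n : ℕ) : (Tn Y (n+1) →₀ ℚ) →ₗ[ℚ] (Tn Y n →₀ ℚ) :=
  ∑ i : Fin (n+2), (-1 : ℤ)^(i:ℕ) • Finsupp.lmapDomain ℚ ℚ (tnd Y n i)

lemma scc_d (n : ℕ) : (singularChainComplex Y).d (n+1) n = ModuleCat.ofHom (tnD Y n) := by
  refine (alternatingFaceMapComplex_obj_d _ n).trans ?_
  refine (msum _).trans ?_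
  refine congrArg ModuleCat.ofHom (Finset.sum_congr rfl fun i _ => ?_)
  refine congrArg (fun z => (-1 : ℤ)^(i:ℕ) • z) ?_
  rfl

lemma brP_comm (n : ℕ) : (SY Y).dd n ∘ₗ (brP Y (n+1)).toLinearMap = (brP Y n).toLinearMap ∘ₗ tnD Y n := by
  apply Finsupp.lhom_ext'
  intro x
  apply LinearMap.ext_ring
  apply Subtype.ext
  change dC n (brP Y (n+1) (Finsupp.single x 1) : Ch V (n+1)) = (brP Y n (tnD Y n (Finsupp.single x 1)) : Ch V n)
  rw [brP_single, dC_sgc, bd_sg, map_sum, tnD, LinearMap.sum_apply, map_sum, AddSubmonoidClass.coe_finsetSum]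
  refine Finset.sum_congr rfl fun i _ => ?_
  rw [LinearMap.smul_apply, Finsupp.lmapDomain_apply, Finsupp.mapDomain_single, map_zsmul]
  have := brP_single Y n (tnd Y n i x)
  have h2 : ∀ z : Sub Y n, (((-1 : ℤ)^(i:ℕ) • z : Sub Y n) : Ch V n) = (-1 : ℤ)^(i:ℕ) • (z : Ch V n) := fun z => rfl
  rw [h2, this, tnE_d, map_smul, push_sg, ← Int.cast_smul_eq_zsmul ℚ]
  push_cast
  rfl

def brI : singularChainComplex Y ≅ (SY Y).C :=
  HomologicalComplex.Hom.isoOfComponents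
    (fun n => LinearEquiv.toModuleIso (X₁ := (Tn Y n →₀ ℚ)) (X₂ := Sub Y n) (brP Y n)) (by
    rintro i n hi
    obtain rfl : i = n + 1 := by simpa using hi.symm
    have h1 : (SY Y).C.d (n+1) n = ModuleCat.ofHom ((SY Y).dd n) := CC_d _ _ _ n
    rw [h1, scc_d]
    refine Eq.trans (b := ModuleCat.ofHom ((SY Y).dd n ∘ₗ (brP Y (n+1)).toLinearMap)) rfl ?_
    rw [brP_comm]
    rfl)

lemma FX_iff {c : ℤ} : FX Y c ↔ FT (SY Y).C c := by
  have e : ∀ n, (singularChainComplex Y).homology n ≅ (SY Y).C.homology n := fun n =>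
    (HomologicalComplex.homologyFunctor _ _ n).mapIso (brI Y)
  exact ⟨fun h => FT.of_iso (fun n => ⟨e n⟩) h, fun h => FT.of_iso (fun n => ⟨(e n).symm⟩) h⟩

end bridge

lemma FX_empty {V : Type} [TopologicalSpace V] (Y : Set V) (h : Y = ∅) : FX Y 0 := by
  rw [FX_iff]
  have : ∀ n, ∀ x : Sub Y n, x = 0 := by
    intro n x
    have : Sub Y n ≤ ⊥ := Sub_le (fun σ hσ => by
      have := hσ (vx n 0)
      simp [h] at this)
    exact Subtype.ext (by simpa using this x.2)
  exact CC_acyclic (fun x => ⟨0, (map_zero _).trans (this 0 x).symm⟩)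
    (fun n x _ => ⟨0, (map_zero _).trans (this _ x).symm⟩)

lemma FX_contractible {X : Type} [TopologicalSpace X] [ContractibleSpace X] : FX X 1 := by
  have e : ContinuousMap.HomotopyEquiv PUnit X :=
    ((ContractibleSpace.hequiv_unit X).some.trans (Homeomorph.toHomotopyEquiv
      (Homeomorph.homeomorphOfUnique Unit PUnit))).symm
  exact FX.congr e FX_point

theorem FX_MV {V : Type} [TopologicalSpace V] {Y O₁ O₂ : Set V} (h₁ : IsOpen O₁) (h₂ : IsOpen O₂)
    (hY : Y ⊆ O₁ ∪ O₂) {a b c : ℤ} (ha : FX ↥(Y ∩ O₁) a) (hb : FX ↥(Y ∩ O₂) b)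
    (hc : FX ↥(Y ∩ O₁ ∩ O₂) c) : FX Y (a + b - c) := by
  rw [FX_iff] at *
  exact MV h₁ h₂ hY ha hb hc

theorem FX_MV' {V : Type} [TopologicalSpace V] {Y O₁ O₂ : Set V} (h₁ : IsOpen O₁) (h₂ : IsOpen O₂)
    (hY : Y ⊆ O₁ ∪ O₂) {y b c : ℤ} (hy : FX Y y) (hb : FX ↥(Y ∩ O₂) b)
    (hc : FX ↥(Y ∩ O₁ ∩ O₂) c) : FX ↥(Y ∩ O₁) (y - b + c) := by
  rw [FX_iff] at *
  exact MV' h₁ h₂ hY hy hb hc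

end Sd

namespace Sd

section geom
variable {V : Type} [NormedAddCommGroup V] [NormedSpace ℂ V] [FiniteDimensional ℂ V]
variable {J : Type} (f : J → Module.Dual ℂ V) (e : Module.Dual ℂ V)

/-- affine arrangement complement inside `U` -/
def XX (U : Submodule ℂ V) (l : List J) : Set V := {x | x ∈ U ∧ e x = 1 ∧ ∀ i ∈ l, f i x ≠ 0}

lemma dual_cont (φ : Module.Dual ℂ V) : Continuous φ := LinearMap.continuous_of_finiteDimensional φ

variable (U : Submodule ℂ V) (l : List J) (α : Module.Dual ℂ V) (v : V)

def NP (p : V) (z : ℂ) : Prop := ∀ j ∈ l, ‖z‖ * ‖f j v‖ < ‖f j p‖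

/-- tubular neighbourhood pieces -/
def NC (C : Set ℂ) : Set V := {x | x ∈ U ∧ e x = 1 ∧ NP f l v (x - α x • v) (α x) ∧ α x ∈ C}

def epsf (p : V) : ℝ := (1 + (l.map (fun j => ‖f j v‖ / ‖f j p‖)).sum)⁻¹

lemma epsf_sum_nonneg (p : V) : 0 ≤ (l.map (fun j => ‖f j v‖ / ‖f j p‖)).sum := by
  apply List.sum_nonneg
  simp only [List.mem_map]
  rintro _ ⟨j, _, rfl⟩
  positivity

lemma epsf_pos (p : V) : 0 < epsf f l v p := by
  have := epsf_sum_nonneg f l v p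
  unfold epsf; positivity

lemma epsf_NP (p : V) (hp : ∀ i ∈ l, f i p ≠ 0) {z : ℂ} (hz : ‖z‖ ≤ epsf f l v p) : NP f l v p z := by
  intro j hj
  have h0 := epsf_sum_nonneg f l v p
  have h1 : ‖f j v‖ / ‖f j p‖ ≤ (l.map (fun j => ‖f j v‖ / ‖f j p‖)).sum := by
    apply List.single_le_sum
    · simp only [List.mem_map]
      rintro _ ⟨j, _, rfl⟩
      positivity
    · exact List.mem_map.2 ⟨j, hj, rfl⟩
  have hpj : 0 < ‖f j p‖ := norm_pos_iff.2 (hp j hj)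
  rw [div_le_iff₀ hpj] at h1
  set S := (l.map (fun j => ‖f j v‖ / ‖f j p‖)).sum
  have h2 : epsf f l v p * (1 + S) = 1 := by
    unfold epsf; exact inv_mul_cancel₀ (by positivity)
  have h3 := epsf_pos f l v p
  calc ‖z‖ * ‖f j v‖ ≤ epsf f l v p * (S * ‖f j p‖) := by gcongr
    _ = (1 - epsf f l v p) * ‖f j p‖ := by rw [← mul_assoc]; congr 1; linarith
    _ < ‖f j p‖ := by nlinarith

lemma NP_mono {p : V} {z w : ℂ} (hz : NP f l v p z) (h : ‖w‖ ≤ ‖z‖) : NP f l v p w := fun j hj =>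
  lt_of_le_of_lt (by gcongr) (hz j hj)

lemma NP_seg {p : V} {z w : ℂ} (hz : NP f l v p z) (hw : NP f l v p w) {t : ℝ} (ht : t ∈ Set.Icc (0:ℝ) 1) :
    NP f l v p ((1 - t : ℝ) * z + (t : ℝ) * w) := by
  have key : ‖((1 - t : ℝ) * z + (t : ℝ) * w : ℂ)‖ ≤ max ‖z‖ ‖w‖ := by
    refine (norm_add_le _ _).trans ?_
    rw [norm_mul, norm_mul, Complex.norm_real, Complex.norm_real, Real.norm_of_nonneg (by linarith [ht.2]),
      Real.norm_of_nonneg ht.1]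
    have h1 := le_max_left ‖z‖ ‖w‖
    have h2 := le_max_right ‖z‖ ‖w‖
    nlinarith [ht.1, ht.2]
  rcases le_total ‖z‖ ‖w‖ with h | h
  · rw [max_eq_right h] at key; exact NP_mono f l v hw key
  · rw [max_eq_left h] at key; exact NP_mono f l v hz key

variable {U l α v}

lemma NP_ne {p : V} {z : ℂ} (h : NP f l v p z) : ∀ i ∈ l, f i p ≠ 0 := fun i hi h0 => by
  have := h i hi
  rw [h0, norm_zero] at this
  exact absurd this (not_lt.2 (by positivity))

lemma NP_ne' {p : V} {z : ℂ} (h : NP f l v p z) : ∀ i ∈ l, f i (p + z • v) ≠ 0 := fun i hi h0 => by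
  have h1 := h i hi
  rw [map_add, map_smul, smul_eq_mul] at h0
  rw [eq_neg_of_add_eq_zero_left h0, norm_neg, norm_mul] at h1
  exact absurd h1 (lt_irrefl _)

lemma epsf_cont : Continuous (fun p : XX f e (U ⊓ LinearMap.ker α) l => epsf f l v (p : V)) := by
  unfold epsf
  apply Continuous.inv₀
  · refine continuous_const.add ?_
    refine continuous_list_sum l (fun j hj => ?_)
    refine continuous_const.div (((dual_cont (f j)).comp continuous_subtype_val).norm) ?_
    exact fun p => norm_ne_zero_iff.2 (p.2.2.2 j hj)
  · intro p
    have := epsf_sum_nonneg f l v (p : V)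
    positivity

lemma sec_mem (hvU : v ∈ U) (hev : e v = 0) (hav : α v = 1) {C : Set ℂ} {p : V} {z : ℂ}
    (hp : p ∈ U) (hpe : e p = 1) (hpa : α p = 0) (hz : NP f l v p z) (hC : z ∈ C) : p + z • v ∈ NC f e U l α v C := by
  have ha : α (p + z • v) = z := by simp [hpa, hav]
  refine ⟨U.add_mem hp (U.smul_mem _ hvU), by simp [hpe, hev], ?_, by rw [ha]; exact hC⟩
  rw [ha, add_sub_cancel_right]; exact hz

def NCequiv (hvU : v ∈ U) (hev : e v = 0) (hav : α v = 1) {C : Set ℂ} {ω : ℂ} (hω : ‖ω‖ ≤ 1)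
    (hC0 : ∀ ε : ℝ, 0 < ε → (ε : ℂ) * ω ∈ C)
    (hC : ∀ ε : ℝ, 0 < ε → ∀ z ∈ C, ∀ t ∈ Set.Icc (0:ℝ) 1, (1 - t : ℝ) * ((ε : ℂ) * ω) + (t:ℝ) * z ∈ C) :
    ContinuousMap.HomotopyEquiv (XX f e (U ⊓ LinearMap.ker α) l) (NC f e U l α v C) := by
  have hn : ∀ p : V, ‖(epsf f l v p : ℂ) * ω‖ ≤ epsf f l v p := by
    intro p
    rw [norm_mul, Complex.norm_real, Real.norm_of_nonneg (epsf_pos f l v p).le]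
    exact mul_le_of_le_one_right (epsf_pos f l v p).le hω
  have hpm : ∀ x ∈ NC f e U l α v C, x - α x • v ∈ XX f e (U ⊓ LinearMap.ker α) l := by
    intro x hx
    refine ⟨⟨U.sub_mem hx.1 (U.smul_mem _ hvU), by simp [hav]⟩, by simp [hx.2.1, hev], NP_ne f hx.2.2.1⟩
  have hac : Continuous α := dual_cont α
  let F : C(XX f e (U ⊓ LinearMap.ker α) l, NC f e U l α v C) :=
    ⟨fun p => ⟨(p : V) + ((epsf f l v p : ℂ) * ω) • v, sec_mem f e hvU hev hav p.2.1.1 p.2.2.1 p.2.1.2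
      (epsf_NP f l v p p.2.2.2 (hn p)) (hC0 _ (epsf_pos f l v p))⟩, by
      refine Continuous.subtype_mk ?_ _
      have h1 := epsf_cont f e (U := U) (l := l) (α := α) (v := v)
      fun_prop⟩
  let G : C(NC f e U l α v C, XX f e (U ⊓ LinearMap.ker α) l) :=
    ⟨fun x => ⟨(x : V) - α x • v, hpm x x.2⟩, by
      refine Continuous.subtype_mk ?_ _
      fun_prop⟩
  refine ⟨F, G, ?_, ?_⟩
  · have : G.comp F = ContinuousMap.id _ := by
      ext p
      have hp : α (p : V) = 0 := p.2.1.2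
      simp [F, G, hp, hav]
    rw [this]
  · refine ⟨⟨⟨fun q => ⟨(G q.2 : V) + (((1 - (q.1:ℝ) : ℝ) * ((epsf f l v (G q.2 : V) : ℂ) * ω) + ((q.1:ℝ):ℝ) * α (q.2 : V) : ℂ)) • v, ?_⟩, ?_⟩, ?_, ?_⟩⟩
    · refine sec_mem f e hvU hev hav (G q.2).2.1.1 (G q.2).2.2.1 (G q.2).2.1.2 ?_ (hC _ (epsf_pos f l v _) _ q.2.2.2.2.2 _ q.1.2)
      exact NP_seg f l v (epsf_NP f l v _ (G q.2).2.2.2 (hn _)) q.2.2.2.2.1 q.1.2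
    · refine Continuous.subtype_mk ?_ _
      have h1 := (epsf_cont f e (U := U) (l := l) (α := α) (v := v)).comp G.continuous
      have h2 : Continuous (fun q : unitInterval × NC f e U l α v C => epsf f l v (G q.2 : V)) := h1.comp continuous_snd
      have h3 : Continuous (fun q : unitInterval × NC f e U l α v C => (G q.2 : V)) := continuous_subtype_val.comp (G.continuous.comp continuous_snd)
      fun_prop
    · intro x
      apply Subtype.ext
      simp [F]
    · intro x
      apply Subtype.ext
      simp [G]

lemma NC_eq_inter {C D : Set ℂ} : NC f e U l α v C ∩ {x | α x ∈ D} = NC f e U l α v (C ∩ D) := by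
  ext x
  simp only [NC, Set.mem_inter_iff, Set.mem_setOf_eq]
  tauto

lemma FX_cast {V : Type} [TopologicalSpace V] {Y Z : Set V} {c : ℤ} (h : Y = Z) (hY : FX Y c) : FX Z c := h ▸ hY

theorem FX_step (hvU : v ∈ U) (hev : e v = 0) (hav : α v = 1) {y h : ℤ} (hY : FX (XX f e U l) y)
    (hH : FX (XX f e (U ⊓ LinearMap.ker α) l) h) : FX ↥(XX f e U l ∩ {x | α x ≠ 0}) (y - h) := by
  have hac : Continuous α := dual_cont α
  have e0 : FX (NC f e U l α v Set.univ) h := FX.congr (NCequiv f e hvU hev hav (ω := 0) (by simp) (by simp) (by simp)) hH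
  have e1 : FX (NC f e U l α v Complex.slitPlane) h := by
    refine FX.congr (NCequiv f e hvU hev hav (ω := 1) (by simp) ?_ ?_) hH
    · intro ε hε; left; simpa using hε
    · intro ε hε z hz t ht
      rcases ht.1.eq_or_lt with h0 | h0
      · left; rw [← h0]; simpa using hε
      · rcases hz with hz | hz
        · left; simp; nlinarith [ht.2, mul_pos h0 hz]
        · right; simp; exact ⟨h0.ne', hz⟩
  have e2 : FX (NC f e U l α v {z | -z ∈ Complex.slitPlane}) h := by
    refine FX.congr (NCequiv f e hvU hev hav (ω := -1) (by simp) ?_ ?_) hH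
    · intro ε hε; left; simpa using hε
    · intro ε hε z hz t ht
      rcases ht.1.eq_or_lt with h0 | h0
      · left; rw [← h0]; simpa using hε
      · rcases hz with hz | hz
        · left; simp at hz ⊢; nlinarith [ht.2, mul_pos h0 (neg_pos.2 hz)]
        · right; simp at hz ⊢; exact ⟨h0.ne', hz⟩
  have e3 : FX (NC f e U l α v {z | 0 < z.im}) h := by
    refine FX.congr (NCequiv f e hvU hev hav (ω := Complex.I) (by simp) ?_ ?_) hH
    · intro ε hε; simpa using hε
    · intro ε hε z hz t ht
      simp at hz ⊢
      rcases ht.1.eq_or_lt with h0 | h0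
      · rw [← h0]; simpa using hε
      · nlinarith [ht.2, mul_pos h0 hz]
  have e4 : FX (NC f e U l α v {z | z.im < 0}) h := by
    refine FX.congr (NCequiv f e hvU hev hav (ω := -Complex.I) (by simp) ?_ ?_) hH
    · intro ε hε; simpa using hε
    · intro ε hε z hz t ht
      simp at hz ⊢
      rcases ht.1.eq_or_lt with h0 | h0
      · rw [← h0]; simpa using hε
      · nlinarith [ht.2, mul_pos h0 (neg_pos.2 hz)]
  have o1 : IsOpen {x : V | 0 < (α x).im} := isOpen_lt continuous_const (Complex.continuous_im.comp hac)
  have o2 : IsOpen {x : V | (α x).im < 0} := isOpen_lt (Complex.continuous_im.comp hac) continuous_const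
  have o3 : IsOpen {x : V | α x ∈ Complex.slitPlane} := Complex.isOpen_slitPlane.preimage hac
  have o4 : IsOpen {x : V | -α x ∈ Complex.slitPlane} := Complex.isOpen_slitPlane.preimage hac.neg
  have e5 : FX (NC f e U l α v {z | z.im ≠ 0}) (h + h - 0) := by
    refine FX_MV o1 o2 ?_ (FX_cast ?_ e3) (FX_cast ?_ e4) (FX_empty _ ?_)
    · intro x hx
      rcases lt_or_gt_of_ne hx.2.2.2 with h | h
      · right; exact h
      · left; exact h
    · refine Eq.trans ?_ (NC_eq_inter f e (D := {z | 0 < z.im})).symm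
      congr 1; ext z; simp; intro h; exact h.ne'
    · refine Eq.trans ?_ (NC_eq_inter f e (D := {z | z.im < 0})).symm
      congr 1; ext z; simp; intro h; exact h.ne
    · ext x
      simp only [Set.mem_inter_iff, Set.mem_setOf_eq, Set.mem_empty_iff_false, iff_false]
      rintro ⟨⟨_, h1⟩, h2⟩
      exact lt_asymm h1 h2
  have e6 : FX (NC f e U l α v {z | z ≠ 0}) (h + h - (h + h - 0)) := by
    refine FX_MV o3 o4 ?_ (FX_cast ?_ e1) (FX_cast ?_ e2) (FX_cast ?_ e5)
    · intro x hx
      have hx0 : α x ≠ 0 := hx.2.2.2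
      simp only [Set.mem_union, Set.mem_setOf_eq, Complex.mem_slitPlane_iff, Complex.neg_re, Complex.neg_im]
      by_contra hcon
      push Not at hcon
      exact hx0 (Complex.ext (by simp; linarith) (by simpa using hcon.1.2))
    · refine Eq.trans ?_ (NC_eq_inter f e (D := Complex.slitPlane)).symm
      congr 1; ext z
      simp only [Set.mem_inter_iff, Set.mem_setOf_eq]
      exact ⟨fun h => ⟨Complex.slitPlane_ne_zero h, h⟩, fun h => h.2⟩
    · refine Eq.trans ?_ (NC_eq_inter f e (D := {z | -z ∈ Complex.slitPlane})).symm
      congr 1; ext z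
      simp only [Set.mem_inter_iff, Set.mem_setOf_eq]
      exact ⟨fun h => ⟨neg_ne_zero.1 (Complex.slitPlane_ne_zero h), h⟩, fun h => h.2⟩
    · refine Eq.trans ?_ (congrArg (fun z => z ∩ _) (NC_eq_inter f e (D := Complex.slitPlane)).symm)
      refine Eq.trans ?_ (NC_eq_inter f e (D := {z | -z ∈ Complex.slitPlane})).symm
      congr 1; ext z
      simp only [Set.mem_inter_iff, Set.mem_setOf_eq, Complex.mem_slitPlane_iff, Complex.neg_re, Complex.neg_im]
      constructor
      · intro h
        exact ⟨⟨fun h0 => h (by simp [h0]), Or.inr h⟩, Or.inr (by simpa using h)⟩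
      · rintro ⟨⟨_, h1⟩, h2⟩ h0
        simp [h0] at h1 h2
        linarith
  let O₂ : Set V := {x | NP f l v (x - α x • v) (α x)}
  have hO₂ : IsOpen O₂ := by
    have : O₂ = ⋂ j ∈ {j | j ∈ l}, {x | ‖α x‖ * ‖f j v‖ < ‖f j (x - α x • v)‖} := by
      ext x; simp [O₂, NP]
    rw [this]
    refine Set.Finite.isOpen_biInter (List.finite_toSet l) (fun j _ => ?_)
    have := dual_cont (f j)
    exact isOpen_lt (by fun_prop) (by fun_prop)
  have hO₁ : IsOpen {x : V | α x ≠ 0} := isOpen_ne_fun hac continuous_const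
  have key := FX_MV' (Y := XX f e U l) hO₁ hO₂ ?_ hY (FX_cast ?_ e0) (FX_cast ?_ e6)
  · convert key using 1; ring
  · intro x hx
    by_cases h0 : α x = 0
    · right
      intro j hj
      simp only [h0, zero_smul, sub_zero, norm_zero, zero_mul, norm_pos_iff]
      exact hx.2.2 j hj
    · left; exact h0
  · ext x
    constructor
    · rintro ⟨h1, h2, h3, -⟩
      refine ⟨⟨h1, h2, fun i hi => ?_⟩, h3⟩
      simpa using NP_ne' f h3 i hi
    · rintro ⟨⟨h1, h2, h4⟩, h3⟩
      exact ⟨h1, h2, h3, trivial⟩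
  · ext x
    constructor
    · rintro ⟨h1, h2, h3, h4⟩
      refine ⟨⟨⟨h1, h2, fun i hi => ?_⟩, h4⟩, h3⟩
      simpa using NP_ne' f h3 i hi
    · rintro ⟨⟨⟨h1, h2, h4⟩, h5⟩, h3⟩
      exact ⟨h1, h2, h3, h5⟩

end geom
end Sd

namespace Sd

section chi
variable {V : Type} [AddCommGroup V] [Module ℂ V]
variable {J : Type} (f : J → Module.Dual ℂ V) (e : Module.Dual ℂ V)

open Classical in
/-- Euler characteristic by deletion and restriction -/
def chi : List J → Submodule ℂ V → ℤ
  | [], U => if U ≤ LinearMap.ker e then 0 else 1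
  | i :: l, U => if U ≤ LinearMap.ker (f i) then 0 else
      if U ⊓ LinearMap.ker e ≤ LinearMap.ker (f i) then chi l U else
        chi l U - chi l (U ⊓ LinearMap.ker (f i))

end chi

theorem FX_chi {V : Type} [NormedAddCommGroup V] [NormedSpace ℂ V] [FiniteDimensional ℂ V]
    {J : Type} (f : J → Module.Dual ℂ V) (e : Module.Dual ℂ V) (l : List J) (U : Submodule ℂ V) :
    FX (XX f e U l) (chi f e l U) := by
  induction l generalizing U with
  | nil =>
    rw [chi]
    split_ifs with h
    · apply FX_empty
      ext x
      simp only [XX, Set.mem_ofPred_eq, Set.mem_empty_iff_false, iff_false]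
      rintro ⟨h1, h2, -⟩
      have : e x = 0 := h h1
      simp [this] at h2
    · obtain ⟨u, hu, hu'⟩ := Set.not_subset.1 h
      have hu'' : e u ≠ 0 := hu'
      let : NormedSpace ℝ V := NormedSpace.restrictScalars ℝ ℂ V
      have hc : Convex ℝ (XX f e U []) := by
        intro x hx y hy a b ha hb hab
        have h1 : ∀ (c : ℝ) (z : V), c • z = (c : ℂ) • z := fun c z => rfl
        rw [h1, h1]
        refine ⟨U.add_mem (U.smul_mem _ hx.1) (U.smul_mem _ hy.1), ?_, by simp⟩
        rw [map_add, map_smul, map_smul, hx.2.1, hy.2.1]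
        simp only [smul_eq_mul, mul_one]
        exact_mod_cast hab
      have hne : (XX f e U []).Nonempty := ⟨(e u)⁻¹ • u, U.smul_mem _ hu, by simp [hu''], by simp⟩
      have := hc.contractibleSpace hne
      exact FX_contractible
  | cons i l ih =>
    have hXX : XX f e U (i :: l) = XX f e U l ∩ {x | f i x ≠ 0} := by
      ext x
      simp only [XX, List.mem_cons, forall_eq_or_imp, Set.mem_inter_iff, Set.mem_ofPred_eq]
      tauto
    rw [chi]
    split_ifs with h1 h2
    · apply FX_empty
      ext x
      simp only [XX, Set.mem_ofPred_eq, Set.mem_empty_iff_false, iff_false]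
      rintro ⟨h3, h2, h4⟩
      exact h4 i (by simp) (h1 h3)
    · refine FX_cast ?_ (ih U)
      rw [hXX, eq_comm, Set.inter_eq_left]
      intro x hx h0
      apply h1
      intro u hu
      have := h2 ⟨U.sub_mem hu (U.smul_mem (e u) hx.1), by simp [hx.2.1]⟩
      simpa [show f i x = 0 from h0] using this
    · obtain ⟨u, hu, hu'⟩ := Set.not_subset.1 h2
      have hu'' : f i u ≠ 0 := hu'
      rw [hXX]
      exact FX_step f e (v := (f i u)⁻¹ • u) (U.smul_mem _ hu.1)
        (by simp [show e u = 0 from hu.2]) (by simp [hu'']) (ih U) (ih _)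

/-- columns of `L` as linear forms -/
def colF {d n : ℕ} (L : Matrix (Fin (d+1)) (Fin (n+1)) ℂ) (i : Fin (n+1)) : Module.Dual ℂ (Fin (d+1) → ℂ) :=
  Fintype.linearCombination ℂ (fun r => L r i)

def e0F (d : ℕ) : Module.Dual ℂ (Fin (d+1) → ℂ) := LinearMap.proj 0

lemma colF_cons {d n : ℕ} (L : Matrix (Fin (d+1)) (Fin (n+1)) ℂ) (i : Fin (n+1)) (x : Fin d → ℂ) :
    colF L i (Fin.cons 1 x) = ell ℂ L x i := by
  simp [colF, ell, Fintype.linearCombination_apply, Fin.sum_univ_succ]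

theorem eulerChar_complement {d n : ℕ} (L : Matrix (Fin (d+1)) (Fin (n+1)) ℂ) :
    eulerChar ↥(complementX L) = chi (colF L) (e0F d) (List.finRange (n+1)) ⊤ := by
  apply FX.euler
  have h := FX_chi (colF L) (e0F d) (List.finRange (n+1)) ⊤
  refine FX.congr (Homeomorph.toHomotopyEquiv ?_) h
  refine
    { toFun := fun x => ⟨Fin.tail (x : Fin (d+1) → ℂ), ?_⟩
      invFun := fun x => ⟨Fin.cons 1 (x : Fin d → ℂ), ?_⟩
      left_inv := ?_
      right_inv := ?_
      continuous_toFun := ?_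
      continuous_invFun := ?_ }
  · intro i
    rw [← colF_cons]
    have h1 : (x : Fin (d+1) → ℂ) 0 = 1 := x.2.2.1
    rw [← h1, Fin.cons_self_tail]
    exact x.2.2.2 i (List.mem_finRange i)
  · refine ⟨trivial, rfl, fun i _ => ?_⟩
    rw [colF_cons]; exact x.2 i
  · intro x
    have h1 : (x : Fin (d+1) → ℂ) 0 = 1 := x.2.2.1
    apply Subtype.ext
    change (Fin.cons 1 (Fin.tail (x : Fin (d+1) → ℂ)) : Fin (d+1) → ℂ) = x
    rw [← h1, Fin.cons_self_tail]
  · intro x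
    apply Subtype.ext
    change Fin.tail (Fin.cons (1:ℂ) (x : Fin d → ℂ) : Fin (d+1) → ℂ) = x
    exact Fin.tail_cons _ _
  · refine Continuous.subtype_mk ?_ _
    refine continuous_pi (fun j => ?_)
    exact (continuous_apply _).comp continuous_subtype_val
  · refine Continuous.subtype_mk ?_ _
    refine continuous_pi (fun j => ?_)
    refine Fin.cases ?_ (fun k => ?_) j
    · exact continuous_const
    · exact (continuous_apply (A := fun _ : Fin d => ℂ) k).comp continuous_subtype_val

end Sd

namespace Sd

section linalg
variable {P : Type} [AddCommGroup P] [Module ℂ P]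

/-- dimension of the image of `A` modulo `K` -/
def rr (A K : Submodule ℂ P) : ℕ := Module.finrank ℂ (A.map K.mkQ)

lemma finrank_map_eq_of_ker {Q₁ Q₂ : Type*} [AddCommGroup Q₁] [Module ℂ Q₁] [AddCommGroup Q₂] [Module ℂ Q₂]
    (A : Submodule ℂ P) (g₁ : P →ₗ[ℂ] Q₁) (g₂ : P →ₗ[ℂ] Q₂) (h : ∀ u ∈ A, g₁ u = 0 ↔ g₂ u = 0) :
    Module.finrank ℂ (A.map g₁) = Module.finrank ℂ (A.map g₂) := by
  have e1 := (g₁.domRestrict A).quotKerEquivRange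
  have e2 := (g₂.domRestrict A).quotKerEquivRange
  have hk : LinearMap.ker (g₁.domRestrict A) = LinearMap.ker (g₂.domRestrict A) := by
    ext u; simpa using h u u.2
  have r1 : LinearMap.range (g₁.domRestrict A) = A.map g₁ := LinearMap.range_domRestrict A g₁
  have r2 : LinearMap.range (g₂.domRestrict A) = A.map g₂ := LinearMap.range_domRestrict A g₂
  rw [← r1, ← r2, ← e1.finrank_eq, ← e2.finrank_eq, hk]

lemma finrank_map_le_of_ker {Q₁ Q₂ : Type*} [AddCommGroup Q₁] [Module ℂ Q₁] [AddCommGroup Q₂] [Module ℂ Q₂]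
    (A : Submodule ℂ P) [FiniteDimensional ℂ A] (g₁ : P →ₗ[ℂ] Q₁) (g₂ : P →ₗ[ℂ] Q₂)
    (h : ∀ u ∈ A, g₂ u = 0 → g₁ u = 0) :
    Module.finrank ℂ (A.map g₁) ≤ Module.finrank ℂ (A.map g₂) := by
  have r1 : LinearMap.range (g₁.domRestrict A) = A.map g₁ := LinearMap.range_domRestrict A g₁
  have r2 : LinearMap.range (g₂.domRestrict A) = A.map g₂ := LinearMap.range_domRestrict A g₂
  have e1 := LinearMap.finrank_range_add_finrank_ker (g₁.domRestrict A)
  have e2 := LinearMap.finrank_range_add_finrank_ker (g₂.domRestrict A)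
  have : Module.finrank ℂ (LinearMap.ker (g₂.domRestrict A)) ≤ Module.finrank ℂ (LinearMap.ker (g₁.domRestrict A)) := by
    apply Submodule.finrank_mono
    intro u hu
    exact h u u.2 hu
  rw [← r1, ← r2]
  omega

lemma rr_sup (A C K : Submodule ℂ P) [FiniteDimensional ℂ A] [FiniteDimensional ℂ C] :
    rr (A ⊔ C) K = rr A K + Module.finrank ℂ (C.map (A ⊔ K).mkQ) := by
  let E := (A ⊔ C).map K.mkQ
  let g : (P ⧸ K) →ₗ[ℂ] (P ⧸ (A ⊔ K)) := Submodule.factor le_sup_right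
  have hfin : FiniteDimensional ℂ E := inferInstance
  have h1 := LinearMap.finrank_range_add_finrank_ker (g.domRestrict E)
  have h2 : LinearMap.range (g.domRestrict E) = C.map (A ⊔ K).mkQ := by
    rw [LinearMap.range_domRestrict]
    simp only [E]
    rw [← Submodule.map_comp, Submodule.map_sup]
    have : g ∘ₗ K.mkQ = (A ⊔ K).mkQ := by ext; rfl
    rw [this, sup_eq_right]
    rw [Submodule.map_le_iff_le_comap]
    refine le_trans ?_ (LinearMap.ker_le_comap _)
    rw [Submodule.ker_mkQ]; exact le_sup_left
  have h3 : Module.finrank ℂ (LinearMap.ker (g.domRestrict E)) = rr A K := by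
    have hle : A.map K.mkQ ≤ E := Submodule.map_mono le_sup_left
    have : LinearMap.ker (g.domRestrict E) = (A.map K.mkQ).comap E.subtype := by
      ext ⟨u, hu⟩
      obtain ⟨w, rfl⟩ := K.mkQ_surjective u
      simp only [LinearMap.mem_ker, LinearMap.domRestrict_apply, Submodule.mem_comap, Submodule.subtype_apply]
      change (A ⊔ K).mkQ w = 0 ↔ _
      rw [← LinearMap.mem_ker, Submodule.ker_mkQ, Submodule.mem_sup, Submodule.mem_map]
      constructor
      · rintro ⟨a, ha, k, hk, rfl⟩
        refine ⟨a, ha, ?_⟩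
        rw [map_add]; simp [hk]
      · rintro ⟨a, ha, h⟩
        refine ⟨a, ha, w - a, ?_, by abel⟩
        rw [Submodule.mkQ_apply, Submodule.mkQ_apply, eq_comm, Submodule.Quotient.eq] at h
        exact h
    rw [this]
    exact (Submodule.comapSubtypeEquivOfLe hle).finrank_eq
  rw [h2, h3] at h1
  change Module.finrank ℂ E = _
  omega

lemma rr_le {A B K J : Submodule ℂ P} [FiniteDimensional ℂ A] [FiniteDimensional ℂ B] {φ : P →ₗ[ℂ] P}
    (h : ∀ u ∈ B, u ∈ J → φ u ∈ A ⊔ K) : rr (A ⊔ B.map φ) K ≤ rr A K + rr B J := by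
  rw [rr_sup, ← Submodule.map_comp]
  refine Nat.add_le_add_left (finrank_map_le_of_ker B _ _ ?_) _
  intro u hu h0
  have := h u hu (by simpa using h0)
  simpa using this

lemma rr_ge {A B K J : Submodule ℂ P} [FiniteDimensional ℂ A] [FiniteDimensional ℂ B] {φ : P →ₗ[ℂ] P}
    (h : ∀ u ∈ B, φ u ∈ A ⊔ K → u ∈ J) : rr A K + rr B J ≤ rr (A ⊔ B.map φ) K := by
  rw [rr_sup, ← Submodule.map_comp]
  refine Nat.add_le_add_left (finrank_map_le_of_ker B _ _ ?_) _
  intro u hu h0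
  have := h u hu (by simpa using h0)
  simpa using this

end linalg

section Pq
variable {J : Type}
open MvPolynomial

def mono (m : List J) : MvPolynomial J ℂ := (m.map X).prod

/-- span of degree `q` monomials in the variables from `l` -/
def Pq (l : List J) (q : ℕ) : Submodule ℂ (MvPolynomial J ℂ) :=
  Submodule.span ℂ {p | ∃ m : List J, m.length = q ∧ (∀ j ∈ m, j ∈ l) ∧ p = mono m}

lemma mono_mem {l m : List J} (h : ∀ j ∈ m, j ∈ l) : mono m ∈ Pq l m.length :=
  Submodule.subset_span ⟨m, rfl, h, rfl⟩

instance (l : List J) (q : ℕ) : FiniteDimensional ℂ (Pq l q) := by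
  apply FiniteDimensional.span_of_finite
  have : {p : MvPolynomial J ℂ | ∃ m : List J, m.length = q ∧ (∀ j ∈ m, j ∈ l) ∧ p = mono m} ⊆
      Set.range (fun g : Fin q → {j // j ∈ l} => mono (List.ofFn (fun k => (g k : J)))) := by
    rintro _ ⟨m, rfl, h, rfl⟩
    refine ⟨fun k => ⟨m.get k, h _ (List.get_mem m k)⟩, ?_⟩
    simp
  have hf : Finite {j // j ∈ l} := List.finite_toSet l
  exact (Set.finite_range _).subset this

lemma Pq_mono {l l' : List J} (h : ∀ j ∈ l, j ∈ l') (q : ℕ) : Pq l q ≤ Pq l' q := by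
  apply Submodule.span_mono
  rintro _ ⟨m, rfl, h', rfl⟩
  exact ⟨m, rfl, fun j hj => h j (h' j hj), rfl⟩

lemma X_mul_Pq {l : List J} {j : J} (hj : j ∈ l) {q : ℕ} {u : MvPolynomial J ℂ} (hu : u ∈ Pq l q) :
    X j * u ∈ Pq l (q+1) := by
  have : Pq l q ≤ (Pq l (q+1)).comap (LinearMap.mulLeft ℂ (X j)) := by
    unfold Pq
    rw [Submodule.span_le]
    rintro _ ⟨m, rfl, h, rfl⟩
    refine Submodule.subset_span ⟨j :: m, rfl, ?_, ?_⟩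
    · simp [hj]; exact h
    · simp [mono]
  exact this hu

lemma Xpow_mul_Pq {l : List J} {j : J} (hj : j ∈ l) {q : ℕ} {u : MvPolynomial J ℂ} (hu : u ∈ Pq l q) (k : ℕ) :
    X j ^ k * u ∈ Pq l (q+k) := by
  induction k with
  | zero => simpa using hu
  | succ k ih => rw [pow_succ', mul_assoc]; exact X_mul_Pq hj ih

/-- filtration by the power of `X i` -/
def Gm (i : J) (l : List J) (q : ℕ) : ℕ → Submodule ℂ (MvPolynomial J ℂ)
  | 0 => Pq l q
  | m + 1 => Gm i l q m ⊔ (Pq l (q - (m+1))).map (LinearMap.mulLeft ℂ (X i ^ (m+1)))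

instance Gm_fin (i : J) (l : List J) (q m : ℕ) : FiniteDimensional ℂ (Gm i l q m) := by
  induction m with
  | zero => rw [Gm]; infer_instance
  | succ m ih => rw [Gm]; infer_instance

lemma mem_Gm (i : J) (l : List J) {q m k : ℕ} (hk : k ≤ m) {u : MvPolynomial J ℂ} (hu : u ∈ Pq l (q - k)) :
    X i ^ k * u ∈ Gm i l q m := by
  induction m with
  | zero => obtain rfl : k = 0 := by omega
            simpa [Gm] using hu
  | succ m ih =>
    rw [Gm]
    rcases Nat.lt_or_ge m k with h | h
    · obtain rfl : k = m + 1 := by omega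
      exact Submodule.mem_sup_right ⟨u, hu, rfl⟩
    · exact Submodule.mem_sup_left (ih h)

lemma Gm_le (i : J) (l : List J) (q : ℕ) {m : ℕ} (hm : m ≤ q) : Gm i l q m ≤ Pq (i :: l) q := by
  induction m with
  | zero => exact Pq_mono (fun j hj => List.mem_cons_of_mem _ hj) q
  | succ m ih =>
    rw [Gm]
    refine sup_le (ih (by omega)) ?_
    rintro _ ⟨u, hu, rfl⟩
    have := Xpow_mul_Pq (l := i :: l) (j := i) (by simp) (Pq_mono (fun j hj => List.mem_cons_of_mem _ hj) _ hu) (m+1)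
    rw [Nat.sub_add_cancel hm] at this
    exact this

lemma Pq_cons (i : J) (l : List J) (q : ℕ) : Pq (i :: l) q = Gm i l q q := by
  classical
  refine le_antisymm ?_ (Gm_le i l q le_rfl)
  unfold Pq
  rw [Submodule.span_le]
  rintro _ ⟨m, rfl, h, rfl⟩
  have key : ∀ m : List J, (∀ j ∈ m, j ∈ i :: l) →
      ∃ k, ∃ m' : List J, k ≤ m.length ∧ m'.length = m.length - k ∧ (∀ j ∈ m', j ∈ l) ∧ mono m = X i ^ k * mono m' := by
    intro m
    induction m with
    | nil => intro _; exact ⟨0, [], by simp, by simp, by simp, by simp⟩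
    | cons a m ih =>
      intro h
      obtain ⟨k, m', h1, h2, h3, h4⟩ := ih (fun j hj => h j (List.mem_cons_of_mem _ hj))
      rcases List.mem_cons.1 (h a (by simp)) with rfl | ha
      · refine ⟨k+1, m', by simpa using h1, by simp [h2], h3, ?_⟩
        simp only [mono, List.map_cons, List.prod_cons] at h4 ⊢
        rw [h4]; ring
      · refine ⟨k, a :: m', by simp; omega, by simp; omega, ?_, ?_⟩
        · simp [ha]; exact h3
        · simp only [mono, List.map_cons, List.prod_cons] at h4 ⊢
          rw [h4]; ring
  obtain ⟨k, m', h1, h2, h3, h4⟩ := key m h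
  rw [h4]
  refine mem_Gm i l h1 ?_
  rw [← h2]; exact mono_mem h3

lemma Pq_nil (q : ℕ) : Pq ([] : List J) q = if q = 0 then Submodule.span ℂ {1} else ⊥ := by
  unfold Pq
  split_ifs with h
  · congr 1
    ext p
    simp only [Set.mem_ofPred_eq, Set.mem_singleton_iff]
    constructor
    · rintro ⟨m, h1, _, rfl⟩
      rw [h, List.length_eq_zero_iff] at h1
      simp [h1, mono]
    · rintro rfl
      exact ⟨[], by simp [h], by simp, by simp [mono]⟩
  · rw [Submodule.span_eq_bot]
    rintro _ ⟨m, h1, h2, rfl⟩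
    exfalso
    cases m with
    | nil => simp at h1; omega
    | cons a m => simpa using h2 a (by simp)

lemma Pq_all [Fintype J] (l : List J) (hl : ∀ j, j ∈ l) (q : ℕ) : Pq l q = homogeneousSubmodule J ℂ q := by
  apply le_antisymm
  · unfold Pq
    rw [Submodule.span_le]
    rintro _ ⟨m, rfl, h, rfl⟩
    change (mono m).IsHomogeneous m.length
    clear h
    induction m with
    | nil => simpa [mono] using isHomogeneous_one J ℂ
    | cons a m ih =>
      simp only [mono, List.map_cons, List.prod_cons, List.length_cons] at ih ⊢
      rw [add_comm]
      exact (isHomogeneous_X ℂ a).mul ih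
  · intro u hu
    rw [u.as_sum]
    refine Submodule.sum_mem _ (fun s hs => ?_)
    have hdeg : s.degree = q := by
      have := (mem_homogeneousSubmodule q u).1 hu (mem_support_iff.1 hs)
      rw [← this]
      exact congrFun (congrArg DFunLike.coe (Finsupp.degree_eq_weight_one (σ := J) (R := ℕ))) s
    rw [← mul_one (coeff s u), ← smul_eq_mul, ← smul_monomial]
    refine Submodule.smul_mem _ _ ?_
    clear hs
    subst hdeg
    have hs2 : monomial s (1:ℂ) = mono s.toMultiset.toList := by
      rw [mono, ← Multiset.prod_coe, ← Multiset.map_coe, Multiset.coe_toList, Finsupp.toMultiset_map,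
        Finsupp.prod_toMultiset, Finsupp.prod_mapDomain_index (by simp) (by intros; rw [pow_add]), monomial_eq]
      simp
    rw [hs2]
    have := mono_mem (l := l) (m := s.toMultiset.toList) (fun j _ => hl j)
    rw [Multiset.length_toList, Finsupp.card_toMultiset] at this
    exact this
end Pq
end Sd

namespace Sd

section NN
variable {V : Type} [AddCommGroup V] [Module ℂ V]
variable {J : Type} (f : J → Module.Dual ℂ V)
open MvPolynomial

open Classical in
/-- the Hilbert function, by deletion and restriction -/
def NN : List J → Submodule ℂ V → ℕ → ℕ
  | [], _, q => if q = 0 then 1 else 0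
  | i :: l, U, q => if U ≤ LinearMap.ker (f i) then 0 else
      NN l U q + ∑ p ∈ Finset.range q, NN l (U ⊓ LinearMap.ker (f i)) p

lemma rr_zero_of_le {P : Type} [AddCommGroup P] [Module ℂ P] {A K : Submodule ℂ P} (h : A ≤ K) : rr A K = 0 := by
  have : A.map K.mkQ = ⊥ := by
    rw [eq_bot_iff]
    rintro _ ⟨a, ha, rfl⟩
    simpa using h ha
  rw [rr, this, finrank_bot]

lemma unit_vec {U : Submodule ℂ V} {α : Module.Dual ℂ V} (h : ¬ U ≤ LinearMap.ker α) :
    ∃ u ∈ U, α u = 1 := by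
  obtain ⟨u, hu, hu'⟩ := Set.not_subset.1 h
  have hu'' : α u ≠ 0 := hu'
  exact ⟨(α u)⁻¹ • u, U.smul_mem _ hu, by simp [hu'']⟩

open Classical in
/-- circuit polynomial -/
def circ (S : Finset J) (c : J → ℂ) : MvPolynomial J ℂ := ∑ j ∈ S, C (c j) * ∏ k ∈ S.erase j, X k

lemma prod_mem_Pq (l : List J) (S : Finset J) (h : ∀ j ∈ S, j ∈ l) : ∏ k ∈ S, (X k : MvPolynomial J ℂ) ∈ Pq l S.card := by
  have := mono_mem (l := l) (m := S.toList) (fun j hj => h j (by simpa using hj))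
  rw [Finset.length_toList] at this
  convert this
  rw [mono, Finset.prod_map_toList]

theorem UB (l : List J) (hl : l.Nodup) (U : Submodule ℂ V) (K : ℕ → Submodule ℂ (MvPolynomial J ℂ))
    (hK : ∀ j ∈ l, ∀ q, ∀ u ∈ K q, X j * u ∈ K (q+1))
    (hc : ∀ S : Finset J, (∀ j ∈ S, j ∈ l) → ∀ c : J → ℂ, (∀ x ∈ U, ∑ j ∈ S, c j * f j x = 0) →
      ∀ k, S.card = k + 1 → circ S c ∈ K k) (q : ℕ) : rr (Pq l q) (K q) ≤ NN f l U q := by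
  classical
  induction l generalizing U K q with
  | nil =>
    rw [Pq_nil, NN]
    split_ifs with h
    · have h1 : Module.finrank ℂ (Submodule.span ℂ {(1 : MvPolynomial J ℂ)}) ≤ 1 := by
        refine (finrank_span_le_card _).trans ?_
        simp
      exact (Submodule.finrank_map_le _ _).trans h1
    · rw [rr_zero_of_le bot_le]
  | cons i l ih =>
    rw [List.nodup_cons] at hl
    rw [NN]
    split_ifs with hloop
    · have h1 : (1 : MvPolynomial J ℂ) ∈ K 0 := by
        have := hc {i} (by simp) (fun _ => 1) (fun x hx => by simpa using hloop hx) 0 (by simp)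
        simpa [circ] using this
      have : Pq (i :: l) q ≤ K q := by
        unfold Pq
        rw [Submodule.span_le]
        rintro _ ⟨m, rfl, h, rfl⟩
        induction m with
        | nil => simpa [mono] using h1
        | cons a m ihm =>
          have := hK a (h a (by simp)) _ _ (ihm (fun j hj => h j (List.mem_cons_of_mem _ hj)))
          simpa [mono] using this
      rw [rr_zero_of_le this]
    · obtain ⟨u0, hu0, hu1⟩ := unit_vec hloop
      let Jd : ℕ → Submodule ℂ (MvPolynomial J ℂ) := fun p =>
        (Pq l (p+1) ⊔ K (p+1)).comap (LinearMap.mulLeft ℂ (X i))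
      have hKl : ∀ j ∈ l, ∀ q, ∀ u ∈ K q, X j * u ∈ K (q+1) := fun j hj => hK j (List.mem_cons_of_mem _ hj)
      have hA := ih hl.2 U K hKl (fun S hS => hc S (fun j hj => List.mem_cons_of_mem _ (hS j hj))) q
      have hB : ∀ p, rr (Pq l p) (Jd p) ≤ NN f l (U ⊓ LinearMap.ker (f i)) p := by
        refine fun p => ih hl.2 _ Jd ?_ ?_ p
        · intro j hj q u hu
          change X i * (X j * u) ∈ Pq l (q+1+1) ⊔ K (q+1+1)
          change X i * u ∈ Pq l (q+1) ⊔ K (q+1) at hu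
          obtain ⟨a, ha, b, hb, hab⟩ := Submodule.mem_sup.1 hu
          rw [mul_left_comm, ← hab, mul_add]
          exact Submodule.add_mem_sup (X_mul_Pq hj ha) (hKl j hj _ _ hb)
        · intro S hS c hrel k hk
          have hiS : i ∉ S := fun h => hl.1 (hS i h)
          let b : ℂ := ∑ j ∈ S, c j * f j u0
          let c' : J → ℂ := fun j => if j = i then -b else c j
          have h1 : ∀ x ∈ U, ∑ j ∈ insert i S, c' j * f j x = 0 := by
            intro x hx
            rw [Finset.sum_insert hiS]
            have h2 := hrel (x - f i x • u0) ⟨U.sub_mem hx (U.smul_mem _ hu0), by simp [hu1]⟩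
            have h3 : ∑ j ∈ S, c' j * f j x = ∑ j ∈ S, c j * f j x := by
              refine Finset.sum_congr rfl fun j hj => ?_
              have : j ≠ i := fun h => hiS (h ▸ hj)
              simp [c', this]
            rw [h3]
            simp only [map_sub, map_smul, smul_eq_mul, mul_sub, Finset.sum_sub_distrib] at h2
            have h4 : ∑ j ∈ S, c j * (f i x * f j u0) = b * f i x := by
              simp only [b]; rw [Finset.sum_mul]; refine Finset.sum_congr rfl fun j _ => by ring
            rw [h4] at h2
            simp only [c', if_true]
            linear_combination h2
          have h2 := hc (insert i S) (by
            intro j hj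
            rcases Finset.mem_insert.1 hj with rfl | hj
            · simp
            · exact List.mem_cons_of_mem _ (hS j hj)) c' h1 (k+1) (by rw [Finset.card_insert_of_notMem hiS, hk])
          have h3 : circ (insert i S) c' = C (-b) * ∏ k ∈ S, X k + X i * circ S c := by
            unfold circ
            rw [Finset.sum_insert hiS, Finset.erase_insert hiS, Finset.mul_sum]
            simp only [c', if_true]
            congr 1
            refine Finset.sum_congr rfl fun j hj => ?_
            have hji : j ≠ i := fun h => hiS (h ▸ hj)
            rw [Finset.erase_insert_of_ne hji.symm, Finset.prod_insert (fun h => hiS (Finset.mem_of_mem_erase h))]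
            simp [hji]; ring
          change X i * circ S c ∈ Pq l (k+1) ⊔ K (k+1)
          have h4 : X i * circ S c = b • ∏ k ∈ S, X k + circ (insert i S) c' := by
            rw [h3, MvPolynomial.smul_eq_C_mul]; simp
          rw [h4]
          refine Submodule.add_mem_sup (Submodule.smul_mem _ _ ?_) h2
          rw [← hk]; exact prod_mem_Pq l S hS
      have hstep : ∀ m ≤ q, rr (Gm i l q m) (K q) ≤ NN f l U q +
          ∑ j ∈ Finset.range m, NN f l (U ⊓ LinearMap.ker (f i)) (q - (j+1)) := by
        intro m
        induction m with
        | zero => intro _; simpa [Gm] using hA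
        | succ m ihm =>
          intro hm
          rw [Finset.sum_range_succ, ← add_assoc, Gm]
          refine (rr_le (J := Jd (q - (m+1))) ?_).trans (Nat.add_le_add (ihm (by omega)) (hB _))
          intro u hu hJ
          change X i * u ∈ Pq l (q-(m+1)+1) ⊔ K (q-(m+1)+1) at hJ
          obtain ⟨a, ha, b, hb, hab⟩ := Submodule.mem_sup.1 hJ
          change X i ^ (m+1) * u ∈ Gm i l q m ⊔ K q
          rw [pow_succ, mul_assoc, ← hab, mul_add]
          have hq : q - (m+1) + 1 = q - m := by omega
          rw [hq] at ha hb
          refine Submodule.add_mem_sup (mem_Gm i l le_rfl ha) ?_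
          have : ∀ k ≤ m, X i ^ k * b ∈ K (q - m + k) := by
            intro k
            induction k with
            | zero => intro _; simpa using hb
            | succ k ihk => intro hk; rw [pow_succ', mul_assoc]; exact hK i (by simp) _ _ (ihk (by omega))
          have := this m le_rfl
          rwa [Nat.sub_add_cancel (by omega)] at this
      rw [Pq_cons]
      refine (hstep q le_rfl).trans (le_of_eq ?_)
      rw [← Finset.sum_range_reflect]
      congr 1
      refine Finset.sum_congr rfl fun j hj => ?_
      rw [Finset.mem_range] at hj
      congr 1; omega

/-- polynomials vanishing at the reciprocals -/
def Van (U : Submodule ℂ V) (l : List J) : Submodule ℂ (MvPolynomial J ℂ) where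
  carrier := {u | ∀ x ∈ U, (∀ j ∈ l, f j x ≠ 0) → eval (fun j => (f j x)⁻¹) u = 0}
  add_mem' := fun ha hb x hx h => by simp [ha x hx h, hb x hx h]
  zero_mem' := fun x hx h => by simp
  smul_mem' := fun c u hu x hx h => by simp [smul_eval, hu x hx h]

lemma mem_Van {U : Submodule ℂ V} {l : List J} {u : MvPolynomial J ℂ} :
    u ∈ Van f U l ↔ ∀ x ∈ U, (∀ j ∈ l, f j x ≠ 0) → eval (fun j => (f j x)⁻¹) u = 0 := Iff.rfl

open Topology Filter in
lemma tend {l : List J} {x u0 : V} (hx : ∀ j ∈ l, f j x ≠ 0) {p : ℕ} {g : MvPolynomial J ℂ} (hg : g ∈ Pq l p) :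
    Tendsto (fun t : ℂ => eval (fun j => (f j (x + t • u0))⁻¹) g) (𝓝[≠] 0) (𝓝 (eval (fun j => (f j x)⁻¹) g)) := by
  refine Tendsto.mono_left ?_ nhdsWithin_le_nhds
  have key : ∀ m : List J, (∀ j ∈ m, j ∈ l) →
      Tendsto (fun t : ℂ => eval (fun j => (f j (x + t • u0))⁻¹) (mono m)) (𝓝 0) (𝓝 (eval (fun j => (f j x)⁻¹) (mono m))) := by
    intro m
    induction m with
    | nil => intro _; simp [mono]
    | cons a m ih =>
      intro h
      have h1 := ih (fun j hj => h j (List.mem_cons_of_mem _ hj))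
      simp only [mono, List.map_cons, List.prod_cons, eval_mul, eval_X] at h1 ⊢
      refine Tendsto.mul ?_ h1
      have h2 : ContinuousAt (fun t : ℂ => (f a (x + t • u0))⁻¹) 0 := by
        simp only [map_add, map_smul]
        refine ContinuousAt.inv₀ (by fun_prop) (by simpa using hx a (h a (by simp)))
      have := h2.tendsto
      simpa using this
  induction hg using Submodule.span_induction with
  | mem u hu => obtain ⟨m, _, h, rfl⟩ := hu; exact key m h
  | zero => simp
  | add a b _ _ ha hb => simpa using ha.add hb
  | smul c a _ ha => simpa [smul_eval] using ha.const_mul c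

open Topology Filter in
lemma ev_ne {l : List J} {x u0 : V} (hx : ∀ j ∈ l, f j x ≠ 0) :
    ∀ᶠ t : ℂ in 𝓝[≠] 0, ∀ j ∈ l, f j (x + t • u0) ≠ 0 := by
  refine Filter.Eventually.filter_mono nhdsWithin_le_nhds ?_
  have : ∀ᶠ t : ℂ in 𝓝 0, ∀ j ∈ {j | j ∈ l}, f j (x + t • u0) ≠ 0 := by
    rw [eventually_all_finite (List.finite_toSet l)]
    intro j hj
    have : ContinuousAt (fun t : ℂ => f j (x + t • u0)) 0 := by
      simp only [map_add, map_smul]; fun_prop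
    exact this.eventually_ne (by simpa using hx j hj)
  exact this

open Topology Filter in
lemma tend_Gm {i : J} {l : List J} {x u0 : V} (hx : ∀ j ∈ l, f j x ≠ 0) (hi : f i x = 0) (hu : f i u0 = 1)
    {q m : ℕ} {w : MvPolynomial J ℂ} (hw : w ∈ Gm i l q m) :
    Tendsto (fun t : ℂ => t ^ (m+1) * eval (fun j => (f j (x + t • u0))⁻¹) w) (𝓝[≠] 0) (𝓝 0) := by
  have ht : Tendsto (fun t : ℂ => t) (𝓝[≠] 0) (𝓝 0) := nhdsWithin_le_nhds
  induction m generalizing w with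
  | zero =>
    have := ht.mul (tend f (u0 := u0) hx hw)
    simpa using this
  | succ m ih =>
    rw [Gm] at hw
    obtain ⟨a, ha, _, ⟨b, hb, rfl⟩, rfl⟩ := Submodule.mem_sup.1 hw
    have h1 := ht.mul (ih ha)
    have h2 := ht.mul (tend f (u0 := u0) hx hb)
    have h3 := h1.add h2
    rw [zero_mul, zero_mul, add_zero] at h3
    refine h3.congr' ?_
    filter_upwards [self_mem_nhdsWithin] with t ht0
    have ht0 : t ≠ 0 := ht0
    simp [hi, hu]
    field_simp
    ring

open Topology Filter in
theorem LB (l : List J) (U : Submodule ℂ V) (q : ℕ) : NN f l U q ≤ rr (Pq l q) (Van f U l) := by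
  classical
  induction l generalizing U q with
  | nil =>
    rw [NN]
    split_ifs with h
    · rw [Pq_nil, if_pos h, rr, Submodule.map_span, Set.image_singleton]
      rw [finrank_span_singleton]
      intro h0
      have h1 : (1 : MvPolynomial J ℂ) ∈ Van f U [] := by simpa using h0
      have := h1 0 U.zero_mem (by simp)
      simp at this
    · exact Nat.zero_le _
  | cons i l ih =>
    rw [NN]
    split_ifs with hloop
    · exact Nat.zero_le _
    · obtain ⟨u0, hu0, hu1⟩ := unit_vec hloop
      set H := U ⊓ LinearMap.ker (f i) with hH
      have hA : NN f l U q ≤ rr (Pq l q) (Van f U (i :: l)) := by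
        refine (ih U q).trans (finrank_map_le_of_ker _ _ _ ?_)
        intro u hu h0
        have h1 : u ∈ Van f U (i :: l) := by simpa using h0
        have h2 : u ∈ Van f U l := by
          intro x hx hxl
          by_cases hxi : f i x = 0
          · have t1 := tend f (u0 := u0) hxl hu
            refine tendsto_nhds_unique t1 (tendsto_const_nhds.congr' ?_)
            filter_upwards [self_mem_nhdsWithin, ev_ne f (u0 := u0) hxl] with t ht0 htl
            refine (h1 _ (U.add_mem hx (U.smul_mem _ hu0)) ?_).symm
            intro j hj
            rcases List.mem_cons.1 hj with rfl | hj
            · simpa [hxi, hu1] using ht0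
            · exact htl j hj
          · exact h1 x hx (by simp [hxi]; exact hxl)
        simpa using h2
      have hstep : ∀ m ≤ q, NN f l U q +
          ∑ j ∈ Finset.range m, NN f l H (q - (j+1)) ≤ rr (Gm i l q m) (Van f U (i :: l)) := by
        intro m
        induction m with
        | zero => intro _; simpa [Gm] using hA
        | succ m ihm =>
          intro hm
          rw [Finset.sum_range_succ, ← add_assoc, Gm]
          refine (Nat.add_le_add (ihm (by omega)) (ih H _)).trans (rr_ge ?_)
          intro u hu hw
          change X i ^ (m+1) * u ∈ Gm i l q m ⊔ Van f U (i::l) at hw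
          obtain ⟨w, hw, b, hb, hab⟩ := Submodule.mem_sup.1 hw
          intro x hx hxl
          have hxi : f i x = 0 := hx.2
          refine tendsto_nhds_unique (tend f (u0 := u0) hxl hu) ((tend_Gm f hxl hxi hu1 hw).congr' ?_)
          filter_upwards [self_mem_nhdsWithin, ev_ne f (u0 := u0) hxl] with t ht0 htl
          have ht0 : t ≠ 0 := ht0
          have h1 := hb (x + t • u0) (U.add_mem hx.1 (U.smul_mem _ hu0)) (by
            intro j hj
            rcases List.mem_cons.1 hj with rfl | hj
            · simpa [hxi, hu1] using ht0
            · exact htl j hj)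
          have h2 := congrArg (eval (fun j => (f j (x + t • u0))⁻¹)) hab
          rw [eval_add, h1, add_zero] at h2
          rw [h2]
          simp [hxi, hu1]
          field_simp
      rw [Pq_cons]
      refine (le_of_eq ?_).trans (hstep q le_rfl)
      rw [← Finset.sum_range_reflect]
      congr 1
      refine Finset.sum_congr rfl fun j hj => ?_
      rw [Finset.mem_range] at hj
      congr 1; omega

theorem rr_eq_NN (l : List J) (hl : l.Nodup) (U : Submodule ℂ V) (q : ℕ) :
    rr (Pq l q) (Van f U l) = NN f l U q := by
  classical
  refine le_antisymm (UB f l hl U (fun _ => Van f U l) ?_ ?_ q) (LB f l U q)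
  · intro j hj q u hu x hx hxl
    rw [eval_mul, hu x hx hxl, mul_zero]
  · intro S hS c hrel k hk x hx hxl
    have h1 := hrel x hx
    unfold circ
    simp only [map_sum, map_mul, eval_C, map_prod, eval_X]
    have h2 : ∀ j ∈ S, c j * ∏ k ∈ S.erase j, (f k x)⁻¹ = (c j * f j x) * ∏ k ∈ S, (f k x)⁻¹ := by
      intro j hj
      rw [← Finset.mul_prod_erase S _ hj]
      have := hxl j (hS j hj)
      field_simp
    rw [Finset.sum_congr rfl h2, ← Finset.sum_mul, h1, zero_mul]

end NN
end Sd

namespace Sd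

lemma van_iff {d n : ℕ} (L : Matrix (Fin (d+1)) (Fin (n+1)) ℂ) (q : ℕ) (u : MvPolynomial (Fin (n+1)) ℂ)
    (hu : u ∈ MvPolynomial.homogeneousSubmodule (Fin (n+1)) ℂ q) :
    u ∈ vanishingIdeal ℂ (coneImage L) ↔ u ∈ Van (colF L) ⊤ (List.finRange (n+1)) := by
  have hhom : ∀ (c : ℂ) (y : Fin (n+1) → ℂ), MvPolynomial.eval (fun i => c * y i) u = c ^ q * MvPolynomial.eval y u := by
    intro c y
    have h : u.IsHomogeneous q := hu
    rw [MvPolynomial.eval_eq, MvPolynomial.eval_eq, Finset.mul_sum]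
    refine Finset.sum_congr rfl fun m hm => ?_
    have hd := h (MvPolynomial.mem_support_iff.1 hm)
    have hd' : ∑ i ∈ m.support, m i = q := by
      rw [← hd, Finsupp.weight_apply, Finsupp.sum]; simp
    simp only [mul_pow, Finset.prod_mul_distrib, Finset.prod_pow_eq_pow_sum, hd']
    ring
  constructor
  · intro h
    -- first the case `x 0 ≠ 0`
    have h1 : ∀ x : Fin (d+1) → ℂ, x 0 ≠ 0 → (∀ j, colF L j x ≠ 0) →
        MvPolynomial.eval (fun j => (colF L j x)⁻¹) u = 0 := by
      intro x h0 hx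
      set y : Fin d → ℂ := fun i => (x 0)⁻¹ * x i.succ with hy
      have hxy : x = x 0 • (Fin.cons 1 y : Fin (d+1) → ℂ) := by
        funext i
        refine Fin.cases ?_ (fun i => ?_) i
        · simp
        · simp [hy, h0]
      have he : ∀ j, colF L j x = x 0 * ell ℂ L y j := by
        intro j
        conv_lhs => rw [hxy]
        rw [map_smul, colF_cons, smul_eq_mul]
      have := h (fun i => (x 0)⁻¹ / ell ℂ L y i) ⟨(x 0)⁻¹, y, fun i hi => hx i (by rw [he, hi, mul_zero]), rfl⟩
      simp only [he, mul_inv]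
      simpa only [div_eq_mul_inv] using this
    intro x _ hx
    by_cases h0 : x 0 = 0
    · have hu' : u ∈ Pq (List.finRange (n+1)) q := by
        rw [Pq_all _ (List.mem_finRange)]; exact hu
      let u0 : Fin (d+1) → ℂ := Pi.single 0 1
      refine tendsto_nhds_unique (tend (colF L) (u0 := u0) hx hu') (tendsto_const_nhds.congr' ?_)
      filter_upwards [self_mem_nhdsWithin, ev_ne (colF L) (u0 := u0) hx] with t ht0 htl
      refine (h1 _ ?_ (fun j => htl j (List.mem_finRange j))).symm
      simpa [u0, h0] using ht0
    · exact h1 x h0 (fun j => hx j (List.mem_finRange j))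
  · rintro h _ ⟨c, x, hx, rfl⟩
    have := h (Fin.cons 1 x) trivial (fun j _ => by rw [colF_cons]; exact hx j)
    simp only [div_eq_mul_inv]
    rw [hhom]
    simp only [colF_cons] at this
    rw [this, mul_zero]

theorem hilb_eq_NN {d n : ℕ} (L : Matrix (Fin (d+1)) (Fin (n+1)) ℂ) (q : ℕ) :
    hilb ℂ (vanishingIdeal ℂ (coneImage L)) q = NN (colF L) (List.finRange (n+1)) ⊤ q := by
  rw [← rr_eq_NN _ _ (List.nodup_finRange _), hilb, rr, Pq_all _ (List.mem_finRange)]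
  refine finrank_map_eq_of_ker _ _ _ fun u hu => ?_
  have := van_iff L q u hu
  simpa [Ideal.Quotient.eq_zero_iff_mem] using this

section aa
variable {V : Type} [AddCommGroup V] [Module ℂ V]
variable {J : Type} (f : J → Module.Dual ℂ V)

lemma finrank_inf_ker [FiniteDimensional ℂ V] {U : Submodule ℂ V} {α : Module.Dual ℂ V}
    (h : ¬ U ≤ LinearMap.ker α) :
    Module.finrank ℂ (U ⊓ LinearMap.ker α : Submodule ℂ V) + 1 = Module.finrank ℂ U := by
  have h1 := LinearMap.finrank_range_add_finrank_ker (α.domRestrict U)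
  have h2 : LinearMap.range (α.domRestrict U) = ⊤ := by
    obtain ⟨u, hu, hu1⟩ := unit_vec h
    rw [LinearMap.range_eq_top]
    intro c
    exact ⟨c • ⟨u, hu⟩, by simp [hu1]⟩
  have h3 : Module.finrank ℂ (LinearMap.ker (α.domRestrict U)) = Module.finrank ℂ (U ⊓ LinearMap.ker α : Submodule ℂ V) := by
    have : (LinearMap.ker (α.domRestrict U)).map U.subtype = U ⊓ LinearMap.ker α := by
      rw [LinearMap.domRestrict, LinearMap.ker_comp, Submodule.map_comap_subtype]
    rw [← this]
    exact (LinearEquiv.finrank_eq (Submodule.equivMapOfInjective _ U.subtype_injective _))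
  rw [h2, finrank_top, Module.finrank_self, h3] at h1
  omega

open Classical in
def aa : List J → Submodule ℂ V → ℕ → ℕ
  | [], _, r => if r = 0 then 1 else 0
  | i :: l, U, r => if U ≤ LinearMap.ker (f i) then 0 else
      aa l U r + (if r = 0 then 0 else aa l (U ⊓ LinearMap.ker (f i)) (r - 1))

open Classical in
def av : List J → Submodule ℂ V → ℕ
  | [], U => if U = ⊥ then 1 else 0
  | i :: l, U => if U ≤ LinearMap.ker (f i) then 0 else av l U + av l (U ⊓ LinearMap.ker (f i))

lemma aa_big [FiniteDimensional ℂ V] (l : List J) (U : Submodule ℂ V) (r : ℕ) (h : Module.finrank ℂ U < r) :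
    aa f l U r = 0 := by
  induction l generalizing U r with
  | nil => simp [aa]; omega
  | cons i l ih =>
    rw [aa]
    by_cases hl : U ≤ LinearMap.ker (f i)
    · rw [if_pos hl]
    · rw [if_neg hl]
      have := finrank_inf_ker hl
      obtain ⟨s, rfl⟩ : ∃ s, r = s + 1 := ⟨r - 1, by omega⟩
      simp [ih U _ h, ih (U ⊓ LinearMap.ker (f i)) s (by omega)]

lemma aa_av [FiniteDimensional ℂ V] (l : List J) (U : Submodule ℂ V) : aa f l U (Module.finrank ℂ U) = av f l U := by
  induction l generalizing U with
  | nil => simp [aa, av, Submodule.finrank_eq_zero]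
  | cons i l ih =>
    rw [aa, av]
    by_cases hl : U ≤ LinearMap.ker (f i)
    · rw [if_pos hl, if_pos hl]
    · rw [if_neg hl, if_neg hl]
      have := finrank_inf_ker hl
      rw [ih, ← this]
      simp [ih]

/-- iterated summation -/
def BB : ℕ → ℕ → ℕ
  | 0, q => if q = 0 then 1 else 0
  | r + 1, q => ∑ p ∈ Finset.range q, BB r p

lemma BB_succ (r q : ℕ) : BB (r+1) (q+1) = q.choose r := by
  induction r generalizing q with
  | zero => rw [BB, Finset.sum_range_succ']; simp [BB]
  | succ r ih =>
    induction q with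
    | zero => rw [BB]; simp [BB]
    | succ q ihq =>
      rw [BB, Finset.sum_range_succ, ih, ← BB, ihq, Nat.choose_succ_succ, add_comm]

lemma NN_eq (l : List J) (U : Submodule ℂ V) (q m : ℕ) (hm : l.length ≤ m) :
    NN f l U q = ∑ r ∈ Finset.range (m+1), aa f l U r * BB r q := by
  induction l generalizing U q m with
  | nil => rw [Finset.sum_range_succ']; simp [NN, aa, BB]
  | cons i l ih =>
    rw [NN]
    split_ifs with hl
    · simp [aa, hl]
    · obtain ⟨m, rfl⟩ : ∃ s, m = s + 1 := ⟨m - 1, by simp at hm; omega⟩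
      simp only [List.length_cons, Nat.add_le_add_iff_right] at hm
      have h1 : ∀ r, aa f (i :: l) U r = aa f l U r + (if r = 0 then 0 else aa f l (U ⊓ LinearMap.ker (f i)) (r - 1)) := by
        intro r; rw [aa, if_neg hl]
      simp only [h1, add_mul, Finset.sum_add_distrib]
      rw [← ih U q (m+1) (by omega)]
      congr 1
      rw [Finset.sum_range_succ']
      simp only [zero_mul, add_zero, if_true, Nat.add_eq_zero_iff, one_ne_zero, and_false, if_false, Nat.add_sub_cancel]
      simp only [fun p => ih (U ⊓ LinearMap.ker (f i)) p m hm]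
      rw [Finset.sum_comm]
      refine Finset.sum_congr rfl fun r _ => ?_
      rw [← Finset.mul_sum, BB]

theorem deg_eq_av {d n : ℕ} (L : Matrix (Fin (d+1)) (Fin (n+1)) ℂ) (k : ℕ)
    (hdeg : IsProjDegree ℂ (vanishingIdeal ℂ (coneImage L)) d k) : k = av (colF L) (List.finRange (n+1)) ⊤ := by
  obtain ⟨P, ⟨N, hN⟩, hPd, hPl⟩ := hdeg
  set a : ℕ → ℕ := aa (colF L) (List.finRange (n+1)) ⊤ with ha
  let Q : Polynomial ℚ := ∑ r ∈ Finset.range (d + n + 2), Polynomial.C ((a (r+1) : ℚ) / (r.factorial : ℚ)) * descPochhammer ℚ r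
  have hQ : ∀ q : ℕ, Q.eval (q : ℚ) = NN (colF L) (List.finRange (n+1)) ⊤ (q+1) := by
    intro q
    rw [NN_eq _ _ _ _ (d+n+2) (by simp; omega), Finset.sum_range_succ']
    simp only [Q, Polynomial.eval_finsetSum, Polynomial.eval_mul, Polynomial.eval_C, BB_succ]
    push_cast
    rw [show BB 0 (q+1) = 0 by simp [BB]]
    simp only [Nat.cast_zero, mul_zero, add_zero]
    refine Finset.sum_congr rfl fun r _ => ?_
    rw [Nat.cast_choose_eq_descPochhammer_div]
    rw [ha]; ring
  have hcomp : P.comp (Polynomial.X + 1) = Q := by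
    refine Polynomial.eq_of_infinite_eval_eq _ _ (Set.Infinite.mono (s := (fun n : ℕ => (n : ℚ)) '' Set.Ici N) ?_ ?_)
    · rintro _ ⟨q, hq, rfl⟩
      have := hN (q+1) (le_trans hq (Nat.le_succ q))
      change (P.comp (Polynomial.X + 1)).eval (q : ℚ) = Q.eval (q : ℚ)
      rw [hQ, ← hilb_eq_NN, ← this]
      simp
    · exact (Set.Ici_infinite N).image (Nat.cast_injective.injOn)
  have hnd : P.natDegree = d := Polynomial.natDegree_eq_of_degree_eq_some hPd
  have h1 : (P.comp (Polynomial.X + 1)).coeff d = P.leadingCoeff := by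
    have e1 : (P.comp (Polynomial.X + Polynomial.C 1)).natDegree = d := by
      rw [Polynomial.natDegree_comp, Polynomial.natDegree_X_add_C, mul_one, hnd]
    have e2 : (P.comp (Polynomial.X + Polynomial.C 1)).leadingCoeff = P.leadingCoeff := by
      rw [Polynomial.leadingCoeff_comp (by rw [Polynomial.natDegree_X_add_C]; simp), Polynomial.leadingCoeff_X_add_C]; simp
    rw [Polynomial.leadingCoeff, e1] at e2
    simpa using e2
  have h2 : Q.coeff d = (a (d+1) : ℚ) / (d.factorial : ℚ) := by
    simp only [Q, Polynomial.finsetSum_coeff, Polynomial.coeff_C_mul]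
    rw [Finset.sum_eq_single d]
    · have := (monic_descPochhammer ℚ d).coeff_natDegree
      rw [descPochhammer_natDegree] at this
      rw [this, mul_one]
    · intro r _ hr
      rcases lt_or_gt_of_ne hr with h | h
      · rw [Polynomial.coeff_eq_zero_of_natDegree_lt, mul_zero]
        rwa [descPochhammer_natDegree]
      · rw [ha, aa_big]
        · simp
        · simp; omega
    · intro h; exact absurd (Finset.mem_range.2 (by omega)) h
  have h3 : (k : ℚ) / (d.factorial : ℚ) = (a (d+1) : ℚ) / (d.factorial : ℚ) := by
    rw [← hPl, ← h1, hcomp, h2]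
  have hf : (d.factorial : ℚ) ≠ 0 := by exact_mod_cast d.factorial_ne_zero
  rw [div_left_inj' hf] at h3
  have h4 : k = a (d+1) := by exact_mod_cast h3
  rw [h4, ha, ← aa_av]
  simp

end aa

theorem no_loop {d n : ℕ} (L : Matrix (Fin (d+1)) (Fin (n+1)) ℂ) (k : ℕ)
    (hdeg : IsProjDegree ℂ (vanishingIdeal ℂ (coneImage L)) d k) (i : Fin (n+1)) : colF L i ≠ 0 := by
  intro hi
  obtain ⟨P, ⟨N, hN⟩, hPd, hPl⟩ := hdeg
  have h0 : ∀ q, hilb ℂ (vanishingIdeal ℂ (coneImage L)) q = 0 := by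
    intro q
    rw [hilb_eq_NN, ← rr_eq_NN _ _ (List.nodup_finRange _)]
    refine rr_zero_of_le fun u _ x _ hx => ?_
    exact absurd (by simp [hi]) (hx i (List.mem_finRange i))
  have : P = 0 := by
    refine Polynomial.eq_of_infinite_eval_eq _ _ (Set.Infinite.mono (s := (fun n : ℕ => (n : ℚ)) '' Set.Ici N) ?_ ?_)
    · rintro _ ⟨q, hq, rfl⟩
      have := hN q hq
      rw [h0] at this
      simpa using this
    · exact (Set.Ici_infinite N).image (Nat.cast_injective.injOn)
  rw [this] at hPd
  simp at hPd

end Sd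

namespace Sd

section comb
variable {V : Type} [AddCommGroup V] [Module ℂ V]
variable {J : Type} (f : J → Module.Dual ℂ V) (e : Module.Dual ℂ V)

/-- the functionals in `l` have no common zero in `U` -/
def Spn (l : List J) (U : Submodule ℂ V) : Prop := ∀ x ∈ U, (∀ j ∈ l, f j x = 0) → x = 0

def NoLoop (l : List J) (U : Submodule ℂ V) : Prop := ∀ j ∈ l, ¬ U ≤ LinearMap.ker (f j)

def Cond (l : List J) (U : Submodule ℂ V) : Prop :=
  ∀ I : Set J, (∀ j ∈ I, j ∈ l) → (∀ x ∈ U, (∀ j ∈ I, f j x = 0) → e x = 0) →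
    ∀ x ∈ U, (∀ j ∈ I, f j x = 0) → x = 0

lemma cond_cons (i : J) (l : List J) (U : Submodule ℂ V) :
    Cond f e (i :: l) U ↔ Cond f e l U ∧ Cond f e l (U ⊓ LinearMap.ker (f i)) := by
  constructor
  · intro h
    refine ⟨fun I hI => h I (fun j hj => List.mem_cons_of_mem _ (hI j hj)), fun I hI h1 x hx h2 => ?_⟩
    refine h (insert i I) ?_ ?_ x hx.1 ?_
    · rintro j (rfl | hj)
      · simp
      · exact List.mem_cons_of_mem _ (hI j hj)
    · intro y hy h3
      exact h1 y ⟨hy, h3 i (Set.mem_insert _ _)⟩ (fun j hj => h3 j (Set.mem_insert_of_mem _ hj))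
    · rintro j (rfl | hj)
      · exact hx.2
      · exact h2 j hj
  · rintro ⟨hA, hB⟩ I hI h1 x hx h2
    by_cases hi : i ∈ I
    · refine hB (I \ {i}) ?_ ?_ x ⟨hx, h2 i hi⟩ (fun j hj => h2 j hj.1)
      · rintro j ⟨hj, hj'⟩
        rcases List.mem_cons.1 (hI j hj) with h | h
        · exact absurd h hj'
        · exact h
      · intro y hy h3
        refine h1 y hy.1 fun j hj => ?_
        by_cases hji : j = i
        · rw [hji]; exact hy.2
        · exact h3 j ⟨hj, hji⟩
    · refine hA I (fun j hj => ?_) h1 x hx h2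
      rcases List.mem_cons.1 (hI j hj) with h | h
      · exact absurd (h ▸ hj) hi
      · exact h

lemma chi_loop (l : List J) (U : Submodule ℂ V) (h : ¬ NoLoop f l U) : chi f e l U = 0 := by
  induction l generalizing U with
  | nil => exact absurd (fun j hj => by simp at hj) h
  | cons i l ih =>
    rw [chi]
    split_ifs with h1 h2
    · rfl
    · refine ih U fun h3 => h fun j hj => ?_
      rcases List.mem_cons.1 hj with rfl | hj
      · exact h1
      · exact h3 j hj
    · rw [ih U, ih (U ⊓ LinearMap.ker (f i)), sub_zero]
      · refine fun h3 => h fun j hj => ?_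
        rcases List.mem_cons.1 hj with rfl | hj
        · exact h1
        · exact fun h4 => h3 j hj (inf_le_left.trans h4)
      · refine fun h3 => h fun j hj => ?_
        rcases List.mem_cons.1 hj with rfl | hj
        · exact h1
        · exact h3 j hj

lemma av_loop (l : List J) (U : Submodule ℂ V) (h : ¬ NoLoop f l U) : av f l U = 0 := by
  induction l generalizing U with
  | nil => exact absurd (fun j hj => by simp at hj) h
  | cons i l ih =>
    rw [av]
    split_ifs with h1
    · rfl
    · rw [ih U, ih (U ⊓ LinearMap.ker (f i))]
      · refine fun h3 => h fun j hj => ?_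
        rcases List.mem_cons.1 hj with rfl | hj
        · exact h1
        · exact fun h4 => h3 j hj (inf_le_left.trans h4)
      · refine fun h3 => h fun j hj => ?_
        rcases List.mem_cons.1 hj with rfl | hj
        · exact h1
        · exact h3 j hj

lemma av_not_spn (l : List J) (U : Submodule ℂ V) (h : ¬ Spn f l U) : av f l U = 0 := by
  have : ∃ w ∈ U, (∀ j ∈ l, f j w = 0) ∧ w ≠ 0 := by
    unfold Spn at h; push Not at h; exact h
  obtain ⟨w, hw, hl, h0⟩ := this
  clear h
  induction l generalizing U with
  | nil => rw [av, if_neg]; rintro rfl; exact h0 (by simpa using hw)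
  | cons i l ih =>
    have hl' : ∀ j ∈ l, f j w = 0 := fun j hj => hl j (List.mem_cons_of_mem _ hj)
    rw [av, ih U hw hl', ih (U ⊓ LinearMap.ker (f i)) ⟨hw, hl i (by simp)⟩ hl']
    simp

lemma chi_C1 (l : List J) (hl0 : l ≠ []) (U : Submodule ℂ V) {w : V} (hw : w ∈ U) (hl : ∀ j ∈ l, f j w = 0)
    (he : e w ≠ 0) : chi f e l U = 0 := by
  induction l generalizing U with
  | nil => exact absurd rfl hl0
  | cons i l ih =>
    have hl' : ∀ j ∈ l, f j w = 0 := fun j hj => hl j (List.mem_cons_of_mem _ hj)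
    have hi : f i w = 0 := hl i (by simp)
    rw [chi]
    split_ifs with h1 h2
    · rfl
    · exfalso
      apply h1
      intro x hx
      have h3 : x - (e x / e w) • w ∈ U ⊓ LinearMap.ker e := by
        refine ⟨U.sub_mem hx (U.smul_mem _ hw), ?_⟩
        simp [he]
      have := h2 h3
      simpa [hi] using this
    · by_cases hn : l = []
      · subst hn
        rw [chi, chi, if_neg (fun h => he (h hw)), if_neg, sub_self]
        exact fun h => he (h ⟨hw, hi⟩)
      · rw [ih hn U hw hl', ih hn (U ⊓ LinearMap.ker (f i)) ⟨hw, hi⟩ hl', sub_self]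

lemma le_ker_iff_of_w {U : Submodule ℂ V} {α β : Module.Dual ℂ V} {w : V} (hw : w ∈ U) (hα : α w ≠ 0) (hβ : β w = 0) :
    U ⊓ LinearMap.ker α ≤ LinearMap.ker β ↔ U ≤ LinearMap.ker β := by
  refine ⟨fun h x hx => ?_, fun h => inf_le_left.trans h⟩
  have h3 : x - (α x / α w) • w ∈ U ⊓ LinearMap.ker α := by
    refine ⟨U.sub_mem hx (U.smul_mem _ hw), ?_⟩
    simp [hα]
  have := h h3
  simpa [hβ] using this

lemma chi_C2 (l : List J) (U : Submodule ℂ V) {w : V} (hw : w ∈ U) (hl : ∀ j ∈ l, f j w = 0)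
    (he : e w = 0) {α : Module.Dual ℂ V} (hα : α w ≠ 0) : chi f e l (U ⊓ LinearMap.ker α) = chi f e l U := by
  induction l generalizing U with
  | nil => rw [chi, chi, le_ker_iff_of_w hw hα he]
  | cons i l ih =>
    have hl' : ∀ j ∈ l, f j w = 0 := fun j hj => hl j (List.mem_cons_of_mem _ hj)
    have hi : f i w = 0 := hl i (by simp)
    rw [chi, chi, le_ker_iff_of_w hw hα hi, inf_right_comm, le_ker_iff_of_w (U := U ⊓ LinearMap.ker e) ⟨hw, he⟩ hα hi,
      inf_right_comm, ih U hw hl', ih (U ⊓ LinearMap.ker (f i)) ⟨hw, hi⟩ hl']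

lemma coloop {i : J} {l : List J} {U : Submodule ℂ V} (hS : Spn f (i :: l) U) (h : ¬ Spn f l U) :
    ∃ w ∈ U, (∀ j ∈ l, f j w = 0) ∧ w ≠ 0 ∧ f i w ≠ 0 := by
  have : ∃ w ∈ U, (∀ j ∈ l, f j w = 0) ∧ w ≠ 0 := by
    unfold Spn at h; push Not at h; exact h
  obtain ⟨w, hw, hl, h0⟩ := this
  refine ⟨w, hw, hl, h0, fun hi => h0 (hS w hw ?_)⟩
  intro j hj
  rcases List.mem_cons.1 hj with rfl | hj
  · exact hi
  · exact hl j hj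

lemma spn_inf {i : J} {l : List J} {U : Submodule ℂ V} (hS : Spn f (i :: l) U) : Spn f l (U ⊓ LinearMap.ker (f i)) := by
  intro x hx h
  refine hS x hx.1 fun j hj => ?_
  rcases List.mem_cons.1 hj with rfl | hj
  · exact hx.2
  · exact h j hj

lemma noloop_tail {i : J} {l : List J} {U : Submodule ℂ V} (hN : NoLoop f (i :: l) U) : NoLoop f l U :=
  fun j hj => hN j (List.mem_cons_of_mem _ hj)

lemma noloop_coloop {i : J} {l : List J} {U : Submodule ℂ V} (hN : NoLoop f (i :: l) U) {w : V} (hw : w ∈ U)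
    (hl : ∀ j ∈ l, f j w = 0) (hi : f i w ≠ 0) : NoLoop f l (U ⊓ LinearMap.ker (f i)) := by
  intro j hj h
  rw [le_ker_iff_of_w hw hi (hl j hj)] at h
  exact noloop_tail f hN j hj h

lemma av_pos (l : List J) (U : Submodule ℂ V) (hN : NoLoop f l U) (hS : Spn f l U) : 0 < av f l U := by
  induction l generalizing U with
  | nil =>
    rw [av, if_pos]
    · simp
    · rw [eq_bot_iff]; intro x hx; simpa using hS x hx (by simp)
  | cons i l ih =>
    rw [av, if_neg (hN i (by simp))]
    by_cases hS' : Spn f l U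
    · have := ih U (noloop_tail f hN) hS'; omega
    · obtain ⟨w, hw, hl, -, hi⟩ := coloop f hS hS'
      have := ih _ (noloop_coloop f hN hw hl hi) (spn_inf f hS)
      omega

/-- two hyperplanes of `U` with an inclusion agree -/
lemma hyper_symm {U : Submodule ℂ V} {α β : Module.Dual ℂ V} (hβ : ¬ U ≤ LinearMap.ker β)
    (h : U ⊓ LinearMap.ker α ≤ LinearMap.ker β) : U ⊓ LinearMap.ker β ≤ LinearMap.ker α := by
  rintro x ⟨hx, hx'⟩
  have hx'' : β x = 0 := hx'
  obtain ⟨u, hu, hu1⟩ := unit_vec hβ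
  by_contra hax
  have hax' : α x ≠ 0 := hax
  have h3 : u - (α u / α x) • x ∈ U ⊓ LinearMap.ker α := by
    refine ⟨U.sub_mem hu (U.smul_mem _ hx), ?_⟩
    simp [hax']
  have := h h3
  simp [hx'', hu1] at this

lemma dim_one_inf [FiniteDimensional ℂ V] {U : Submodule ℂ V} (h1 : Module.finrank ℂ U = 1) {α : Module.Dual ℂ V}
    (h : ¬ U ≤ LinearMap.ker α) : U ⊓ LinearMap.ker α = ⊥ := by
  have := finrank_inf_ker h
  rw [← Submodule.finrank_eq_zero (R := ℂ)]
  omega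

lemma chi_dim_one [FiniteDimensional ℂ V] (l : List J) (U : Submodule ℂ V) (h1 : Module.finrank ℂ U = 1)
    (hN : NoLoop f l U) (he : ¬ U ≤ LinearMap.ker e) : chi f e l U = 1 := by
  induction l with
  | nil => rw [chi, if_neg he]
  | cons i l ih =>
    rw [chi, if_neg (hN i (by simp)), if_pos, ih (noloop_tail f hN)]
    rw [dim_one_inf h1 he]; exact bot_le

lemma av_dim_one [FiniteDimensional ℂ V] (l : List J) (hl : l ≠ []) (U : Submodule ℂ V) (h1 : Module.finrank ℂ U = 1)
    (hN : NoLoop f l U) : av f l U = 1 := by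
  induction l with
  | nil => exact absurd rfl hl
  | cons i l ih =>
    rw [av, if_neg (hN i (by simp)), dim_one_inf h1 (hN i (by simp))]
    cases l with
    | nil =>
      rw [av, av, if_neg, if_pos rfl]
      rintro rfl
      simp at h1
    | cons j l =>
      rw [ih (by simp) (noloop_tail f hN), av_loop f (j :: l) ⊥]
      exact fun h => h j (by simp) bot_le

theorem main_comb [FiniteDimensional ℂ V] (l : List J) (U : Submodule ℂ V) (hN : NoLoop f l U) (hS : Spn f l U)
    (he : ¬ U ≤ LinearMap.ker e) :
    (-1) ^ (Module.finrank ℂ U + 1) * chi f e l U ≤ (av f l U : ℤ) ∧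
      ((-1) ^ (Module.finrank ℂ U + 1) * chi f e l U = (av f l U : ℤ) ↔ Cond f e l U) := by
  induction l generalizing U with
  | nil =>
    exfalso
    apply he
    intro x hx
    rw [hS x hx (by simp)]; simp
  | cons i l ih =>
    obtain ⟨u, hu, hu1⟩ := unit_vec he
    have hne : Module.finrank ℂ U ≠ 0 := by
      intro h
      rw [Submodule.finrank_eq_zero] at h
      rw [h] at hu
      simp at hu
      simp [hu] at hu1
    by_cases h1 : Module.finrank ℂ U = 1
    · rw [chi_dim_one f e _ U h1 hN he, av_dim_one f _ (by simp) U h1 hN, h1]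
      refine ⟨by norm_num, fun _ => ?_, fun _ => by norm_num⟩
      intro I _ h2 x hx h3
      have h4 : x ∈ U ⊓ LinearMap.ker e := ⟨hx, h2 x hx h3⟩
      rw [dim_one_inf h1 he] at h4
      simpa using h4
    have hi : ¬ U ≤ LinearMap.ker (f i) := hN i (by simp)
    have hdim := finrank_inf_ker hi
    have hl0 : l ≠ [] := by
      rintro rfl
      have : U ⊓ LinearMap.ker (f i) = ⊥ := by
        rw [eq_bot_iff]
        intro x hx
        simpa using spn_inf f hS x hx (by simp)
      rw [this, finrank_bot] at hdim
      omega
    have hNt := noloop_tail f hN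
    have hSi := spn_inf f hS
    set W := U ⊓ LinearMap.ker (f i) with hW
    have hav : av f (i :: l) U = av f l U + av f l W := by rw [av, if_neg hi]
    have hpos : 0 < av f (i :: l) U := av_pos f _ U hN hS
    -- a loop after restriction is parallel to `f i`
    have hpar : ¬ NoLoop f l W → ∃ j ∈ l, U ⊓ LinearMap.ker (f j) ≤ LinearMap.ker (f i) ∧ W ≤ LinearMap.ker (f j) := by
      intro h
      unfold NoLoop at h
      push Not at h
      obtain ⟨j, hj, h⟩ := h
      exact ⟨j, hj, hyper_symm (hNt j hj) h, h⟩
    by_cases hp : U ⊓ LinearMap.ker e ≤ LinearMap.ker (f i)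
    · -- parallel to infinity
      have hp' : W ≤ LinearMap.ker e := hyper_symm hi hp
      have hchi : chi f e (i :: l) U = chi f e l U := by rw [chi, if_neg hi, if_pos hp]
      have hWne : W ≠ ⊥ := by
        intro h
        rw [h, finrank_bot] at hdim
        omega
      obtain ⟨y, hy, hy0⟩ := Submodule.exists_mem_ne_zero_of_ne_bot hWne
      have hcond : ¬ Cond f e (i :: l) U := by
        intro h
        apply hy0
        refine h {i} (by simp) ?_ y hy.1 ?_
        · intro x hx h
          exact hp' ⟨hx, h i rfl⟩
        · rintro j rfl; exact hy.2
      suffices hlt : (-1) ^ (Module.finrank ℂ U + 1) * chi f e (i :: l) U < (av f (i :: l) U : ℤ) from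
        ⟨hlt.le, fun h => absurd h hlt.ne, fun h => absurd h hcond⟩
      by_cases hSl : Spn f l U
      · obtain ⟨hle, heq⟩ := ih U hNt hSl he
        rw [hchi, hav]
        push_cast
        by_cases hNl : NoLoop f l W
        · have := av_pos f l W hNl hSi
          omega
        · obtain ⟨j, hj, hj1, hj2⟩ := hpar hNl
          have hc : ¬ Cond f e l U := by
            intro h
            apply hy0
            refine h {j} (by simpa using hj) ?_ y hy.1 ?_
            · intro x hx h
              exact hp' ⟨hx, hj1 ⟨hx, h j rfl⟩⟩
            · rintro k rfl; exact hj2 hy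
          have := lt_of_le_of_ne hle (fun h => hc (heq.1 h))
          omega
      · obtain ⟨w, hw, hwl, -, hwi⟩ := coloop f hS hSl
        have hew : e w ≠ 0 := fun h => hwi (hp ⟨hw, h⟩)
        rw [hchi, chi_C1 f e l hl0 U hw hwl hew, mul_zero]
        exact_mod_cast hpos
    · have heW : ¬ W ≤ LinearMap.ker e := fun h => hp (hyper_symm he h)
      have hchi : chi f e (i :: l) U = chi f e l U - chi f e l W := by rw [chi, if_neg hi, if_neg hp]
      have hsg : (-1 : ℤ) ^ (Module.finrank ℂ U + 1) * chi f e (i :: l) U =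
          (-1) ^ (Module.finrank ℂ U + 1) * chi f e l U + (-1) ^ (Module.finrank ℂ W + 1) * chi f e l W := by
        rw [hchi, ← hdim]; ring
      rw [cond_cons, ← hW]
      by_cases hSl : Spn f l U
      · obtain ⟨hle, heq⟩ := ih U hNt hSl he
        rw [hsg, hav]
        push_cast
        by_cases hNl : NoLoop f l W
        · obtain ⟨hle', heq'⟩ := ih W hNl hSi heW
          rw [← heq, ← heq']
          refine ⟨by linarith, fun h => ⟨by linarith, by linarith⟩, fun h => by linarith⟩
        · rw [chi_loop f e l W hNl, av_loop f l W hNl, ← heq]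
          simp only [mul_zero, add_zero, Nat.cast_zero]
          refine ⟨hle, fun h => ⟨h, ?_⟩, fun h => h.1⟩
          have hc := heq.1 h
          obtain ⟨j, hj, hj1, hj2⟩ := hpar hNl
          intro I hI h1 x hx h2
          refine hc (insert j I) ?_ ?_ x hx.1 ?_
          · rintro k (rfl | hk)
            · exact hj
            · exact hI k hk
          · intro y hy h3
            exact h1 y ⟨hy, hj1 ⟨hy, h3 j (Set.mem_insert _ _)⟩⟩ (fun k hk => h3 k (Set.mem_insert_of_mem _ hk))
          · rintro k (rfl | hk)
            · exact hj2 hx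
            · exact h2 k hk
      · obtain ⟨w, hw, hwl, hw0, hwi⟩ := coloop f hS hSl
        have hNl := noloop_coloop f hN hw hwl hwi
        by_cases hew : e w = 0
        · have h0 : chi f e (i :: l) U = 0 := by
            rw [hchi, hW, chi_C2 f e l U hw hwl hew hwi, sub_self]
          have hlt : (-1) ^ (Module.finrank ℂ U + 1) * chi f e (i :: l) U < (av f (i :: l) U : ℤ) := by
            rw [h0, mul_zero]; exact_mod_cast hpos
          refine ⟨hlt.le, fun h => absurd h hlt.ne, fun h => absurd ?_ hw0⟩
          refine h.1 {j | j ∈ l} (fun _ h => h) ?_ w hw hwl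
          intro v hv hvl
          have h5 : v - (f i v / f i w) • w = 0 := by
            refine hS _ (U.sub_mem hv (U.smul_mem _ hw)) fun j hj => ?_
            rcases List.mem_cons.1 hj with rfl | hj
            · simp [hwi]
            · simp [hwl j hj, hvl j hj]
          have h6 := congrArg e h5
          simpa [hew] using h6
        · obtain ⟨hle', heq'⟩ := ih W hNl hSi heW
          rw [hsg, hav, chi_C1 f e l hl0 U hw hwl hew, av_not_spn f l U hSl]
          simp only [mul_zero, zero_add]
          refine ⟨hle', fun h => ⟨?_, heq'.1 h⟩, fun h => heq'.2 h.2⟩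
          intro I hI h1
          exact absurd (h1 w hw (fun j hj => hwl j (hI j hj))) hew

end comb

section transl
variable {n : ℕ} (L : Matrix (Fin (d+1)) (Fin (n+1)) ℂ)

/-- columns -/
def colV (i : Fin (n+1)) : Fin (d+1) → ℂ := fun r => L r i

lemma colF_apply (i : Fin (n+1)) (x : Fin (d+1) → ℂ) : colF L i x = ∑ r, x r * L r i := by
  simp [colF, Fintype.linearCombination_apply]

lemma mem_span_iff (I : Set (Fin (n+1))) (v : Fin (d+1) → ℂ) :
    v ∈ Submodule.span ℂ (colV L '' I) ↔ ∀ x : Fin (d+1) → ℂ, (∀ i ∈ I, colF L i x = 0) → ∑ r, x r * v r = 0 := by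
  constructor
  · intro hv x hx
    induction hv using Submodule.span_induction with
    | mem u hu => obtain ⟨i, hi, rfl⟩ := hu; rw [← hx i hi, colF_apply]; rfl
    | zero => simp
    | add a b _ _ ha hb => simp [mul_add, Finset.sum_add_distrib, ha, hb]
    | smul c a _ ha =>
      have : ∑ r, x r * (c • a) r = c * ∑ r, x r * a r := by
        rw [Finset.mul_sum]; refine Finset.sum_congr rfl fun r _ => by simp; ring
      rw [this, ha, mul_zero]
  · intro h
    let K : Module.Dual ℂ (Fin (d+1) → ℂ) := Fintype.linearCombination ℂ v
    have hK : ∀ x, K x = ∑ r, x r * v r := fun x => by simp [K, Fintype.linearCombination_apply]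
    have h1 : K ∈ Submodule.span ℂ (Set.range (fun i : I => colF L i)) := by
      apply mem_span_of_iInf_ker_le_ker
      intro x hx
      rw [Submodule.mem_iInf] at hx
      change K x = 0
      rw [hK]
      exact h x (fun i hi => hx ⟨i, hi⟩)
    let T : Module.Dual ℂ (Fin (d+1) → ℂ) →ₗ[ℂ] (Fin (d+1) → ℂ) :=
      { toFun := fun g r => g (Pi.single r 1)
        map_add' := fun _ _ => rfl
        map_smul' := fun _ _ => rfl }
    have h2 : T K ∈ (Submodule.span ℂ (Set.range (fun i : I => colF L i))).map T := ⟨K, h1, rfl⟩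
    have h3 : T K = v := by
      funext r
      change K (Pi.single r 1) = v r
      rw [hK]; simp [Pi.single_apply]
    rw [h3, Submodule.map_span] at h2
    refine Submodule.span_mono ?_ h2
    rintro _ ⟨_, ⟨i, rfl⟩, rfl⟩
    refine ⟨i, i.2, ?_⟩
    funext r
    change L r i = colF L i (Pi.single r 1)
    rw [colF_apply]; simp [Pi.single_apply]

lemma rk_eq_iff (I : Set (Fin (n+1))) :
    rkA ℂ L I = rkL ℂ L I ↔ (Pi.single 0 1 : Fin (d+1) → ℂ) ∉ Submodule.span ℂ (colV L '' I) := by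
  let π : (Fin (d+1) → ℂ) →ₗ[ℂ] (Fin d → ℂ) := LinearMap.funLeft ℂ ℂ Fin.succ
  set S := Submodule.span ℂ (colV L '' I) with hS
  have hA : rkA ℂ L I = Module.finrank ℂ (S.map π) := by
    rw [rkA, hS, Submodule.map_span, Set.image_image]; rfl
  have hL : rkL ℂ L I = Module.finrank ℂ S := rfl
  have h1 := LinearMap.finrank_range_add_finrank_ker (π.domRestrict S)
  rw [LinearMap.range_domRestrict] at h1
  rw [hA, hL]
  have h2 : Module.finrank ℂ (S.map π) = Module.finrank ℂ S ↔ LinearMap.ker (π.domRestrict S) = ⊥ := by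
    rw [← Submodule.finrank_eq_zero (R := ℂ)]; omega
  rw [h2, LinearMap.ker_eq_bot']
  constructor
  · intro h hmem
    have := h ⟨_, hmem⟩ (by
      funext k
      change (Pi.single 0 1 : Fin (d+1) → ℂ) k.succ = 0
      simp)
    have h3 := congrFun (congrArg Subtype.val this) 0
    simp at h3
  · rintro h ⟨x, hx⟩ h0
    have h3 : ∀ k : Fin d, x k.succ = 0 := fun k => congrFun h0 k
    have h4 : x = x 0 • (Pi.single 0 1 : Fin (d+1) → ℂ) := by
      funext r
      refine Fin.cases (by simp) (fun k => by simp [h3]) r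
    by_cases hx0 : x 0 = 0
    · apply Subtype.ext
      rw [hx0, zero_smul] at h4
      exact h4
    · exfalso
      apply h
      have := S.smul_mem (x 0)⁻¹ hx
      rw [h4] at this
      simpa [hx0, smul_smul] using this

lemma spn_of_rank (hrank : L.rank = d + 1) : Spn (colF L) (List.finRange (n+1)) ⊤ := by
  intro x _ hx
  have h1 : L.transpose.rank = d + 1 := by rw [Matrix.rank_transpose, hrank]
  have h2 := LinearMap.finrank_range_add_finrank_ker (L.transpose.mulVecLin)
  rw [Matrix.rank] at h1
  rw [h1] at h2
  simp only [Module.finrank_fin_fun] at h2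
  have h3 : LinearMap.ker (L.transpose.mulVecLin) = ⊥ := by
    rw [← Submodule.finrank_eq_zero (R := ℂ)]; omega
  rw [LinearMap.ker_eq_bot'] at h3
  apply h3
  funext i
  have := hx i (List.mem_finRange i)
  rw [colF_apply] at this
  simp only [Matrix.mulVecLin_apply, Matrix.mulVec, dotProduct, Matrix.transpose_apply, Pi.zero_apply]
  rw [← this]
  exact Finset.sum_congr rfl fun r _ => mul_comm _ _

lemma cond_iff (hrank : L.rank = d + 1) :
    Cond (colF L) (e0F d) (List.finRange (n+1)) ⊤ ↔
      ∀ I : Set (Fin (n+1)), IsFlat ℂ L I → I ≠ Set.univ → rkA ℂ L I = rkL ℂ L I := by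
  have hS := spn_of_rank L hrank
  have he0 : ∀ x : Fin (d+1) → ℂ, ∑ r, x r * (Pi.single 0 1 : Fin (d+1) → ℂ) r = e0F d x := by
    intro x; simp [e0F, Pi.single_apply]
  constructor
  · intro hc I hI hne
    rw [rk_eq_iff, mem_span_iff]
    intro h
    obtain ⟨i, hi⟩ := (Set.ne_univ_iff_exists_notMem I).1 hne
    have h0 := hc I (fun j _ => List.mem_finRange j) (fun x _ hx => by rw [← he0]; exact h x hx)
    have hmem : colV L i ∈ Submodule.span ℂ (colV L '' I) := by
      rw [mem_span_iff]
      intro x hx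
      rw [h0 x trivial hx]; simp
    have h1 := hI i hi
    have h2 : Submodule.span ℂ (colV L '' (insert i I)) = Submodule.span ℂ (colV L '' I) := by
      rw [Set.image_insert_eq, Submodule.span_insert_eq_span hmem]
    have h3 : rkL ℂ L (insert i I) = rkL ℂ L I := by
      change Module.finrank ℂ (Submodule.span ℂ (colV L '' (insert i I))) = Module.finrank ℂ (Submodule.span ℂ (colV L '' I))
      rw [h2]
    omega
  · intro hf I _ h x _ hx
    set F : Set (Fin (n+1)) := {i | colV L i ∈ Submodule.span ℂ (colV L '' I)} with hF
    have hspan : Submodule.span ℂ (colV L '' F) = Submodule.span ℂ (colV L '' I) := by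
      apply le_antisymm
      · rw [Submodule.span_le]
        rintro _ ⟨i, hi, rfl⟩
        exact hi
      · apply Submodule.span_mono
        apply Set.image_mono
        intro i hi
        exact Submodule.subset_span ⟨i, hi, rfl⟩
    have hflat : IsFlat ℂ L F := by
      intro i hi
      apply Submodule.finrank_lt_finrank_of_lt
      refine lt_of_le_of_ne (Submodule.span_mono (Set.image_mono (Set.subset_insert _ _))) ?_
      intro heq
      apply hi
      have h1 : colV L i ∈ Submodule.span ℂ (colV L '' (insert i F)) := Submodule.subset_span ⟨i, Set.mem_insert _ _, rfl⟩
      have h2 : Submodule.span ℂ (colV L '' F) = Submodule.span ℂ (colV L '' (insert i F)) := heq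
      rw [← h2, hspan] at h1
      exact h1
    have huniv : F = Set.univ := by
      by_contra hne
      have := hf F hflat hne
      rw [rk_eq_iff, hspan, mem_span_iff] at this
      apply this
      intro y hy
      rw [he0]
      exact h y trivial hy
    refine hS x trivial fun i _ => ?_
    have hi : i ∈ F := by rw [huniv]; trivial
    have := (mem_span_iff L I _).1 hi x hx
    rw [colF_apply]
    exact this

end transl

theorem main_thm {d n : ℕ} (L : Matrix (Fin (d+1)) (Fin (n+1)) ℂ) (hrank : L.rank = d + 1)
    (k : ℕ) (hdeg : IsProjDegree ℂ (vanishingIdeal ℂ (coneImage L)) d k) :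
    (-1) ^ d * eulerChar ↥(complementX L) = (k : ℤ) ↔
      ∀ I : Set (Fin (n+1)), IsFlat ℂ L I → I ≠ Set.univ → rkA ℂ L I = rkL ℂ L I := by
  have h := (main_comb (colF L) (e0F d) (List.finRange (n+1)) ⊤ ?_ (spn_of_rank L hrank) ?_).2
  · rw [← cond_iff L hrank, ← h, deg_eq_av L k hdeg, eulerChar_complement]
    have : Module.finrank ℂ (⊤ : Submodule ℂ (Fin (d+1) → ℂ)) = d + 1 := by simp
    rw [this, show (-1 : ℤ) ^ (d+1+1) = (-1) ^ d by ring]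
  · intro j _ hj
    apply no_loop L k hdeg j
    rwa [top_le_iff, LinearMap.ker_eq_top] at hj
  · intro hj
    have := hj (show (Pi.single 0 1 : Fin (d+1) → ℂ) ∈ ⊤ from trivial)
    simp [e0F] at this

end Sd

/-- Corollary 3.7.  For `rank L = d+1`, the equality
`(-1)^d ⋅ χ(X) = deg ℛ_L` holds iff `rank A_I^⊤ = rank L_I` for every flat
`I ≠ {0,…,n}` of `M(L)`. -/
theorem signed_euler_eq_reciprocal_degree_iff
    {d n : ℕ} (L : Matrix (Fin (d+1)) (Fin (n+1)) ℂ) (hrank : L.rank = d + 1)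
    (k : ℕ) (hdeg : IsProjDegree ℂ (vanishingIdeal ℂ (coneImage L)) d k) :
    (-1) ^ d * eulerChar ↥(complementX L) = (k : ℤ) ↔
      ∀ I : Set (Fin (n+1)), IsFlat ℂ L I → I ≠ Set.univ → rkA ℂ L I = rkL ℂ L I :=
  Sd.main_thm L hrank k hdeg

end ScatteringPaper
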